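/- Let N ≥ 3 and let B be the open unit ball in ℝ^N. Suppose k : ℝ^N → ℝ satisfies: (k1) k is nonnegative, not identically zero, radial, and α-Hölder continuous on the closed unit ball for some α ∈ (0,1]; (k2) there exist β > 0 and constants C₀, δ₀ > 0 with k(x) ≤ C₀|x|^β for all |x| ≤ δ₀; (k3) there exist γ ≥ β and constants C, δ > 0 with k(x) ≥ C|x|^γ for all 0 < |x| < δ. Suppose f : ℝ → ℝ satisfies: (f1) f is Hölder continuous on every compact interval, f(t) ≥ 0 for t > 0 and f(t) = 0 for t ≤ 0; (f2) f(t)/t → 0 as t → 0⁺ and f(t)/t^q → 0 as t → ∞, where q = (N+2+2β)/(N−2); (f3) there exists θ > 2 with t·f(t) ≥ θ·F(t) for all t ≥ 0, where F(t) = ∫₀ᵗ f(s) ds; (f4) f(t)/t^p → ∞ as t → ∞, where p = max{1, (2γ+6−N)/(N−2)}. Then for every λ > 0 there exists a radial function u, continuous on the closed unit ball and twice continuously differentiable on B, with u > 0 in B, u = 0 on the unit sphere, satisfying −Δu(x) = u(x)^((N+2)/(N−2)) + λ·k(x)·f(u(x)) for all x ∈ B. -/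

import Mathlib

open scoped NNReal
open MeasureTheory Filter Set Metric

noncomputable def laplacian {N : ℕ} (u : EuclideanSpace ℝ (Fin N) → ℝ)
    (x : EuclideanSpace ℝ (Fin N)) : ℝ :=
  ∑ i, fderiv ℝ (fun y => fderiv ℝ u y (EuclideanSpace.single i (1:ℝ))) x
      (EuclideanSpace.single i (1:ℝ))

theorem mp_abs {H : Type*} [NormedAddCommGroup H] [InnerProductSpace ℝ H]
    (J : H → ℝ) (D : H → H) (hJ : ∀ x, HasFDerivAt J (innerSL ℝ (D x)) x)
    (hD : ∀ R, UniformContinuousOn D (closedBall 0 R))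
    (δ α c ρ : ℝ) (e : H) (hδ : 0 < δ) (hα : 0 < α) (hρ : 0 < ρ) (hc : 0 ≤ c)
    (hgrad : ∀ x, α / 2 ≤ J x → J x ≤ c → δ ≤ ‖D x‖)
    (hsph : ∀ x, ‖x‖ = ρ → α ≤ J x) (he : ρ < ‖e‖) (hJ0 : J 0 ≤ 0) (hJe : J e ≤ 0)
    (hpath : ∀ t ∈ Icc (0:ℝ) 1, J (t • e) ≤ c) : False := by
  have hJc : Continuous J := continuous_iff_continuousAt.2 fun x => (hJ x).continuousAt
  have hDc : Continuous D := by
    rw [continuous_iff_continuousAt]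
    intro x
    refine ((hD (‖x‖ + 1)).continuousOn).continuousAt ?_
    refine mem_of_superset (ball_mem_nhds x one_pos) ?_
    intro y hy
    rw [mem_closedBall_zero_iff]
    rw [mem_ball_iff_norm] at hy
    have := norm_le_norm_add_norm_sub' y x
    linarith
  set χ : H → ℝ := fun x => max 0 (min 1 ((J x - α / 2) / (α / 4))) with hχ
  have hχc : Continuous χ := by fun_prop
  have hχ0 : ∀ x, 0 ≤ χ x := fun x => le_max_left _ _
  have hχ1 : ∀ x, χ x ≤ 1 := fun x => max_le zero_le_one (min_le_left _ _)
  set V : H → H := fun x => (χ x / max ‖D x‖ δ) • D x with hV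
  have hmx : ∀ x, 0 < max ‖D x‖ δ := fun x => lt_max_of_lt_right hδ
  have hVc : Continuous V := by
    refine Continuous.smul ?_ hDc
    exact hχc.div (hDc.norm.max continuous_const) (fun x => (hmx x).ne')
  have hVn : ∀ x, ‖V x‖ ≤ χ x := by
    intro x
    rw [hV]
    simp only [norm_smul, norm_div, Real.norm_eq_abs, abs_of_nonneg (hχ0 x), abs_of_pos (hmx x)]
    rw [div_mul_eq_mul_div, div_le_iff₀ (hmx x)]
    exact mul_le_mul_of_nonneg_left (le_max_left _ _) (hχ0 x)
  set R : ℝ := ‖e‖ + 2 * c / δ + 3 with hR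
  obtain ⟨τ1, hτ1, hτ1'⟩ := Metric.uniformContinuousOn_iff.1 (hD (R + 1)) (δ / 2) (by positivity)
  set τ : ℝ := min (τ1 / 2) 1 with hτ
  have hτpos : 0 < τ := by positivity
  have hτle : τ ≤ 1 := min_le_right _ _
  have hτlt : τ < τ1 := lt_of_le_of_lt (min_le_left _ _) (by linarith)
  -- descent
  have hdesc : ∀ x, ‖x‖ ≤ R → J x ≤ c → J (x - τ • V x) ≤ J x - τ * (χ x * (δ / 2)) := by
    intro x hx hxc
    rcases (hχ0 x).eq_or_lt with h0 | h0
    · have : V x = 0 := by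
        have := hVn x
        rw [← h0] at this
        exact norm_le_zero_iff.1 this
      simp [this, ← h0]
    have hJx : α / 2 ≤ J x := by
      by_contra hcon
      push Not at hcon
      have : (J x - α / 2) / (α / 4) < 0 := div_neg_of_neg_of_pos (by linarith) (by linarith)
      have : χ x = 0 := by
        simp only [hχ]
        exact max_eq_left ((min_le_right _ _).trans this.le)
      linarith
    have hg := hgrad x hJx hxc
    have hder : ∀ s : ℝ, HasDerivAt (fun s : ℝ => J (x - s • V x))
        (-(inner ℝ (D (x - s • V x)) (V x))) s := by
      intro s
      have h1 : HasDerivAt (fun s : ℝ => x - s • V x) (-(V x)) s := by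
        have := ((hasDerivAt_id s).smul_const (V x)).const_sub x
        simpa using this
      have h2 := (hJ (x - s • V x)).comp_hasDerivAt s h1
      refine HasDerivAt.congr_deriv h2 ?_
      simp
    have hbd : ∀ s ∈ Icc (0:ℝ) τ, χ x * (δ / 2) ≤ inner ℝ (D (x - s • V x)) (V x) := by
      intro s hs
      have hsV : ‖s • V x‖ ≤ τ := by
        rw [norm_smul, Real.norm_eq_abs, abs_of_nonneg hs.1]
        calc s * ‖V x‖ ≤ τ * 1 := mul_le_mul hs.2 ((hVn x).trans (hχ1 x)) (norm_nonneg _) hτpos.le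
          _ = τ := mul_one _
      have hd : dist (D (x - s • V x)) (D x) < δ / 2 := by
        apply hτ1'
        · rw [mem_closedBall_zero_iff]
          have := norm_sub_le x (s • V x)
          linarith
        · rw [mem_closedBall_zero_iff]; linarith
        · rw [dist_eq_norm]
          simp only [sub_sub_cancel_left, norm_neg]
          linarith
      rw [dist_eq_norm] at hd
      have e1 : inner ℝ (D (x - s • V x)) (V x) =
          inner ℝ (D x) (V x) + inner ℝ (D (x - s • V x) - D x) (V x) := by
        rw [inner_sub_left]; ring
      have e2 : inner ℝ (D x) (V x) = χ x * ‖D x‖ := by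
        simp only [hV]
        rw [inner_smul_right, real_inner_self_eq_norm_sq, max_eq_left hg]
        have : ‖D x‖ ≠ 0 := by linarith
        field_simp
      have e3 : -(δ / 2 * χ x) ≤ inner ℝ (D (x - s • V x) - D x) (V x) := by
        have := abs_real_inner_le_norm (D (x - s • V x) - D x) (V x)
        have h2 : ‖D (x - s • V x) - D x‖ * ‖V x‖ ≤ δ / 2 * χ x :=
          mul_le_mul hd.le (hVn x) (norm_nonneg _) (by positivity)
        have := neg_abs_le (inner ℝ (D (x - s • V x) - D x) (V x))
        linarith
      rw [e1, e2]
      nlinarith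
    obtain ⟨s, hs, hs'⟩ := exists_hasDerivAt_eq_slope (fun s : ℝ => J (x - s • V x)) _ hτpos
      (fun s _ => (hder s).continuousAt.continuousWithinAt) (fun s _ => hder s)
    have hb := hbd s ⟨hs.1.le, hs.2.le⟩
    rw [eq_div_iff (by linarith)] at hs'
    simp only [zero_smul, sub_zero] at hs'
    nlinarith
  set η : H → H := fun x => x - τ • V x with hη
  have hηc : Continuous η := continuous_id.sub (hVc.const_smul τ)
  have hηn : ∀ x, ‖η x‖ ≤ ‖x‖ + τ := by
    intro x
    have h1 := norm_sub_le x (τ • V x)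
    have h2 : ‖τ • V x‖ ≤ τ := by
      rw [norm_smul, Real.norm_eq_abs, abs_of_pos hτpos]
      nlinarith [hVn x, hχ1 x]
    simp only [hη]; linarith
  have hηfix : ∀ x, J x ≤ 0 → η x = x := by
    intro x hx
    have : χ x = 0 := by
      simp only [hχ]
      apply max_eq_left
      refine (min_le_right _ _).trans (div_nonpos_of_nonpos_of_nonneg (by linarith) (by linarith))
    have : V x = 0 := by simp [hV, this]
    simp [hη, this]
  set n0 : ℕ := ⌈2 * c / (δ * τ)⌉₊ with hn0
  have hn0' : (n0:ℝ) * τ ≤ 2 * c / δ + 1 := by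
    have : (n0:ℝ) < 2 * c / (δ * τ) + 1 := Nat.ceil_lt_add_one (by positivity)
    have h2 : 2 * c / (δ * τ) * τ = 2 * c / δ := by field_simp
    nlinarith
  have hmain : ∀ t ∈ Icc (0:ℝ) 1, ∀ n : ℕ, n ≤ n0 → ‖η^[n] (t • e)‖ ≤ ‖e‖ + n * τ ∧
      J (η^[n] (t • e)) ≤ c ∧ J (η^[n] (t • e)) ≤ max (3 * α / 4) (c - n * (τ * δ / 2)) := by
    intro t ht n
    induction n with
    | zero =>
      intro _
      refine ⟨?_, hpath t ht, ?_⟩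
      · simp only [Function.iterate_zero, id, norm_smul, Real.norm_eq_abs, abs_of_nonneg ht.1]
        have := ht.2
        push_cast
        nlinarith [norm_nonneg e]
      · have := hpath t ht
        simp only [Function.iterate_zero, id, Nat.cast_zero, zero_mul, sub_zero]
        exact this.trans (le_max_right _ _)
    | succ n ih =>
      intro hn
      obtain ⟨i1, i2, i3⟩ := ih (by omega)
      rw [Function.iterate_succ_apply']
      set y := η^[n] (t • e)
      have hnn : (n:ℝ) * τ ≤ n0 * τ := by
        have : (n:ℝ) ≤ n0 := by exact_mod_cast (by omega : n ≤ n0)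
        nlinarith
      have hyR : ‖y‖ ≤ R := by rw [hR]; linarith
      have hdy := hdesc y hyR i2
      have hpos : 0 ≤ τ * (χ y * (δ / 2)) := by have := hχ0 y; positivity
      refine ⟨?_, ?_, ?_⟩
      · have := hηn y
        push_cast; linarith
      · change J (y - τ • V y) ≤ c
        linarith
      · change J (y - τ • V y) ≤ _
        by_cases hcase : J y ≤ 3 * α / 4
        · exact (by linarith : J (y - τ • V y) ≤ 3 * α / 4).trans (le_max_left _ _)
        · push Not at hcase
          have : χ y = 1 := by
            simp only [hχ]
            rw [min_eq_left, max_eq_right zero_le_one]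
            rw [le_div_iff₀ (by linarith)]; linarith
          rw [this] at hdy
          have h3 : J y ≤ c - n * (τ * δ / 2) := by
            rcases le_max_iff.1 i3 with h | h
            · linarith
            · exact h
          refine le_trans ?_ (le_max_right _ _)
          push_cast; linarith
  -- crossing
  have hcont : Continuous (fun t : ℝ => ‖η^[n0] (t • e)‖) :=
    ((hηc.iterate n0).comp (by fun_prop)).norm
  have hfix : ∀ n, ∀ x, J x ≤ 0 → η^[n] x = x := fun n x hx => Function.iterate_fixed (hηfix x hx) n
  have h0 : ‖η^[n0] ((0:ℝ) • e)‖ = 0 := by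
    rw [zero_smul, hfix n0 0 hJ0, norm_zero]
  have h1 : ‖η^[n0] ((1:ℝ) • e)‖ = ‖e‖ := by
    rw [one_smul, hfix n0 e hJe]
  obtain ⟨t, ht, ht'⟩ := intermediate_value_Icc (zero_le_one' ℝ) hcont.continuousOn
    (show ρ ∈ Icc _ _ by rw [h0, h1]; exact ⟨hρ.le, he.le⟩)
  have hs := hsph _ ht'
  have hm := (hmain t ht n0 le_rfl).2.2
  have : c - n0 * (τ * δ / 2) ≤ 0 := by
    have : 2 * c / (δ * τ) ≤ n0 := Nat.le_ceil _
    rw [div_le_iff₀ (by positivity)] at this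
    nlinarith
  rcases le_max_iff.1 hm with h | h <;> linarith

theorem inner_iint {H : Type*} [NormedAddCommGroup H] [InnerProductSpace ℝ H] [CompleteSpace H]
    (g : ℝ → H) (hg : Continuous g) (a b : ℝ) (w : H) :
    inner ℝ w (∫ s in a..b, g s) = ∫ s in a..b, inner ℝ w (g s) := by
  have := (innerSL ℝ w).intervalIntegral_comp_comm (hg.intervalIntegrable a b (μ := volume))
  simpa using this.symm

theorem bdd_on {h : ℝ → ℝ → ℝ} (hc : Continuous (Function.uncurry h)) (L r : ℝ) :
    ∃ M, 0 ≤ M ∧ ∀ s ∈ Icc 1 L, ∀ t, |t| ≤ r → |h s t| ≤ M := by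
  obtain ⟨M, hM⟩ := (isCompact_Icc.prod isCompact_Icc : IsCompact (Icc 1 L ×ˢ Icc (-r) r)).exists_bound_of_continuousOn
    hc.continuousOn
  refine ⟨max M 0, le_max_right _ _, fun s hs t ht => ?_⟩
  exact (hM (s, t) ⟨hs, abs_le.1 ht⟩).trans (le_max_left _ _)

theorem crit_exists {H : Type*} [NormedAddCommGroup H] [InnerProductSpace ℝ H] [CompleteSpace H]
    (e : ℝ → H) (he : Continuous e) (L : ℝ) (hL : 1 < L) (h Hh : ℝ → ℝ → ℝ)
    (hc : Continuous (Function.uncurry h)) (Hc : Continuous (Function.uncurry Hh))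
    (hd : ∀ s t, HasDerivAt (Hh s) (h s t) t) (θ : ℝ) (hθ : 2 < θ)
    (hAR : ∀ s t, θ * Hh s t ≤ t * h s t)
    (hsmall : ∀ ε > 0, ∃ δ > 0, ∀ s ∈ Icc 1 L, ∀ t, |t| ≤ δ → Hh s t ≤ ε * t ^ 2)
    (H0 : ∀ s, Hh s 0 = 0)
    (v0 : H) (hv0 : v0 ≠ 0) (cs : ℝ)
    (hpath : ∀ t ≥ 0, 1 / 2 * t ^ 2 * ‖v0‖ ^ 2 - ∫ s in (1:ℝ)..L, Hh s (t * inner ℝ v0 (e s)) ≤ cs)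
    (hneg : ∀ T0 : ℝ, ∃ T ≥ T0,
      1 / 2 * T ^ 2 * ‖v0‖ ^ 2 - ∫ s in (1:ℝ)..L, Hh s (T * inner ℝ v0 (e s)) ≤ 0) :
    ∃ v : H, v = ∫ s in (1:ℝ)..L, h s (inner ℝ v (e s)) • e s ∧
      0 < 1 / 2 * ‖v‖ ^ 2 - ∫ s in (1:ℝ)..L, Hh s (inner ℝ v (e s)) ∧
      1 / 2 * ‖v‖ ^ 2 - ∫ s in (1:ℝ)..L, Hh s (inner ℝ v (e s)) ≤ cs := by
  set Φ : H → H := fun v => ∫ s in (1:ℝ)..L, h s (inner ℝ v (e s)) • e s with hΦ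
  set J : H → ℝ := fun v => 1 / 2 * ‖v‖ ^ 2 - ∫ s in (1:ℝ)..L, Hh s (inner ℝ v (e s)) with hJdef
  set D : H → H := fun v => v - Φ v with hDdef
  have hL0 : 0 < L - 1 := by linarith
  have hu : ∀ v : H, Continuous fun s => inner ℝ v (e s) := fun v => by fun_prop
  have hhc : ∀ v : H, Continuous fun s => h s (inner ℝ v (e s)) := fun v =>
    hc.comp (continuous_id.prodMk (hu v))
  have hHc : ∀ v : H, Continuous fun s => Hh s (inner ℝ v (e s)) := fun v =>
    Hc.comp (continuous_id.prodMk (hu v))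
  have hgc : ∀ v : H, Continuous fun s => h s (inner ℝ v (e s)) • e s := fun v => (hhc v).smul he
  obtain ⟨E0, hE0⟩ := (isCompact_Icc (a := (1:ℝ)) (b := L)).exists_bound_of_continuousOn
    (he.continuousOn)
  set E := max E0 1 with hE
  have hE1 : 1 ≤ E := le_max_right _ _
  have hEb : ∀ s ∈ Icc 1 L, ‖e s‖ ≤ E := fun s hs => (hE0 s hs).trans (le_max_left _ _)
  have hub : ∀ v : H, ∀ s ∈ Icc 1 L, |inner ℝ v (e s)| ≤ ‖v‖ * E := fun v s hs =>
    (abs_real_inner_le_norm _ _).trans (mul_le_mul_of_nonneg_left (hEb s hs) (norm_nonneg _))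
  have huI : uIoc (1:ℝ) L ⊆ Icc 1 L := by
    rw [uIoc_of_le hL.le]; exact Ioc_subset_Icc_self
  -- derivative
  have hJd : ∀ v, HasFDerivAt J (innerSL ℝ (D v)) v := by
    intro v
    obtain ⟨M, hM0, hM⟩ := bdd_on hc L ((‖v‖ + 1) * E)
    have h1 := intervalIntegral.hasFDerivAt_integral_of_dominated_of_fderiv_le (𝕜 := ℝ) (μ := volume)
      (F := fun v s => Hh s (inner ℝ v (e s)))
      (F' := fun v s => (h s (inner ℝ v (e s))) • (innerSL ℝ (e s))) (x₀ := v) (a := 1) (b := L)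
      (s := ball v 1) (bound := fun _ => M * E) (ball_mem_nhds v one_pos)
      (Eventually.of_forall fun v => (hHc v).aestronglyMeasurable)
      ((hHc v).intervalIntegrable _ _)
      (((hhc v).smul ((innerSL ℝ).continuous.comp he)).aestronglyMeasurable)
      (Eventually.of_forall fun s hs w hw => by
        have hw' : ‖w‖ ≤ ‖v‖ + 1 := by
          rw [mem_ball_iff_norm] at hw
          have := norm_le_norm_add_norm_sub' w v
          linarith
        have hs' := huI hs
        rw [norm_smul, innerSL_apply_norm, Real.norm_eq_abs]
        refine mul_le_mul (hM s hs' _ ((hub w s hs').trans ?_)) (hEb s hs') (norm_nonneg _) hM0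
        exact mul_le_mul_of_nonneg_right hw' (by linarith))
      (continuous_const.intervalIntegrable _ _)
      (Eventually.of_forall fun s hs w hw => by
        have h2 : HasFDerivAt (fun w : H => inner ℝ w (e s)) (innerSL ℝ (e s)) w := by
          have := (innerSL ℝ (e s)).hasFDerivAt (x := w)
          refine this.congr_of_eventuallyEq (Eventually.of_forall fun y => ?_)
          simp [real_inner_comm]
        exact (hd s (inner ℝ w (e s))).comp_hasFDerivAt w h2)
    have h3 : HasFDerivAt (fun v : H => 1 / 2 * ‖v‖ ^ 2) (innerSL ℝ v) v := by
      have := (hasStrictFDerivAt_norm_sq v).hasFDerivAt.const_mul (1 / 2 : ℝ)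
      refine this.congr_fderiv ?_
      ext w
      simp
    refine (h3.sub h1).congr_fderiv ?_
    ext w
    simp only [sub_apply, innerSL_apply_apply, hDdef, inner_sub_left, hΦ]
    congr 1
    rw [real_inner_comm, inner_iint _ (hgc v), ContinuousLinearMap.intervalIntegral_apply]
    · refine intervalIntegral.integral_congr fun s _ => ?_
      simp [inner_smul_right, real_inner_comm]
    · exact ((hhc v).smul ((innerSL ℝ).continuous.comp he)).intervalIntegrable _ _
  -- uniform continuity
  have hUC : ∀ R, UniformContinuousOn D (closedBall 0 R) := by
    intro R
    rcases lt_or_ge R 0 with hR | hR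
    · rw [closedBall_eq_empty.2 hR]
      simp [UniformContinuousOn]
    have hunif := (isCompact_Icc.prod isCompact_Icc :
      IsCompact (Icc 1 L ×ˢ Icc (-(R * E)) (R * E))).uniformContinuousOn_of_continuous
        hc.continuousOn
    rw [Metric.uniformContinuousOn_iff] at hunif ⊢
    intro ε hε
    obtain ⟨δ, hδ, hδ'⟩ := hunif (ε / (2 * E * (L - 1))) (by positivity)
    refine ⟨min (δ / E) (ε / 2), by positivity, ?_⟩
    intro v hv w hw hvw
    rw [mem_closedBall_zero_iff] at hv hw
    have hvw1 : ‖v - w‖ < ε / 2 := by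
      rw [← dist_eq_norm]; exact hvw.trans_le (min_le_right _ _)
    have hvw2 : ‖v - w‖ * E < δ := by
      rw [← dist_eq_norm, ← lt_div_iff₀ (by linarith)]; exact hvw.trans_le (min_le_left _ _)
    have hΦd : ‖Φ v - Φ w‖ ≤ ε / 2 := by
      simp only [hΦ]
      rw [← intervalIntegral.integral_sub ((hgc v).intervalIntegrable _ _)
        ((hgc w).intervalIntegrable _ _)]
      have := intervalIntegral.norm_integral_le_of_norm_le_const (a := 1) (b := L)
        (f := fun s => h s (inner ℝ v (e s)) • e s - h s (inner ℝ w (e s)) • e s)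
        (C := ε / (2 * E * (L - 1)) * E) (by
          intro s hs
          have hs' := huI hs
          rw [← sub_smul, norm_smul]
          refine mul_le_mul ?_ (hEb s hs') (norm_nonneg _) (by positivity)
          have := hδ' (s, inner ℝ v (e s))
            ⟨hs', abs_le.1 ((hub v s hs').trans (mul_le_mul_of_nonneg_right hv (by linarith)))⟩
            (s, inner ℝ w (e s))
            ⟨hs', abs_le.1 ((hub w s hs').trans (mul_le_mul_of_nonneg_right hw (by linarith)))⟩ (by
              rw [Prod.dist_eq]
              simp only [dist_self]
              rw [max_eq_right dist_nonneg, Real.dist_eq, ← inner_sub_left]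
              exact (hub (v - w) s hs').trans_lt hvw2)
          rw [Real.dist_eq] at this
          exact this.le)
      refine this.trans (le_of_eq ?_)
      rw [abs_of_pos hL0]
      field_simp
    rw [dist_eq_norm]
    have : D v - D w = (v - w) - (Φ v - Φ w) := by simp only [hDdef]; abel
    rw [this]
    have := norm_sub_le (v - w) (Φ v - Φ w)
    linarith
  have hDc : Continuous D := by
    rw [continuous_iff_continuousAt]
    intro x
    refine ((hUC (‖x‖ + 1)).continuousOn).continuousAt ?_
    refine mem_of_superset (ball_mem_nhds x one_pos) ?_
    intro y hy
    rw [mem_closedBall_zero_iff]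
    rw [mem_ball_iff_norm] at hy
    have := norm_le_norm_add_norm_sub' y x
    linarith
  have hJc : Continuous J := continuous_iff_continuousAt.2 fun x => (hJd x).continuousAt
  -- compactness
  have hcomp : ∀ R, ∃ K : Set H, IsCompact K ∧ ∀ v, ‖v‖ ≤ R → Φ v ∈ K := by
    intro R
    obtain ⟨M, hM0, hM⟩ := bdd_on hc L (R * E)
    set S : Set H := (fun q : ℝ × ℝ => q.1 • e q.2) '' (Icc (-M) M ×ˢ Icc 1 L) with hS
    have hSc : IsCompact S := (isCompact_Icc.prod isCompact_Icc).image (by fun_prop)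
    have hK : IsCompact (closure (convexHull ℝ S)) := by
      rw [isCompact_iff_totallyBounded_isComplete]
      exact ⟨(hSc.totallyBounded.convexHull).closure, isClosed_closure.isComplete⟩
    refine ⟨(fun x => (L - 1) • x) '' closure (convexHull ℝ S), hK.image (by fun_prop), ?_⟩
    intro v hv
    refine ⟨⨍ s in (1:ℝ)..L, h s (inner ℝ v (e s)) • e s, ?_, ?_⟩
    · refine (convex_convexHull ℝ S).set_average_mem_closure ?_ ?_ ?_ ?_
      · rw [uIoc_of_le hL.le]; simp [hL]
      · rw [uIoc_of_le hL.le]; simp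
      · refine ae_restrict_of_forall_mem measurableSet_uIoc fun s hs => subset_convexHull ℝ S ?_
        have hs' := huI hs
        exact ⟨(h s (inner ℝ v (e s)), s), ⟨abs_le.1 (hM s hs' _ ((hub v s hs').trans
          (mul_le_mul_of_nonneg_right hv (by linarith)))), hs'⟩, rfl⟩
      · exact ((hgc v).integrableOn_Icc).mono_set huI
    · simp only [interval_average_eq]
      rw [smul_smul, mul_inv_cancel₀ hL0.ne', one_smul]
  -- geometry
  obtain ⟨δ1, hδ1, hδ1'⟩ := hsmall (1 / (4 * (L - 1) * E ^ 2)) (by positivity)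
  set ρ := δ1 / E with hρ
  have hρpos : 0 < ρ := by positivity
  have hsph : ∀ x, ‖x‖ = ρ → ρ ^ 2 / 4 ≤ J x := by
    intro x hx
    have hb : ∫ s in (1:ℝ)..L, Hh s (inner ℝ x (e s)) ≤ ∫ s in (1:ℝ)..L, ρ ^ 2 / (4 * (L - 1)) := by
      refine intervalIntegral.integral_mono_on hL.le ((hHc x).intervalIntegrable _ _)
        (continuous_const.intervalIntegrable _ _) fun s hs => ?_
      have h1 := hub x s hs
      rw [hx] at h1
      have h2 : ρ * E = δ1 := by rw [hρ]; field_simp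
      refine (hδ1' s hs _ (h1.trans h2.le)).trans ?_
      have h3 : (inner ℝ x (e s)) ^ 2 ≤ (ρ * E) ^ 2 := sq_le_sq' (by linarith [abs_le.1 h1]) (abs_le.1 h1).2
      calc 1 / (4 * (L - 1) * E ^ 2) * (inner ℝ x (e s)) ^ 2
          ≤ 1 / (4 * (L - 1) * E ^ 2) * (ρ * E) ^ 2 := mul_le_mul_of_nonneg_left h3 (by positivity)
        _ = _ := by field_simp
    rw [intervalIntegral.integral_const, smul_eq_mul] at hb
    have : (L - 1) * (ρ ^ 2 / (4 * (L - 1))) = ρ ^ 2 / 4 := by field_simp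
    simp only [hJdef, hx]
    linarith
  obtain ⟨T, hT, hT'⟩ := hneg ((ρ + 1) / ‖v0‖)
  have hv0n : 0 < ‖v0‖ := norm_pos_iff.2 hv0
  have hTpos : 0 < T := lt_of_lt_of_le (by positivity) hT
  have hJt : ∀ t : ℝ, J (t • v0) = 1 / 2 * t ^ 2 * ‖v0‖ ^ 2 -
      ∫ s in (1:ℝ)..L, Hh s (t * inner ℝ v0 (e s)) := by
    intro t
    simp only [hJdef, norm_smul, inner_smul_left, mul_pow, Real.norm_eq_abs, sq_abs]
    simp only [conj_trivial]
    ring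
  have hJ0 : J 0 = 0 := by simp [hJdef, H0]
  by_contra hcon
  push Not at hcon
  have hcs0 : 0 ≤ cs := by
    have := hpath 0 le_rfl
    simpa [H0] using this
  -- PS
  have hPS : ∃ δ > 0, ∀ x, ρ ^ 2 / 4 / 2 ≤ J x → J x ≤ cs → δ ≤ ‖D x‖ := by
    by_contra hno
    push Not at hno
    have hseq : ∀ n : ℕ, ∃ x, ρ ^ 2 / 4 / 2 ≤ J x ∧ J x ≤ cs ∧ ‖D x‖ < 1 / ((n:ℝ) + 1) := fun n =>
      hno (1 / ((n:ℝ) + 1)) (by positivity)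
    choose x hx1 hx2 hx3 using hseq
    have hbdx : ∀ n, ‖x n‖ ≤ (cs + 1) / (1 / 2 - 1 / θ) + 1 := by
      intro n
      have hθ0 : 0 < θ := by linarith
      have hi1 : θ * (∫ s in (1:ℝ)..L, Hh s (inner ℝ (x n) (e s))) ≤ inner ℝ (x n) (Φ (x n)) := by
        simp only [hΦ]
        rw [inner_iint _ (hgc _), ← intervalIntegral.integral_const_mul]
        refine intervalIntegral.integral_mono_on hL.le
          (((hHc _).const_mul _ |>.intervalIntegrable _ _))
          ((continuous_const.inner (hgc _)).intervalIntegrable _ _) fun s hs => ?_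
        rw [inner_smul_right, mul_comm (h s _)]
        exact hAR s _
      have hi2 : inner ℝ (x n) (Φ (x n)) = ‖x n‖ ^ 2 - inner ℝ (x n) (D (x n)) := by
        simp only [hDdef, inner_sub_right, real_inner_self_eq_norm_sq]; ring
      have hi3 : |inner ℝ (x n) (D (x n))| ≤ ‖x n‖ * 1 := by
        refine (abs_real_inner_le_norm _ _).trans (mul_le_mul_of_nonneg_left ?_ (norm_nonneg _))
        refine (hx3 n).le.trans ?_
        rw [div_le_one (by positivity)]
        have : (0:ℝ) ≤ n := n.cast_nonneg
        linarith
      have hi4 := (abs_le.1 hi3).1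
      have hJn : J (x n) = 1 / 2 * ‖x n‖ ^ 2 - ∫ s in (1:ℝ)..L, Hh s (inner ℝ (x n) (e s)) := rfl
      have hi5 : ∫ s in (1:ℝ)..L, Hh s (inner ℝ (x n) (e s)) ≤ (1 / θ) * (‖x n‖ ^ 2 + ‖x n‖) := by
        rw [div_mul_eq_mul_div, le_div_iff₀ hθ0]; linarith
      have hθ1 : 1 / θ < 1 / 2 := one_div_lt_one_div_of_lt (by norm_num) hθ
      have hθ2 : 0 < 1 / θ := by positivity
      set a := 1 / 2 - 1 / θ with ha
      have ha0 : 0 < a := by rw [ha]; linarith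
      have hi6 : a * ‖x n‖ ^ 2 ≤ cs + ‖x n‖ := by
        have := hx2 n
        have := norm_nonneg (x n)
        nlinarith
      by_contra hlt
      push Not at hlt
      have hA : 0 < (cs + 1) / a := by positivity
      have hlt2 : (cs + 1) < a * ‖x n‖ := by
        have : (cs + 1) / a < ‖x n‖ := by linarith
        rw [div_lt_iff₀ ha0] at this; linarith
      nlinarith
    obtain ⟨K, hK, hK'⟩ := hcomp ((cs + 1) / (1 / 2 - 1 / θ) + 1)
    obtain ⟨y, -, ψ, hψ, hy⟩ := hK.tendsto_subseq (fun n => hK' (x n) (hbdx n))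
    have hD0 : Tendsto (fun n => D (x (ψ n))) atTop (nhds 0) := by
      have : Tendsto (fun n => D (x n)) atTop (nhds 0) :=
        squeeze_zero_norm (fun n => (hx3 n).le) tendsto_one_div_add_atTop_nhds_zero_nat
      exact this.comp hψ.tendsto_atTop
    have hxy : Tendsto (fun n => x (ψ n)) atTop (nhds y) := by
      have := hD0.add hy
      rw [zero_add] at this
      refine this.congr fun n => ?_
      simp [hDdef]
    have hDy : D y = 0 := tendsto_nhds_unique ((hDc.tendsto y).comp hxy) hD0
    have hJy := (hJc.tendsto y).comp hxy
    have h1 : ρ ^ 2 / 4 / 2 ≤ J y := ge_of_tendsto' hJy fun n => hx1 _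
    have h2 : J y ≤ cs := le_of_tendsto' hJy fun n => hx2 _
    have h3 := hcon y (sub_eq_zero.1 hDy) (lt_of_lt_of_le (by positivity) h1)
    exact absurd h2 (not_le.2 h3)
  obtain ⟨δ, hδ, hδ'⟩ := hPS
  refine mp_abs J D hJd hUC δ (ρ ^ 2 / 4) cs ρ (T • v0) hδ (by positivity) hρpos hcs0 hδ' hsph ?_
    hJ0.le ?_ ?_
  · rw [norm_smul, Real.norm_eq_abs, abs_of_pos hTpos]
    have := (div_le_iff₀ hv0n).1 hT
    linarith
  · rw [hJt]; exact hT'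
  · intro t ht
    rw [smul_smul, hJt]
    exact hpath _ (mul_nonneg ht.1 hTpos.le)

noncomputable def kE (x : ℝ) : Lp ℝ 2 (volume : Measure ℝ) :=
  indicatorConstLp 2 (s := Ioc 1 x) measurableSet_Ioc (by simp) (1:ℝ)

theorem kE_inner (x y : ℝ) : inner ℝ (kE x) (kE y) = max (min x y - 1) 0 := by
  unfold kE
  rw [L2.inner_indicatorConstLp_one]
  have : ∫ t in Ioc 1 x, (indicatorConstLp 2 (s := Ioc 1 y) measurableSet_Ioc (by simp) (1:ℝ) :
      Lp ℝ 2 (volume : Measure ℝ)) t = ∫ t in Ioc 1 x, (Ioc 1 y).indicator (fun _ => (1:ℝ)) t := by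
    refine integral_congr_ae (ae_restrict_of_ae ?_)
    exact indicatorConstLp_coeFn
  rw [this, integral_indicator measurableSet_Ioc, Measure.restrict_restrict measurableSet_Ioc]
  simp only [integral_const, smul_eq_mul, mul_one]
  rw [Ioc_inter_Ioc]
  simp [Measure.real, ENNReal.toReal_ofReal', min_comm]

theorem kE_cont : Continuous kE := by
  rw [continuous_iff_continuousAt]
  intro x
  rw [ContinuousAt, tendsto_iff_norm_sub_tendsto_zero]
  have h : ∀ y, ‖kE y - kE x‖ = Real.sqrt (max (y - 1) 0 - 2 * max (min y x - 1) 0 + max (x - 1) 0) := by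
    intro y
    rw [← Real.sqrt_sq (norm_nonneg _), @norm_sub_sq_real, ← real_inner_self_eq_norm_sq, ← real_inner_self_eq_norm_sq, kE_inner, kE_inner, kE_inner, min_self, min_self]
  simp_rw [h]
  have : Continuous fun y : ℝ => Real.sqrt (max (y - 1) 0 - 2 * max (min y x - 1) 0 + max (x - 1) 0) := by
    fun_prop
  have h2 := this.tendsto x
  simp only [min_self] at h2
  convert h2 using 2
  symm
  rw [Real.sqrt_eq_zero']
  linarith

theorem kE_test (L : ℝ) (hL : 1 ≤ L) (g : ℝ → ℝ) (hg : ContinuousOn g (Icc 1 L)) :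
    ∃ v : Lp ℝ 2 (volume : Measure ℝ), ‖v‖ ^ 2 = ∫ s in (1:ℝ)..L, g s ^ 2 ∧
      ∀ x ∈ Icc 1 L, inner ℝ v (kE x) = ∫ s in (1:ℝ)..x, g s := by
  have hm : MemLp ((Icc 1 L).indicator g) 2 (volume : Measure ℝ) := by
    rw [memLp_indicator_iff_restrict measurableSet_Icc]
    obtain ⟨C, hC⟩ := isCompact_Icc.exists_bound_of_continuousOn hg
    refine MemLp.of_bound (hg.aestronglyMeasurable measurableSet_Icc) C ?_
    filter_upwards [ae_restrict_mem measurableSet_Icc] with a ha using hC a ha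
  refine ⟨hm.toLp _, ?_, ?_⟩
  · rw [← real_inner_self_eq_norm_sq, L2.inner_def]
    have : ∀ᵐ a : ℝ, inner ℝ ((hm.toLp _ : ℝ → ℝ) a) ((hm.toLp _ : ℝ → ℝ) a) = (Icc 1 L).indicator (fun s => g s ^ 2) a := by
      filter_upwards [hm.coeFn_toLp] with a ha
      rw [ha]
      by_cases h : a ∈ Icc 1 L <;> simp [h, sq]
    rw [integral_congr_ae this, integral_indicator measurableSet_Icc, integral_Icc_eq_integral_Ioc,
      intervalIntegral.integral_of_le hL]
  · intro x hx
    rw [real_inner_comm]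
    unfold kE
    rw [L2.inner_indicatorConstLp_one, intervalIntegral.integral_of_le hx.1]
    refine integral_congr_ae ?_
    filter_upwards [ae_restrict_of_ae hm.coeFn_toLp, ae_restrict_mem measurableSet_Ioc] with a ha ha2
    rw [ha, indicator_of_mem]
    exact ⟨ha2.1.le, ha2.2.trans hx.2⟩

structure Dat where
  σ : ℝ
  hσ : 0 < σ
  κ : ℝ → ℝ
  f : ℝ → ℝ
  κc : Continuous κ
  κ0 : ∀ x, 0 ≤ κ x
  fc : Continuous f
  f0 : ∀ t, 0 ≤ f t
  fz : ∀ t ≤ 0, f t = 0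
  β : ℝ
  γ : ℝ
  hβ : 0 < β
  hγ : 0 < γ
  Cκ : ℝ
  hCκ : 0 < Cκ
  κu : ∀ x, 1 ≤ x → κ x ≤ Cκ * x ^ (-(β * σ / 2))
  cκ : ℝ
  hcκ : 0 < cκ
  xκ : ℝ
  hxκ : 1 ≤ xκ
  κl : ∀ x, xκ ≤ x → cκ * x ^ (-(γ * σ / 2)) ≤ κ x
  fs : ∀ ε > 0, ∃ δ > 0, ∀ t, 0 ≤ t → t ≤ δ → f t ≤ ε * t
  fl : ∀ ε > 0, ∃ C ≥ 0, ∀ t, 0 ≤ t → f t ≤ ε * t ^ (2 * σ + 1 + β * σ) + C * t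
  θ : ℝ
  hθ : 2 < θ
  f3 : ∀ t, 0 ≤ t → θ * (∫ s in (0:ℝ)..t, f s) ≤ t * f t
  f4 : ∀ M : ℝ, ∃ T > 0, ∀ t, T ≤ t → M * t ^ (γ * σ + 2 * σ) ≤ ∫ s in (0:ℝ)..t, f s

namespace Dat
variable (D : Dat)

noncomputable def c : ℝ := D.σ ^ 2 / 4
noncomputable def w (s : ℝ) : ℝ := D.c * (max s 1) ^ (-(D.σ + 2))
noncomputable def F (t : ℝ) : ℝ := ∫ s in (0:ℝ)..t, D.f s
noncomputable def h (s t : ℝ) : ℝ := D.w s * ((max t 0) ^ (2 * D.σ + 1) + D.κ s * D.f t)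
noncomputable def H (s t : ℝ) : ℝ :=
  D.w s * ((max t 0) ^ (2 * D.σ + 2) / (2 * D.σ + 2) + D.κ s * D.F t)

theorem c_pos : 0 < D.c := by have := D.hσ; unfold c; positivity

theorem w_pos (s : ℝ) : 0 < D.w s := by
  unfold w
  have := D.c_pos
  have : 0 < max s 1 := lt_max_of_lt_right one_pos
  positivity

theorem w_eq {s : ℝ} (hs : 1 ≤ s) : D.w s = D.c * s ^ (-(D.σ + 2)) := by
  unfold w; rw [max_eq_left hs]

theorem w_le (s : ℝ) : D.w s ≤ D.c := by
  unfold w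
  have := D.c_pos
  have h := Real.rpow_le_one_of_one_le_of_nonpos (le_max_right s 1) (show -(D.σ + 2) ≤ 0 by linarith [D.hσ])
  nlinarith

theorem w_cont : Continuous D.w := by
  unfold w
  refine continuous_const.mul (Continuous.rpow_const (by fun_prop) fun x => Or.inl ?_)
  have : 0 < max x 1 := lt_max_of_lt_right one_pos
  exact this.ne'

theorem κ_le {x : ℝ} (hx : 1 ≤ x) : D.κ x ≤ D.Cκ := by
  refine (D.κu x hx).trans ?_
  have := D.hCκ
  have := Real.rpow_le_one_of_one_le_of_nonpos hx (show -(D.β * D.σ / 2) ≤ 0 by have := D.hσ; have := D.hβ; simp; positivity)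
  nlinarith

theorem pw_cont (a : ℝ) (ha : 0 < a) : Continuous fun t : ℝ => (max t 0) ^ a :=
  Continuous.rpow_const (by fun_prop) fun _ => Or.inr ha.le

theorem pw_hasDeriv (a : ℝ) (ha : 0 < a) (t : ℝ) :
    HasDerivAt (fun t : ℝ => (max t 0) ^ (a + 1) / (a + 1)) ((max t 0) ^ a) t := by
  have : (fun t : ℝ => (max t 0) ^ (a + 1) / (a + 1)) = fun t => ∫ s in (0:ℝ)..t, (max s 0) ^ a := by
    ext t
    rcases le_total 0 t with ht | ht
    · rw [max_eq_left ht]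
      have : ∫ s in (0:ℝ)..t, (max s 0) ^ a = ∫ s in (0:ℝ)..t, s ^ a := by
        refine intervalIntegral.integral_congr fun s hs => ?_
        rw [uIcc_of_le ht] at hs
        simp only [max_eq_left hs.1]
      rw [this, integral_rpow (Or.inl (by linarith)), Real.zero_rpow (by linarith), sub_zero]
    · rw [max_eq_right ht, Real.zero_rpow (by linarith), zero_div]
      have : ∫ s in (0:ℝ)..t, (max s 0) ^ a = ∫ s in (0:ℝ)..t, 0 := by
        refine intervalIntegral.integral_congr fun s hs => ?_
        rw [uIcc_of_ge ht] at hs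
        simp only [max_eq_right hs.2, Real.zero_rpow ha.ne']
      rw [this]; simp
  rw [this]
  exact (pw_cont a ha).integral_hasStrictDerivAt 0 t |>.hasDerivAt

theorem F_hasDeriv (t : ℝ) : HasDerivAt D.F (D.f t) t :=
  (D.fc.integral_hasStrictDerivAt 0 t).hasDerivAt

theorem F_cont : Continuous D.F :=
  continuous_iff_continuousAt.2 fun t => (D.F_hasDeriv t).continuousAt

theorem F_mono : Monotone D.F :=
  monotone_of_hasDerivAt_nonneg (fun t => D.F_hasDeriv t) fun t => D.f0 t

theorem F_zero : D.F 0 = 0 := by simp [F]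

theorem F_nonneg {t : ℝ} (ht : 0 ≤ t) : 0 ≤ D.F t := D.F_zero ▸ D.F_mono ht

theorem F_neg {t : ℝ} (ht : t ≤ 0) : D.F t = 0 := by
  unfold F
  have : ∫ s in (0:ℝ)..t, D.f s = ∫ s in (0:ℝ)..t, 0 := by
    refine intervalIntegral.integral_congr fun s hs => ?_
    rw [uIcc_of_ge ht] at hs
    simp only [D.fz s hs.2]
  rw [this]; simp

theorem F_nonneg2 (t : ℝ) : 0 ≤ D.F t := by
  rcases le_total 0 t with ht | ht
  · exact D.F_nonneg ht
  · rw [D.F_neg ht]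

theorem h_cont : Continuous (Function.uncurry D.h) := by
  unfold Function.uncurry h
  have h1 := D.w_cont
  have h2 := D.κc
  have h3 := D.fc
  have h4 := pw_cont (2 * D.σ + 1) (by linarith [D.hσ])
  have h5 : Continuous fun a : ℝ × ℝ => (max a.2 0) ^ (2 * D.σ + 1) := h4.comp continuous_snd
  fun_prop

theorem H_cont : Continuous (Function.uncurry D.H) := by
  unfold Function.uncurry H
  have h1 := D.w_cont
  have h2 := D.κc
  have h3 := D.F_cont
  have h4 := pw_cont (2 * D.σ + 2) (by linarith [D.hσ])
  have h5 : Continuous fun a : ℝ × ℝ => (max a.2 0) ^ (2 * D.σ + 2) := h4.comp continuous_snd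
  fun_prop

theorem h_nonneg (s t : ℝ) : 0 ≤ D.h s t := by
  unfold h
  have := (D.w_pos s).le
  have := D.κ0 s
  have := D.f0 t
  have : 0 ≤ max t 0 := le_max_right _ _
  positivity

theorem H_hasDeriv (s t : ℝ) : HasDerivAt (D.H s) (D.h s t) t := by
  unfold H h
  have h1 := pw_hasDeriv (2 * D.σ + 1) (by linarith [D.hσ]) t
  rw [show 2 * D.σ + 1 + 1 = 2 * D.σ + 2 by ring] at h1
  exact (h1.add ((D.F_hasDeriv t).const_mul (D.κ s))).const_mul (D.w s)

theorem H_zero (s : ℝ) : D.H s 0 = 0 := by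
  unfold H
  rw [max_self, Real.zero_rpow (by linarith [D.hσ]), D.F_zero]; simp

theorem H_neg (s : ℝ) {t : ℝ} (ht : t ≤ 0) : D.H s t = 0 := by
  unfold H
  rw [max_eq_right ht, Real.zero_rpow (by linarith [D.hσ]), D.F_neg ht]; simp

theorem h_neg (s : ℝ) {t : ℝ} (ht : t ≤ 0) : D.h s t = 0 := by
  unfold h
  rw [max_eq_right ht, Real.zero_rpow (by linarith [D.hσ]), D.fz t ht]; simp

theorem H_AR (s t : ℝ) : min D.θ (2 * D.σ + 2) * D.H s t ≤ t * D.h s t := by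
  rcases le_total t 0 with ht | ht
  · rw [D.H_neg s ht, D.h_neg s ht]; simp
  · unfold H h
    rw [max_eq_left ht]
    set m := min D.θ (2 * D.σ + 2)
    have hm1 : m ≤ D.θ := min_le_left _ _
    have hm2 : m ≤ 2 * D.σ + 2 := min_le_right _ _
    have h3 : D.θ * D.F t ≤ t * D.f t := D.f3 t ht
    have hF := D.F_nonneg ht
    have hσ := D.hσ
    have e : t * t ^ (2 * D.σ + 1) = t ^ (2 * D.σ + 2) := by
      have := Real.rpow_add_one' ht (show (2 * D.σ + 1) + 1 ≠ 0 by linarith)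
      rw [show 2 * D.σ + 2 = (2 * D.σ + 1) + 1 by ring, this, mul_comm]
    have p0 : 0 ≤ t ^ (2 * D.σ + 2) := Real.rpow_nonneg ht _
    have a1 : m * (t ^ (2 * D.σ + 2) / (2 * D.σ + 2)) ≤ t * t ^ (2 * D.σ + 1) := by
      rw [e, mul_div_assoc', div_le_iff₀ (by linarith)]
      nlinarith
    have a2 : m * D.F t ≤ t * D.f t := by nlinarith
    have a3 := mul_le_mul_of_nonneg_left a2 (D.κ0 s)
    have := mul_le_mul_of_nonneg_left (add_le_add a1 a3) (D.w_pos s).le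
    linarith

theorem f_F_small (ε : ℝ) (hε : 0 < ε) : ∃ δ > 0, ∀ t, 0 ≤ t → t ≤ δ →
    t ^ (2 * D.σ) ≤ ε ∧ D.f t ≤ ε * t ∧ D.F t ≤ ε * t ^ 2 := by
  obtain ⟨δ, hδ, h⟩ := D.fs ε hε
  have hσ := D.hσ
  refine ⟨min δ (ε ^ (1 / (2 * D.σ))), by positivity, fun t ht0 ht => ⟨?_, ?_, ?_⟩⟩
  · have := Real.rpow_le_rpow ht0 (ht.trans (min_le_right _ _)) (show 0 ≤ 2 * D.σ by linarith)
    rwa [← Real.rpow_mul hε.le, one_div_mul_cancel (by linarith), Real.rpow_one] at this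
  · exact h t ht0 (ht.trans (min_le_left _ _))
  · have h3 : D.θ * D.F t ≤ t * D.f t := D.f3 t ht0
    have := h t ht0 (ht.trans (min_le_left _ _))
    have := D.hθ
    have := D.F_nonneg ht0
    nlinarith

theorem H_small (L : ℝ) : ∀ ε > 0, ∃ δ > 0, ∀ s ∈ Icc 1 L, ∀ t, |t| ≤ δ → D.H s t ≤ ε * t ^ 2 := by
  intro ε hε
  have hc := D.c_pos
  have hk := D.hCκ
  obtain ⟨δ, hδ, h⟩ := D.f_F_small (ε / (D.c * (1 + D.Cκ))) (by positivity)
  refine ⟨δ, hδ, fun s hs t ht => ?_⟩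
  rcases le_total t 0 with h0 | h0
  · rw [D.H_neg s h0]; positivity
  rw [abs_of_nonneg h0] at ht
  obtain ⟨h1, -, h3⟩ := h t h0 ht
  unfold H
  rw [max_eq_left h0]
  have hσ := D.hσ
  set e := ε / (D.c * (1 + D.Cκ)) with he
  have he0 : 0 < e := by positivity
  have h4 : t ^ (2 * D.σ + 2) / (2 * D.σ + 2) ≤ e * t ^ 2 := by
    have : t ^ (2 * D.σ + 2) = t ^ (2 * D.σ) * t ^ 2 := by
      rw [Real.rpow_add' h0 (by linarith)]; norm_num
    rw [this, div_le_iff₀ (by linarith)]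
    have : t ^ (2 * D.σ) * t ^ 2 ≤ e * t ^ 2 := by gcongr
    nlinarith [mul_nonneg he0.le (sq_nonneg t)]
  have h5 : D.κ s * D.F t ≤ D.Cκ * (e * t ^ 2) :=
    mul_le_mul (D.κ_le hs.1) h3 (D.F_nonneg h0) hk.le
  have h6 : D.w s * (t ^ (2 * D.σ + 2) / (2 * D.σ + 2) + D.κ s * D.F t) ≤ D.c * (e * t ^ 2 + D.Cκ * (e * t ^ 2)) := by
    apply mul_le_mul (D.w_le s) (add_le_add h4 h5) _ hc.le
    have := D.κ0 s
    have := D.F_nonneg h0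
    positivity
  refine h6.trans (le_of_eq ?_)
  rw [he]; field_simp

structure Sol (L : ℝ) (u y g : ℝ → ℝ) : Prop where
  du : ∀ x, HasDerivAt u (y x) x
  dy : ∀ x, HasDerivAt y (-g x) x
  gc : Continuous g
  gh : ∀ x ∈ Icc 1 L, g x = D.h x (u x)
  u1 : u 1 = 0
  yL : y L = 0

theorem sol_exists (L : ℝ) (hL : 1 < L) (G : ℝ → ℝ) (hG : ContinuousOn G (Icc 1 L))
    (hG0 : 0 < ∫ s in (1:ℝ)..L, G s ^ 2) (cs : ℝ)
    (hpath : ∀ t ≥ 0, 1 / 2 * t ^ 2 * (∫ s in (1:ℝ)..L, G s ^ 2)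
      - ∫ s in (1:ℝ)..L, D.H s (t * ∫ r in (1:ℝ)..s, G r) ≤ cs)
    (hneg : ∀ T0 : ℝ, ∃ T ≥ T0, 1 / 2 * T ^ 2 * (∫ s in (1:ℝ)..L, G s ^ 2)
      - ∫ s in (1:ℝ)..L, D.H s (T * ∫ r in (1:ℝ)..s, G r) ≤ 0) :
    ∃ u y g, D.Sol L u y g ∧ 0 < 1 / 2 * (∫ s in (1:ℝ)..L, u s * g s) - ∫ s in (1:ℝ)..L, D.H s (u s) ∧
      1 / 2 * (∫ s in (1:ℝ)..L, u s * g s) - ∫ s in (1:ℝ)..L, D.H s (u s) ≤ cs := by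
  obtain ⟨v0, hv0, hv1⟩ := kE_test L hL.le G hG
  have key : ∀ t : ℝ, ∫ s in (1:ℝ)..L, D.H s (t * inner ℝ v0 (kE s)) = ∫ s in (1:ℝ)..L, D.H s (t * ∫ r in (1:ℝ)..s, G r) := by
    intro t
    refine intervalIntegral.integral_congr fun s hs => ?_
    rw [uIcc_of_le hL.le] at hs
    simp only [hv1 s hs]
  obtain ⟨v, hv, hJ, hJ2⟩ := crit_exists kE kE_cont L hL D.h D.H D.h_cont D.H_cont D.H_hasDeriv
    (min D.θ (2 * D.σ + 2)) (lt_min D.hθ (by linarith [D.hσ])) D.H_AR (D.H_small L) D.H_zero v0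
    (by rintro rfl; simp at hv0; linarith) cs
    (by intro t ht; rw [hv0, key]; exact hpath t ht)
    (by intro T0; rw [hv0]; simp_rw [key]; exact hneg T0)
  set u0 : ℝ → ℝ := fun s => inner ℝ v (kE s) with hu0
  have hu0c : Continuous u0 := continuous_const.inner kE_cont
  set g : ℝ → ℝ := fun s => D.h s (u0 s) with hg
  have gc : Continuous g := D.h_cont.comp (continuous_id.prodMk hu0c)
  have hgk : Continuous fun s => g s • kE s := gc.smul kE_cont
  have hv' : v = ∫ s in (1:ℝ)..L, g s • kE s := hv
  have hu0x : ∀ x ∈ Icc 1 L, u0 x = ∫ s in (1:ℝ)..L, g s * (min x s - 1) := by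
    intro x hx
    change inner ℝ v (kE x) = _
    rw [real_inner_comm]
    rw [show inner ℝ (kE x) v = inner ℝ (kE x) (∫ s in (1:ℝ)..L, g s • kE s) from congrArg _ hv', inner_iint _ hgk]
    refine intervalIntegral.integral_congr fun s hs => ?_
    rw [uIcc_of_le hL.le] at hs
    simp only [inner_smul_right, kE_inner]
    rw [max_eq_left]
    simp [hx.1, hs.1]
  have hnorm : ‖v‖ ^ 2 = ∫ s in (1:ℝ)..L, u0 s * g s := by
    rw [← real_inner_self_eq_norm_sq]
    have : inner ℝ v (∫ s in (1:ℝ)..L, g s • kE s) = ∫ s in (1:ℝ)..L, u0 s * g s := by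
      rw [inner_iint _ hgk]
      refine intervalIntegral.integral_congr fun s hs => ?_
      simp only [inner_smul_right, hu0]; ring
    rw [← this]
    exact congrArg _ hv'
  set y : ℝ → ℝ := fun x => ∫ s in x..L, g s with hy
  have dy : ∀ x, HasDerivAt y (-g x) x := fun x =>
    intervalIntegral.integral_hasDerivAt_left (gc.intervalIntegrable _ _) (gc.stronglyMeasurableAtFilter _ _) gc.continuousAt
  set u : ℝ → ℝ := fun x => (∫ s in (1:ℝ)..x, g s * (s - 1)) + (x - 1) * y x with hu
  have gc2 : Continuous fun s => g s * (s - 1) := by fun_prop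
  have du : ∀ x, HasDerivAt u (y x) x := by
    intro x
    have h1 := (gc2.integral_hasStrictDerivAt 1 x).hasDerivAt
    have h2 := (((hasDerivAt_id x).sub_const 1).mul (dy x))
    refine (h1.add h2).congr_deriv ?_
    simp only [id]; ring
  have huu : ∀ x ∈ Icc 1 L, u x = u0 x := by
    intro x hx
    rw [hu0x x hx]
    have hc : Continuous fun s => g s * (min x s - 1) := by fun_prop
    rw [← intervalIntegral.integral_add_adjacent_intervals (hc.intervalIntegrable 1 x) (hc.intervalIntegrable x L)]
    simp only [hu, hy]
    congr 1
    · refine intervalIntegral.integral_congr fun s hs => ?_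
      rw [uIcc_of_le hx.1] at hs
      simp only [min_eq_right hs.2]
    · rw [← intervalIntegral.integral_const_mul]
      refine intervalIntegral.integral_congr fun s hs => ?_
      rw [uIcc_of_le hx.2] at hs
      simp only [min_eq_left hs.1]; ring
  have e1 : ∫ s in (1:ℝ)..L, u s * g s = ‖v‖ ^ 2 := by
    rw [hnorm]
    refine intervalIntegral.integral_congr fun s hs => ?_
    rw [uIcc_of_le hL.le] at hs
    simp only [huu s hs]
  have e2 : ∫ s in (1:ℝ)..L, D.H s (u s) = ∫ s in (1:ℝ)..L, D.H s (inner ℝ v (kE s)) := by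
    refine intervalIntegral.integral_congr fun s hs => ?_
    rw [uIcc_of_le hL.le] at hs
    simp only [huu s hs, hu0]
  refine ⟨u, y, g, ⟨du, dy, gc, fun x hx => ?_, ?_, ?_⟩, ?_, ?_⟩
  · rw [huu x hx]
  · simp [hu]
  · simp [hy]
  · rw [e1, e2]; exact hJ
  · rw [e1, e2]; exact hJ2

end Dat

noncomputable def cR (σ m τ : ℝ) : ℝ := 1 / 2 * Real.sqrt (τ ^ 2 - τ ^ (2 * σ + 2) * m ^ (-(2 * σ)))
noncomputable def cS (σ m t : ℝ) : ℝ := ∫ τ in (0:ℝ)..t, cR σ m τ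

theorem cR_cont (σ m : ℝ) (hσ : 0 < σ) : Continuous (cR σ m) := by
  unfold cR
  have : Continuous fun τ : ℝ => τ ^ (2 * σ + 2) :=
    Continuous.rpow_const continuous_id fun _ => Or.inr (by linarith)
  fun_prop

theorem cR_nonneg (σ m τ : ℝ) : 0 ≤ cR σ m τ := by unfold cR; positivity

theorem cS_deriv (σ m t : ℝ) (hσ : 0 < σ) : HasDerivAt (cS σ m) (cR σ m t) t :=
  ((cR_cont σ m hσ).integral_hasStrictDerivAt 0 t).hasDerivAt

theorem cS_nonneg (σ m t : ℝ) (ht : 0 ≤ t) : 0 ≤ cS σ m t :=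
  intervalIntegral.integral_nonneg ht fun _ _ => cR_nonneg _ _ _

theorem cR_le (σ m τ : ℝ) (hτ : 0 ≤ τ) (hm : 0 < m) : cR σ m τ ≤ τ / 2 := by
  unfold cR
  have : Real.sqrt (τ ^ 2 - τ ^ (2 * σ + 2) * m ^ (-(2 * σ))) ≤ τ := by
    refine (Real.sqrt_le_sqrt (y := τ ^ 2) ?_).trans (Real.sqrt_sq hτ).le
    have : 0 ≤ τ ^ (2 * σ + 2) * m ^ (-(2 * σ)) := by positivity
    linarith
  linarith

theorem cS_le (σ m t : ℝ) (hσ : 0 < σ) (ht : 0 ≤ t) (hm : 0 < m) : cS σ m t ≤ t ^ 2 / 4 := by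
  unfold cS
  have : ∫ τ in (0:ℝ)..t, τ / 2 = t ^ 2 / 4 := by
    rw [intervalIntegral.integral_div, integral_id]; ring
  rw [← this]
  refine intervalIntegral.integral_mono_on ht ((cR_cont σ m hσ).intervalIntegrable _ _)
    ((continuous_id.div_const 2).intervalIntegrable _ _) fun τ hτ => cR_le σ m τ hτ.1 hm

theorem cR_scale (σ m τ : ℝ) (hσ : 0 < σ) (hm : 0 < m) (hτ : 0 ≤ τ) : cR σ m (m * τ) = m * cR σ 1 τ := by
  unfold cR
  have : (m * τ) ^ 2 - (m * τ) ^ (2 * σ + 2) * m ^ (-(2 * σ)) = m ^ 2 * (τ ^ 2 - τ ^ (2 * σ + 2) * 1 ^ (-(2 * σ))) := by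
    rw [Real.mul_rpow hm.le hτ, Real.one_rpow]
    have : m ^ (2 * σ + 2) * m ^ (-(2 * σ)) = m ^ 2 := by
      rw [← Real.rpow_add hm]; ring_nf; norm_num
    linear_combination (-τ ^ (2 * σ + 2)) * this
  rw [this, Real.sqrt_mul (by positivity), Real.sqrt_sq hm.le]; ring

theorem cS_scale (σ m : ℝ) (hσ : 0 < σ) (hm : 0 < m) : cS σ m m = m ^ 2 * cS σ 1 1 := by
  unfold cS
  have := intervalIntegral.smul_integral_comp_mul_left (a := 0) (b := 1) (cR σ m) m
  rw [mul_zero, mul_one] at this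
  rw [← this]
  have e : ∫ x in (0:ℝ)..1, cR σ m (m * x) = ∫ x in (0:ℝ)..1, m * cR σ 1 x := by
    refine intervalIntegral.integral_congr fun s hs => ?_
    rw [uIcc_of_le zero_le_one] at hs
    exact cR_scale σ m s hσ hm hs.1
  rw [e, intervalIntegral.integral_const_mul, smul_eq_mul]; ring

theorem cS_pos (σ : ℝ) (hσ : 0 < σ) : 0 < cS σ 1 1 := by
  unfold cS
  refine intervalIntegral.intervalIntegral_pos_of_pos_on ((cR_cont σ 1 hσ).intervalIntegrable _ _) ?_ one_pos
  intro τ hτ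
  unfold cR
  have : 0 < τ ^ 2 - τ ^ (2 * σ + 2) * 1 ^ (-(2 * σ)) := by
    rw [Real.one_rpow, mul_one]
    have := Real.rpow_lt_rpow_of_exponent_gt hτ.1 hτ.2 (show (2:ℝ) < 2 * σ + 2 by linarith)
    rw [Real.rpow_two] at this
    linarith
  have := Real.sqrt_pos.2 this
  linarith

namespace Dat
variable (D : Dat)

noncomputable def m0 : ℝ := ((1 + D.σ) / (4 * D.c)) ^ (1 / (2 * D.σ))
noncomputable def m1 : ℝ := ((1 + D.σ) / D.c) ^ (1 / (2 * D.σ))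

theorem m0_pos : 0 < D.m0 := by have := D.hσ; have := D.c_pos; unfold m0; positivity
theorem m1_pos : 0 < D.m1 := by have := D.hσ; have := D.c_pos; unfold m1; positivity
theorem m0_pow : D.m0 ^ (2 * D.σ) = (1 + D.σ) / (4 * D.c) := by
  have := D.hσ; have := D.c_pos; unfold m0
  rw [← Real.rpow_mul (by positivity), one_div_mul_cancel (by positivity), Real.rpow_one]
theorem m1_pow : D.m1 ^ (2 * D.σ) = (1 + D.σ) / D.c := by
  have := D.hσ; have := D.c_pos; unfold m1
  rw [← Real.rpow_mul (by positivity), one_div_mul_cancel (by positivity), Real.rpow_one]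
theorem m1_eq : D.m1 * 2 ^ (-(1 / D.σ)) = D.m0 := by
  have := D.hσ; have := D.c_pos; unfold m1 m0
  rw [show (1 + D.σ) / (4 * D.c) = (1 + D.σ) / D.c * (2 ^ (-(2:ℝ))) by
    rw [Real.rpow_neg (by norm_num)]; norm_num; field_simp, Real.mul_rpow (by positivity) (by positivity),
    ← Real.rpow_mul (by norm_num)]
  congr 2; field_simp

noncomputable def Kst : ℝ := 4 * cS D.σ D.m0 D.m0 * (1 + D.σ) / D.σ

theorem Kst_pos : 0 < D.Kst := by
  have := D.hσ; have := D.m0_pos; have := cS_pos D.σ D.hσ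
  unfold Kst; rw [cS_scale _ _ D.hσ D.m0_pos]; positivity

noncomputable def bA (z x : ℝ) : ℝ := z ^ D.σ + x ^ D.σ
noncomputable def bU (z x : ℝ) : ℝ := D.m1 * √z * x * D.bA z x ^ (-(1 / D.σ))
noncomputable def bV (z x : ℝ) : ℝ := D.m1 * √z * z ^ D.σ * D.bA z x ^ (-(1 / D.σ) - 1)

variable {D} {z x : ℝ}

theorem bA_pos (hz : 0 < z) (hx : 0 < x) : 0 < D.bA z x := by unfold bA; positivity

theorem bA_deriv (hx : 0 < x) : HasDerivAt (D.bA z) (D.σ * x ^ (D.σ - 1)) x := by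
  unfold bA
  exact (Real.hasDerivAt_rpow_const (Or.inl hx.ne')).const_add _

theorem bA_pow_deriv (a : ℝ) (hz : 0 < z) (hx : 0 < x) :
    HasDerivAt (fun x => D.bA z x ^ a) (D.σ * x ^ (D.σ - 1) * a * D.bA z x ^ (a - 1)) x :=
  (bA_deriv hx).rpow_const (Or.inl (bA_pos hz hx).ne')

theorem bU_pos (hz : 0 < z) (hx : 0 < x) : 0 < D.bU z x := by
  have := D.m1_pos; have := bA_pos (D := D) hz hx; unfold bU; positivity
theorem bV_pos (hz : 0 < z) (hx : 0 < x) : 0 < D.bV z x := by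
  have := D.m1_pos; have := bA_pos (D := D) hz hx; unfold bV; positivity

theorem bU_deriv (hz : 0 < z) (hx : 0 < x) : HasDerivAt (D.bU z) (D.bV z x) x := by
  have h1 := ((hasDerivAt_id x).const_mul (D.m1 * √z)).mul (bA_pow_deriv (D := D) (-(1 / D.σ)) hz hx)
  refine h1.congr_deriv ?_
  have hA := bA_pos (D := D) hz hx
  have hσ := D.hσ
  have e1 : D.bA z x ^ (-(1 / D.σ)) = D.bA z x ^ (-(1 / D.σ) - 1) * D.bA z x := by
    rw [← Real.rpow_add_one hA.ne']; ring_nf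
  have e2 : x * x ^ (D.σ - 1) = x ^ D.σ := by
    rw [mul_comm, ← Real.rpow_add_one hx.ne']; ring_nf
  unfold bV
  simp only [id]
  rw [e1]
  set Q := D.bA z x ^ (-(1 / D.σ) - 1)
  have e3 : D.bA z x = z ^ D.σ + x ^ D.σ := rfl
  rw [e3, ← e2]
  field_simp
  ring

theorem bV_deriv (hz : 0 < z) (hx : 1 ≤ x) : HasDerivAt (D.bV z) (-(D.w x * D.bU z x ^ (2 * D.σ + 1))) x := by
  have hx0 : 0 < x := by linarith
  have h1 := (bA_pow_deriv (D := D) (-(1 / D.σ) - 1) hz hx0).const_mul (D.m1 * √z * z ^ D.σ)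
  refine h1.congr_deriv ?_
  have hA := bA_pos (D := D) hz hx0
  have hσ := D.hσ
  have hc := D.c_pos
  rw [D.w_eq hx]
  unfold bU
  have hm := D.m1_pos
  have hsz : 0 < √z := Real.sqrt_pos.2 hz
  rw [Real.mul_rpow (by positivity) (by positivity), Real.mul_rpow (by positivity) (by positivity), Real.mul_rpow (by positivity) (by positivity)]
  rw [Real.rpow_add_one hm.ne', D.m1_pow, Real.rpow_add_one hsz.ne', ← Real.rpow_mul hA.le]
  have e1 : √z ^ (2 * D.σ) = z ^ D.σ := by
    rw [Real.sqrt_eq_rpow, ← Real.rpow_mul hz.le]; ring_nf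
  have e2 : -(1 / D.σ) * (2 * D.σ + 1) = -(1 / D.σ) - 1 - 1 := by field_simp; ring
  rw [e1, e2]
  have e3 : x ^ (D.σ - 1) = x ^ (-(D.σ + 2)) * x ^ (2 * D.σ + 1) := by
    rw [← Real.rpow_add hx0]; ring_nf
  rw [e3]
  field_simp
  ring

end Dat

namespace Dat

noncomputable def bP (D : Dat) (z x : ℝ) : ℝ := D.m1 * √z * √x * D.bA z x ^ (-(1 / D.σ))

variable {D : Dat} {z x : ℝ}

theorem bP_pos (hz : 0 < z) (hx : 0 < x) : 0 < D.bP z x := by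
  have := D.m1_pos; have := bA_pos (D := D) hz hx
  have : 0 < √x := Real.sqrt_pos.2 hx
  have : 0 < √z := Real.sqrt_pos.2 hz
  unfold bP; positivity

theorem bU_eq (hx : 0 < x) : D.bU z x = √x * D.bP z x := by
  unfold bU bP
  nth_rewrite 1 [← Real.mul_self_sqrt hx.le]
  ring

theorem sqrt_rpow (hz : 0 < z) (a : ℝ) : √z ^ (2 * a) = z ^ a := by
  rw [Real.sqrt_eq_rpow, ← Real.rpow_mul hz.le]; ring_nf

theorem bP_pow (hz : 0 < z) (hx : 0 < x) :
    D.bP z x ^ (2 * D.σ) = (1 + D.σ) / D.c * (z ^ D.σ * x ^ D.σ) / D.bA z x ^ 2 := by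
  have hm := D.m1_pos; have hA := bA_pos (D := D) hz hx; have hσ := D.hσ
  unfold bP
  rw [Real.mul_rpow (by positivity) (by positivity), Real.mul_rpow (by positivity) (by positivity), Real.mul_rpow (by positivity) (by positivity),
    D.m1_pow, sqrt_rpow hz, sqrt_rpow hx, ← Real.rpow_mul hA.le]
  rw [show -(1 / D.σ) * (2 * D.σ) = -(2:ℝ) by field_simp, Real.rpow_neg hA.le, Real.rpow_two]
  ring

theorem bP_deriv (hz : 0 < z) (hx : 0 < x) :
    HasDerivAt (D.bP z) (D.bP z x * (z ^ D.σ - x ^ D.σ) / (2 * D.bA z x * x)) x := by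
  have h1 := ((Real.hasDerivAt_sqrt hx.ne').const_mul (D.m1 * √z)).mul (bA_pow_deriv (D := D) (-(1 / D.σ)) hz hx)
  refine h1.congr_deriv ?_
  have hA := bA_pos (D := D) hz hx
  have hσ := D.hσ
  have e1 : D.bA z x ^ (-(1 / D.σ)) = D.bA z x ^ (-(1 / D.σ) - 1) * D.bA z x := by
    rw [← Real.rpow_add_one hA.ne']; ring_nf
  have e2 : x ^ D.σ = x ^ (D.σ - 1) * x := by
    rw [← Real.rpow_add_one hx.ne']; ring_nf
  unfold bP
  rw [e1]
  set Q := D.bA z x ^ (-(1 / D.σ) - 1)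
  have hs : 0 < √x := Real.sqrt_pos.2 hx
  have e3 : D.bA z x = z ^ D.σ + x ^ D.σ := rfl
  have e4 : x = √x ^ 2 := (Real.sq_sqrt hx.le).symm
  have e5 : z ^ D.σ = D.bA z x - x ^ (D.σ - 1) * x := by rw [e3, e2]; ring
  rw [e2, e5]
  clear e1 e2 e3 e5 h1
  generalize D.bA z x = A at *
  generalize x ^ (D.σ - 1) = B at *
  generalize √x = r at *
  subst e4
  field_simp
  ring

theorem bP_R (hz : 0 < z) (hx : 0 < x) :
    cR D.σ D.m0 (D.bP z x) = D.bP z x * |z ^ D.σ - x ^ D.σ| / (2 * D.bA z x) := by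
  have hP := bP_pos (D := D) hz hx
  have hA := bA_pos (D := D) hz hx
  have hσ := D.hσ
  have hc := D.c_pos
  unfold cR
  have : D.bP z x ^ 2 - D.bP z x ^ (2 * D.σ + 2) * D.m0 ^ (-(2 * D.σ)) = (D.bP z x * |z ^ D.σ - x ^ D.σ| / (D.bA z x)) ^ 2 := by
    rw [Real.rpow_neg D.m0_pos.le, D.m0_pow, Real.rpow_add hP, bP_pow hz hx, Real.rpow_two, div_pow, mul_pow, sq_abs]
    have e3 : D.bA z x = z ^ D.σ + x ^ D.σ := rfl
    have hA' := hA.ne'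
    rw [e3] at hA' ⊢
    field_simp
    ring
  rw [this, Real.sqrt_sq (by positivity)]
  field_simp

theorem bP_E (hz : 0 < z) (hx : 1 ≤ x) (e : ℝ) (he : e * |z ^ D.σ - x ^ D.σ| = z ^ D.σ - x ^ D.σ) :
    HasDerivAt (fun x => D.bP z x ^ 2 / 2 + e * (2 * cS D.σ D.m0 (D.bP z x)))
      (D.bV z x ^ 2 - 1 / (1 + D.σ) * (D.w x * D.bU z x ^ (2 * D.σ + 2))) x := by
  have hx0 : 0 < x := by linarith
  have hP := bP_pos (D := D) hz hx0
  have hA := bA_pos (D := D) hz hx0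
  have hσ := D.hσ
  have hc := D.c_pos
  have h1 := bP_deriv (D := D) hz hx0
  have h2 := (cS_deriv D.σ D.m0 (D.bP z x) hσ).comp x h1
  have h3 := ((h1.pow 2).div_const 2).add ((h2.const_mul 2).const_mul e)
  refine h3.congr_deriv ?_
  rw [bP_R hz hx0]
  have e1 : D.bV z x ^ 2 = D.bP z x ^ 2 * (z ^ D.σ) ^ 2 / (x * D.bA z x ^ 2) := by
    unfold bV bP
    rw [Real.rpow_sub_one hA.ne']
    have := Real.sq_sqrt hx0.le
    field_simp
    rw [this]
  have e2 : D.w x * D.bU z x ^ (2 * D.σ + 2) = (1 + D.σ) * D.bP z x ^ 2 * (z ^ D.σ * x ^ D.σ) / (D.bA z x ^ 2 * x) := by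
    rw [bU_eq hx0, Real.mul_rpow (Real.sqrt_nonneg _) hP.le, Real.rpow_add hP, bP_pow hz hx0, D.w_eq hx, Real.rpow_two,
      show 2 * D.σ + 2 = 2 * (D.σ + 1) by ring, sqrt_rpow hx0, Real.rpow_add_one hx0.ne', show -(D.σ + 2) = -D.σ - 2 by ring,
      Real.rpow_sub hx0, Real.rpow_neg hx0.le, Real.rpow_two]
    field_simp
  rw [e1, e2]
  have e5 : e * (2 * (D.bP z x * |z ^ D.σ - x ^ D.σ| / (2 * D.bA z x) * (D.bP z x * (z ^ D.σ - x ^ D.σ) / (2 * D.bA z x * x))))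
    = (2 * (D.bP z x * (z ^ D.σ - x ^ D.σ) / (2 * D.bA z x) * (D.bP z x * (z ^ D.σ - x ^ D.σ) / (2 * D.bA z x * x)))) := by
    linear_combination (2 * D.bP z x / (2 * D.bA z x) * (D.bP z x * (z ^ D.σ - x ^ D.σ) / (2 * D.bA z x * x))) * he
  rw [e5]
  have e3 : D.bA z x = z ^ D.σ + x ^ D.σ := rfl
  have hA' := hA.ne'
  rw [e3] at hA' ⊢
  field_simp
  push_cast
  ring

end Dat

namespace Dat
variable {D : Dat} {z x L : ℝ}

theorem bU_contOn (hz : 0 < z) (L : ℝ) : ContinuousOn (D.bU z) (Icc 1 L) := fun _ hx =>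
  (bU_deriv hz (by linarith [hx.1])).continuousAt.continuousWithinAt
theorem bV_contOn (hz : 0 < z) (L : ℝ) : ContinuousOn (D.bV z) (Icc 1 L) := fun _ hx =>
  (bV_deriv hz hx.1).continuousAt.continuousWithinAt

theorem bA_ge (hz : 0 < z) (hx : 0 < x) (a : ℝ) (ha : 0 ≤ a) :
    D.bA z x ^ (-a) ≤ z ^ (-(D.σ * a)) ∧ D.bA z x ^ (-a) ≤ x ^ (-(D.σ * a)) := by
  have hz' : 0 < z ^ D.σ := by positivity
  have hx' : 0 < x ^ D.σ := by positivity
  have e1 : z ^ (-(D.σ * a)) = (z ^ D.σ) ^ (-a) := by rw [← Real.rpow_mul hz.le]; ring_nf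
  have e2 : x ^ (-(D.σ * a)) = (x ^ D.σ) ^ (-a) := by rw [← Real.rpow_mul hx.le]; ring_nf
  rw [e1, e2]
  unfold bA
  exact ⟨Real.rpow_le_rpow_of_nonpos hz' (by linarith) (by linarith), Real.rpow_le_rpow_of_nonpos hx' (by linarith) (by linarith)⟩

theorem bU_1 (hz : 0 < z) : D.bU z 1 ≤ D.m1 / √z := by
  have hσ := D.hσ
  have hm := D.m1_pos
  have h := (bA_ge (D := D) hz one_pos (1 / D.σ) (by positivity)).1
  rw [mul_one_div_cancel hσ.ne', Real.rpow_neg_one] at h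
  unfold bU
  have hs := Real.sqrt_pos.2 hz
  calc D.m1 * √z * 1 * D.bA z 1 ^ (-(1 / D.σ)) ≤ D.m1 * √z * 1 * z⁻¹ := by gcongr
    _ = D.m1 / √z := by
      have := Real.sq_sqrt hz.le
      field_simp
      exact this

theorem bV_1 (hz : 0 < z) : D.bV z 1 ≤ D.m1 / √z := by
  have hσ := D.hσ
  have hm := D.m1_pos
  have h := (bA_ge (D := D) hz one_pos (1 / D.σ + 1) (by positivity)).1
  rw [show D.σ * (1 / D.σ + 1) = D.σ + 1 by field_simp; ring, neg_add', Real.rpow_neg hz.le, Real.rpow_add_one hz.ne'] at h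
  unfold bV
  have hs := Real.sqrt_pos.2 hz
  calc D.m1 * √z * z ^ D.σ * D.bA z 1 ^ (-(1 / D.σ) - 1) ≤ D.m1 * √z * z ^ D.σ * (z ^ D.σ * z)⁻¹ := by gcongr
    _ = D.m1 / √z := by
      have := Real.sq_sqrt hz.le
      field_simp
      exact this

theorem bUV_1 (hz : 0 < z) : D.bU z 1 * D.bV z 1 ≤ D.m1 ^ 2 / z := by
  have h := mul_le_mul (bU_1 (D := D) hz) (bV_1 (D := D) hz) (bV_pos hz one_pos).le (by have := D.m1_pos; positivity)
  refine h.trans (le_of_eq ?_)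
  rw [div_mul_div_comm, Real.mul_self_sqrt hz.le]; ring

theorem bUL (hz : 0 < z) (hx : 0 < x) : D.bU z x ≤ D.m1 * √z := by
  have hσ := D.hσ
  have hm := D.m1_pos
  have h := (bA_ge (D := D) hz hx (1 / D.σ) (by positivity)).2
  rw [mul_one_div_cancel hσ.ne', Real.rpow_neg_one] at h
  unfold bU
  calc D.m1 * √z * x * D.bA z x ^ (-(1 / D.σ)) ≤ D.m1 * √z * x * x⁻¹ := by gcongr
    _ = D.m1 * √z := by field_simp

theorem bVL (hz : 0 < z) (hx : 0 < x) : D.bV z x ≤ D.m1 * √z * z ^ D.σ * (x ^ D.σ * x)⁻¹ := by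
  have hσ := D.hσ
  have hm := D.m1_pos
  have h := (bA_ge (D := D) hz hx (1 / D.σ + 1) (by positivity)).2
  rw [show D.σ * (1 / D.σ + 1) = D.σ + 1 by field_simp; ring, neg_add', Real.rpow_neg hx.le, Real.rpow_add_one hx.ne'] at h
  unfold bV
  gcongr

theorem bUVL (hz : 1 ≤ z) (hL : z ^ 2 ≤ L) : D.bU z L * D.bV z L ≤ D.m1 ^ 2 / z := by
  have hz0 : 0 < z := by linarith
  have hL0 : 0 < L := by nlinarith
  have hm := D.m1_pos
  have hσ := D.hσ
  have hzL : z ≤ L := by nlinarith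
  have h := mul_le_mul (bUL (D := D) hz0 hL0) (bVL (D := D) hz0 hL0) (bV_pos hz0 hL0).le (by positivity)
  refine h.trans ?_
  have h1 : z ^ D.σ * (L ^ D.σ * L)⁻¹ ≤ 1 / z ^ 2 := by
    rw [← div_eq_mul_inv, div_le_div_iff₀ (by positivity) (by positivity)]
    have := Real.rpow_le_rpow hz0.le hzL hσ.le
    rw [one_mul]
    exact mul_le_mul this hL (by positivity) (by positivity)
  calc D.m1 * √z * (D.m1 * √z * z ^ D.σ * (L ^ D.σ * L)⁻¹) = D.m1 ^ 2 * (√z) ^ 2 * (z ^ D.σ * (L ^ D.σ * L)⁻¹) := by ring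
    _ ≤ D.m1 ^ 2 * (√z) ^ 2 * (1 / z ^ 2) := by gcongr
    _ = D.m1 ^ 2 / z := by rw [Real.sq_sqrt hz0.le]; field_simp

theorem bPL (hz : 1 ≤ z) (hL : z ^ 2 ≤ L) : D.bP z L ^ 2 ≤ D.m1 ^ 2 / z := by
  have hz0 : 0 < z := by linarith
  have hL0 : 0 < L := by nlinarith
  have h := bUL (D := D) hz0 hL0
  rw [bU_eq hL0] at h
  have hm := D.m1_pos
  have h2 := pow_le_pow_left₀ (by have := bP_pos (D := D) hz0 hL0; positivity) h 2
  rw [mul_pow, mul_pow, Real.sq_sqrt hL0.le, Real.sq_sqrt hz0.le] at h2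
  rw [le_div_iff₀ hz0]
  have : z * (D.bP z L ^ 2 * z) ≤ z * D.m1 ^ 2 := by
    calc z * (D.bP z L ^ 2 * z) = z ^ 2 * D.bP z L ^ 2 := by ring
      _ ≤ L * D.bP z L ^ 2 := by gcongr
      _ ≤ _ := by linarith
  exact le_of_mul_le_mul_left this hz0

theorem bA_zz (hz : 0 < z) : D.bA z z ^ (-(1 / D.σ)) = 2 ^ (-(1 / D.σ)) * z⁻¹ := by
  have : D.bA z z = 2 * z ^ D.σ := by unfold bA; ring
  have hσ := D.hσ
  rw [this, Real.mul_rpow (by norm_num) (by positivity), ← Real.rpow_mul hz.le, show D.σ * -(1 / D.σ) = -1 by field_simp, Real.rpow_neg_one]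

theorem bP_zz (hz : 0 < z) : D.bP z z = D.m0 := by
  unfold bP
  rw [bA_zz hz, ← D.m1_eq]
  calc D.m1 * √z * √z * (2 ^ (-(1 / D.σ)) * z⁻¹) = D.m1 * (√z * √z) * (2 ^ (-(1 / D.σ)) * z⁻¹) := by ring
    _ = _ := by rw [Real.mul_self_sqrt hz.le]; field_simp

theorem bU_zz (hz : 0 < z) : D.bU z z = D.m0 * √z := by
  rw [bU_eq hz, bP_zz hz]; ring

theorem wU_contOn (a : ℝ) (hz : 0 < z) (L : ℝ) :
    ContinuousOn (fun x => D.w x * D.bU z x ^ a) (Icc 1 L) :=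
  D.w_cont.continuousOn.mul ((bU_contOn hz L).rpow_const fun _ hx => Or.inl (bU_pos hz (by linarith [hx.1])).ne')

theorem bQ (hz : 0 < z) (hL : 1 ≤ L) :
    ∫ x in (1:ℝ)..L, D.w x * D.bU z x ^ (2 * D.σ + 2) =
      (∫ x in (1:ℝ)..L, D.bV z x ^ 2) + D.bU z 1 * D.bV z 1 - D.bU z L * D.bV z L := by
  have h := intervalIntegral.integral_eq_sub_of_hasDerivAt (a := 1) (b := L)
    (f := fun x => D.bU z x * D.bV z x) (f' := fun x => D.bV z x ^ 2 - D.w x * D.bU z x ^ (2 * D.σ + 2)) ?_ ?_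
  · rw [intervalIntegral.integral_sub] at h
    · linarith
    · exact (((bV_contOn hz L).pow 2).intervalIntegrable_of_Icc hL)
    · exact ((wU_contOn _ hz L).intervalIntegrable_of_Icc hL)
  · intro x hx
    rw [uIcc_of_le hL] at hx
    have hx0 : 0 < x := by linarith [hx.1]
    refine ((bU_deriv hz hx0).mul (bV_deriv hz hx.1)).congr_deriv ?_
    rw [show 2 * D.σ + 2 = 2 * D.σ + 1 + 1 by ring, Real.rpow_add_one (bU_pos hz hx0).ne' (2 * D.σ + 1)]
    ring
  · exact (((bV_contOn hz L).pow 2).sub (wU_contOn _ hz L)).intervalIntegrable_of_Icc hL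

theorem bQ1 (hz : 0 < z) (hL : 1 ≤ L) :
    ∫ x in (1:ℝ)..L, D.w x * D.bU z x ^ (2 * D.σ + 1) = D.bV z 1 - D.bV z L := by
  have h := intervalIntegral.integral_eq_sub_of_hasDerivAt (a := 1) (b := L)
    (f := fun x => - D.bV z x) (f' := fun x => D.w x * D.bU z x ^ (2 * D.σ + 1)) ?_ ?_
  · rw [h]; ring
  · intro x hx
    rw [uIcc_of_le hL] at hx
    refine (bV_deriv hz hx.1).neg.congr_deriv ?_
    ring
  · exact (wU_contOn _ hz L).intervalIntegrable_of_Icc hL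

theorem bK_le (hz : 1 ≤ z) (hL : z ^ 2 ≤ L) :
    ∫ x in (1:ℝ)..L, D.bV z x ^ 2 ≤ D.Kst + (2 * D.m1 ^ 2 * (1 + D.σ) / D.σ) / z := by
  have hz0 : 0 < z := by linarith
  have hzL : z ≤ L := by nlinarith
  have hL1 : 1 ≤ L := by linarith
  have hσ := D.hσ
  have ic : ∀ a b, 1 ≤ a → a ≤ b → IntervalIntegrable (fun x => D.bV z x ^ 2 - 1 / (1 + D.σ) * (D.w x * D.bU z x ^ (2 * D.σ + 2))) volume a b := by
    intro a b ha hab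
    refine ContinuousOn.intervalIntegrable_of_Icc hab (ContinuousOn.mono (s := Icc 1 b) ?_ (Icc_subset_Icc_left ha))
    exact ((bV_contOn hz0 b).pow 2).sub (continuousOn_const.mul (wU_contOn _ hz0 b))
  have h1 := intervalIntegral.integral_eq_sub_of_hasDerivAt (a := 1) (b := z)
    (f := fun x => D.bP z x ^ 2 / 2 + 1 * (2 * cS D.σ D.m0 (D.bP z x)))
    (f' := fun x => D.bV z x ^ 2 - 1 / (1 + D.σ) * (D.w x * D.bU z x ^ (2 * D.σ + 2))) ?_ (ic _ _ le_rfl hz)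
  swap
  · intro x hx
    rw [uIcc_of_le hz] at hx
    refine bP_E hz0 hx.1 1 ?_
    have := Real.rpow_le_rpow (by linarith [hx.1]) hx.2 hσ.le
    rw [one_mul, abs_of_nonneg (by linarith)]
  have h2 := intervalIntegral.integral_eq_sub_of_hasDerivAt (a := z) (b := L)
    (f := fun x => D.bP z x ^ 2 / 2 + (-1) * (2 * cS D.σ D.m0 (D.bP z x)))
    (f' := fun x => D.bV z x ^ 2 - 1 / (1 + D.σ) * (D.w x * D.bU z x ^ (2 * D.σ + 2))) ?_ (ic _ _ hz hzL)
  swap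
  · intro x hx
    rw [uIcc_of_le hzL] at hx
    refine bP_E hz0 (by linarith [hx.1]) (-1) ?_
    have := Real.rpow_le_rpow (by linarith [hx.1]) hx.1 hσ.le
    rw [abs_of_nonpos (by linarith)]; ring
  have h3 := intervalIntegral.integral_add_adjacent_intervals (ic 1 z le_rfl hz) (ic z L hz hzL)
  have ia : IntervalIntegrable (fun x => D.bV z x ^ 2) volume 1 L := ((bV_contOn hz0 L).pow 2).intervalIntegrable_of_Icc hL1
  have ib : IntervalIntegrable (fun x => 1 / (1 + D.σ) * (D.w x * D.bU z x ^ (2 * D.σ + 2))) volume 1 L :=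
    (continuousOn_const.mul (wU_contOn _ hz0 L)).intervalIntegrable_of_Icc hL1
  rw [h1, h2, intervalIntegral.integral_sub ia ib, intervalIntegral.integral_const_mul, bQ hz0 hL1] at h3
  simp only [bP_zz hz0] at h3
  set K := ∫ x in (1:ℝ)..L, D.bV z x ^ 2
  have s1 := cS_nonneg D.σ D.m0 (D.bP z 1) (bP_pos hz0 one_pos).le
  have s2 := cS_nonneg D.σ D.m0 (D.bP z L) (bP_pos hz0 (by linarith)).le
  have s3 := sq_nonneg (D.bP z 1)
  have s4 := bPL (D := D) hz hL
  have s5 := bUV_1 (D := D) hz0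
  have s6 := mul_nonneg (bU_pos (D := D) hz0 (show 0 < L by linarith)).le (bV_pos (D := D) hz0 (show 0 < L by linarith)).le
  set S := cS D.σ D.m0 D.m0 with hS
  have s7 : 1 / (1 + D.σ) * (K + D.bU z 1 * D.bV z 1 - D.bU z L * D.bV z L) ≤ 1 / (1 + D.σ) * (K + D.m1 ^ 2 / z) := by
    gcongr; linarith
  have s8 : K - 1 / (1 + D.σ) * (K + D.m1 ^ 2 / z) ≤ 4 * S + D.m1 ^ 2 / z / 2 := by linarith
  have s9 : 0 ≤ D.m1 ^ 2 / z := by positivity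
  have e : K - 1 / (1 + D.σ) * (K + D.m1 ^ 2 / z) = (D.σ * K - D.m1 ^ 2 / z) / (1 + D.σ) := by field_simp; ring
  rw [e, div_le_iff₀ (by linarith)] at s8
  have e2 : D.Kst + (2 * D.m1 ^ 2 * (1 + D.σ) / D.σ) / z = (4 * S * (1 + D.σ) + 2 * (D.m1 ^ 2 / z) * (1 + D.σ)) / D.σ := by
    unfold Kst; rw [← hS]; field_simp
  rw [e2, le_div_iff₀ hσ]
  nlinarith

theorem bV_anti (hz : 0 < z) {y : ℝ} (hx : 0 < x) (hxy : x ≤ y) : D.bV z y ≤ D.bV z x := by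
  have hσ := D.hσ
  have hm := D.m1_pos
  unfold bV
  have := Real.rpow_le_rpow hx.le hxy hσ.le
  have : D.bA z y ^ (-(1 / D.σ) - 1) ≤ D.bA z x ^ (-(1 / D.σ) - 1) := by
    refine Real.rpow_le_rpow_of_nonpos (bA_pos hz hx) ?_ ?_
    · unfold bA; linarith
    · have : 0 < 1 / D.σ := by positivity
      linarith
  gcongr

theorem bU_mono (hz : 0 < z) {y : ℝ} (hx : 1 ≤ x) (hxy : x ≤ y) : D.bU z x ≤ D.bU z y := by
  have : MonotoneOn (D.bU z) (Icc 1 y) := by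
    refine monotoneOn_of_deriv_nonneg (convex_Icc _ _) (bU_contOn hz y) ?_ ?_
    · intro t ht
      rw [interior_Icc] at ht
      exact (bU_deriv hz (by linarith [ht.1])).differentiableAt.differentiableWithinAt
    · intro t ht
      rw [interior_Icc] at ht
      rw [(bU_deriv hz (by linarith [ht.1])).deriv]
      exact (bV_pos hz (by linarith [ht.1])).le
  exact this ⟨hx, hxy⟩ ⟨by linarith, le_rfl⟩ hxy

noncomputable def Kmin (D : Dat) : ℝ := D.m1 ^ 2 * ((1 + 2 ^ D.σ) ^ (-(1 / D.σ) - 1)) ^ 2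

theorem Kmin_pos : 0 < D.Kmin := by
  have hm := D.m1_pos
  unfold Kmin; positivity

theorem bV_2z (hz : 0 < z) : D.bV z (2 * z) ^ 2 * z = D.Kmin := by
  have hσ := D.hσ
  unfold bV Kmin
  have : D.bA z (2 * z) = (1 + 2 ^ D.σ) * z ^ D.σ := by
    unfold bA; rw [Real.mul_rpow (by norm_num) hz.le]; ring
  rw [this, Real.mul_rpow (by positivity) (by positivity), ← Real.rpow_mul hz.le,
    show D.σ * (-(1 / D.σ) - 1) = -D.σ - 1 by field_simp; ring, Real.rpow_sub_one hz.ne', Real.rpow_neg hz.le]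
  set q := (1 + 2 ^ D.σ : ℝ) ^ (-(1 / D.σ) - 1)
  have := Real.sq_sqrt hz.le
  field_simp
  rw [this]; ring

theorem bK_ge (hz : 2 ≤ z) (hL : z ^ 2 ≤ L) : D.Kmin ≤ ∫ x in (1:ℝ)..L, D.bV z x ^ 2 := by
  have hz0 : 0 < z := by linarith
  have hzL : 2 * z ≤ L := by nlinarith
  have ii := ((bV_contOn (D := D) hz0 L).pow 2).intervalIntegrable_of_Icc (μ := volume) (show 1 ≤ L by linarith)
  have h1 : ∫ x in z..(2 * z), D.bV z x ^ 2 ≤ ∫ x in (1:ℝ)..L, D.bV z x ^ 2 :=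
    intervalIntegral.integral_mono_interval (by linarith) (by linarith) hzL (Eventually.of_forall fun x => sq_nonneg _) ii
  have h2 : ∫ x in z..(2 * z), D.bV z (2 * z) ^ 2 ≤ ∫ x in z..(2 * z), D.bV z x ^ 2 := by
    refine intervalIntegral.integral_mono_on (by linarith) (by simp) ?_ ?_
    · refine ii.mono_set ?_
      rw [uIcc_of_le (by linarith), uIcc_of_le (by linarith)]
      exact Icc_subset_Icc (by linarith) hzL
    · intro x hx
      exact pow_le_pow_left₀ (bV_pos hz0 (by linarith)).le (bV_anti hz0 (by linarith [hx.1]) hx.2) 2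
  have h3 : ∫ x in z..(2 * z), D.bV z (2 * z) ^ 2 = D.Kmin := by
    rw [← bV_2z hz0]; simp; ring
  linarith

theorem bQhat (hz : 1 ≤ z) (hL : z ^ 2 ≤ L) :
    (∫ x in (1:ℝ)..L, D.bV z x ^ 2) - (2 * D.σ + 3) * D.m1 ^ 2 / z ≤
      ∫ x in (1:ℝ)..L, D.w x * (D.bU z x - D.bU z 1) ^ (2 * D.σ + 2) := by
  have hz0 : 0 < z := by linarith
  have hL1 : 1 ≤ L := by nlinarith
  have hσ := D.hσ
  set p := 2 * D.σ + 2 with hp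
  have hb : ∀ x ∈ Icc 1 L, D.w x * D.bU z x ^ p - p * D.bU z 1 * (D.w x * D.bU z x ^ (2 * D.σ + 1)) ≤ D.w x * (D.bU z x - D.bU z 1) ^ p := by
    intro x hx
    have hU := bU_pos (D := D) hz0 (show 0 < x by linarith [hx.1])
    have hU1 := bU_pos (D := D) hz0 one_pos
    have hUm := bU_mono (D := D) hz0 le_rfl hx.1
    have hr : D.bU z 1 / D.bU z x ≤ 1 := (div_le_one hU).2 hUm
    have := one_add_mul_self_le_rpow_one_add (s := -(D.bU z 1 / D.bU z x)) (by linarith) (p := p) (by linarith)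
    have e1 : (D.bU z x - D.bU z 1) ^ p = D.bU z x ^ p * (1 + -(D.bU z 1 / D.bU z x)) ^ p := by
      rw [← Real.mul_rpow hU.le (by linarith)]; congr 1; field_simp; ring
    have e2 : D.bU z x ^ (2 * D.σ + 1) = D.bU z x ^ p / D.bU z x := by
      rw [← Real.rpow_sub_one hU.ne']; congr 1; rw [hp]; ring
    rw [e1, e2]
    have h3 := mul_le_mul_of_nonneg_left this (mul_nonneg (D.w_pos x).le (Real.rpow_nonneg hU.le p))
    refine le_trans (le_of_eq ?_) (h3.trans (le_of_eq (by ring)))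
    field_simp
    ring
  have ia : IntervalIntegrable (fun x => D.w x * D.bU z x ^ p) volume 1 L := (wU_contOn (D := D) p hz0 L).intervalIntegrable_of_Icc hL1
  have ib : IntervalIntegrable (fun x => p * D.bU z 1 * (D.w x * D.bU z x ^ (2 * D.σ + 1))) volume 1 L :=
    (continuousOn_const.mul (wU_contOn _ hz0 L)).intervalIntegrable_of_Icc hL1
  have id' : IntervalIntegrable (fun x => D.w x * (D.bU z x - D.bU z 1) ^ p) volume 1 L :=
    (D.w_cont.continuousOn.mul (((bU_contOn hz0 L).sub continuousOn_const).rpow_const (fun _ _ => Or.inr (by linarith)))).intervalIntegrable_of_Icc hL1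
  have h1 := intervalIntegral.integral_mono_on hL1 (μ := volume) (ia.sub ib) id' hb
  refine le_trans ?_ h1
  rw [intervalIntegral.integral_sub ia ib, intervalIntegral.integral_const_mul,
    bQ hz0 hL1, bQ1 hz0 hL1]
  have s5 := bUV_1 (D := D) hz0
  have s6 := bUVL (D := D) hz hL
  have s7 := mul_pos (bU_pos (D := D) hz0 one_pos) (bV_pos (D := D) hz0 one_pos)
  have s8 := mul_pos (bU_pos (D := D) hz0 one_pos) (bV_pos (D := D) hz0 (show 0 < L by linarith))
  have s9 : p * D.bU z 1 * (D.bV z 1 - D.bV z L) ≤ p * (D.m1 ^ 2 / z) := by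
    have : D.bU z 1 * (D.bV z 1 - D.bV z L) ≤ D.m1 ^ 2 / z := by nlinarith
    rw [mul_assoc]
    exact mul_le_mul_of_nonneg_left this (by linarith)
  have e : (2 * D.σ + 3) * D.m1 ^ 2 / z = p * (D.m1 ^ 2 / z) + D.m1 ^ 2 / z := by rw [hp]; ring
  linarith

end Dat

namespace Dat
variable {D : Dat} {z x L : ℝ}

theorem bV_int (hz : 0 < z) (hx : 1 ≤ x) : ∫ r in (1:ℝ)..x, D.bV z r = D.bU z x - D.bU z 1 := by
  refine intervalIntegral.integral_eq_sub_of_hasDerivAt ?_ ((bV_contOn hz x).intervalIntegrable_of_Icc hx)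
  intro t ht
  rw [uIcc_of_le hx] at ht
  exact bU_deriv hz (by linarith [ht.1])

theorem H_low (hz : 2 ≤ z) (hL : z ^ 2 ≤ L) (t : ℝ) (ht : 0 ≤ t) (n : ℝ)
    (hn : ∀ x ∈ Icc z (2 * z), n ≤ D.w x * (D.κ x * D.F (t * (D.bU z x - D.bU z 1)))) :
    t ^ (2 * D.σ + 2) / (2 * D.σ + 2) * (∫ x in (1:ℝ)..L, D.w x * (D.bU z x - D.bU z 1) ^ (2 * D.σ + 2)) + z * n
      ≤ ∫ s in (1:ℝ)..L, D.H s (t * ∫ r in (1:ℝ)..s, D.bV z r) := by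
  have hz0 : 0 < z := by linarith
  have hzL : 2 * z ≤ L := by nlinarith
  have hL1 : 1 ≤ L := by linarith
  have hσ := D.hσ
  have c1 : ContinuousOn (fun x => D.bU z x - D.bU z 1) (Icc 1 L) := (bU_contOn hz0 L).sub continuousOn_const
  have c2 : ContinuousOn (fun x => t ^ (2 * D.σ + 2) / (2 * D.σ + 2) * (D.w x * (D.bU z x - D.bU z 1) ^ (2 * D.σ + 2))) (Icc 1 L) :=
    continuousOn_const.mul (D.w_cont.continuousOn.mul (c1.rpow_const fun _ _ => Or.inr (by linarith)))
  have c3 : ContinuousOn (fun x => D.w x * (D.κ x * D.F (t * (D.bU z x - D.bU z 1)))) (Icc 1 L) :=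
    D.w_cont.continuousOn.mul (D.κc.continuousOn.mul (D.F_cont.comp_continuousOn (continuousOn_const.mul c1)))
  have i2 := c2.intervalIntegrable_of_Icc (μ := volume) hL1
  have i3 := c3.intervalIntegrable_of_Icc (μ := volume) hL1
  have e : ∫ s in (1:ℝ)..L, D.H s (t * ∫ r in (1:ℝ)..s, D.bV z r) =
      ∫ x in (1:ℝ)..L, (t ^ (2 * D.σ + 2) / (2 * D.σ + 2) * (D.w x * (D.bU z x - D.bU z 1) ^ (2 * D.σ + 2))
        + D.w x * (D.κ x * D.F (t * (D.bU z x - D.bU z 1)))) := by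
    refine intervalIntegral.integral_congr fun s hs => ?_
    rw [uIcc_of_le hL1] at hs
    have h0 : 0 ≤ D.bU z s - D.bU z 1 := by linarith [bU_mono (D := D) hz0 le_rfl hs.1]
    simp only [H, bV_int hz0 hs.1]
    rw [max_eq_left (by positivity), Real.mul_rpow ht h0]
    ring
  rw [e, intervalIntegral.integral_add i2 i3, intervalIntegral.integral_const_mul]
  gcongr
  have h1 : ∫ x in z..(2 * z), D.w x * (D.κ x * D.F (t * (D.bU z x - D.bU z 1))) ≤ ∫ x in (1:ℝ)..L, D.w x * (D.κ x * D.F (t * (D.bU z x - D.bU z 1))) := by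
    refine intervalIntegral.integral_mono_interval (by linarith) (by linarith) hzL (Eventually.of_forall fun x => ?_) i3
    have := (D.w_pos x).le
    have := D.κ0 x
    have := D.F_nonneg2 (t * (D.bU z x - D.bU z 1))
    simp only [Pi.zero_apply]
    positivity
  refine le_trans ?_ h1
  have h2 : ∫ x in z..(2 * z), n = z * n := by simp; left; ring
  rw [← h2]
  refine intervalIntegral.integral_mono_on (by linarith) (by simp) ?_ hn
  refine i3.mono_set ?_
  rw [uIcc_of_le (by linarith), uIcc_of_le (by linarith)]
  exact Icc_subset_Icc (by linarith) hzL

noncomputable def nu (D : Dat) : ℝ := D.σ / (2 * (1 + D.σ))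

theorem nu_pos : 0 < D.nu := by have := D.hσ; unfold nu; positivity

theorem t_bern (t : ℝ) (ht : 0 ≤ t) : t ^ 2 / 2 - t ^ (2 * D.σ + 2) / (2 * D.σ + 2) ≤ D.nu := by
  have hσ := D.hσ
  have h := one_add_mul_self_le_rpow_one_add (s := t ^ 2 - 1) (by nlinarith) (p := 1 + D.σ) (by linarith)
  rw [show 1 + (t ^ 2 - 1) = t ^ 2 by ring, ← Real.rpow_natCast, ← Real.rpow_mul ht, show ((2:ℕ):ℝ) * (1 + D.σ) = 2 * D.σ + 2 by push_cast; ring] at h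
  unfold nu
  rw [show t ^ ((2:ℕ):ℝ) = t ^ 2 from Real.rpow_natCast t 2] at h
  have : t ^ 2 / 2 - t ^ (2 * D.σ + 2) / (2 * D.σ + 2) = (t ^ 2 * (1 + D.σ) - t ^ (2 * D.σ + 2)) / (2 * (1 + D.σ)) := by
    rw [show 2 * D.σ + 2 = 2 * (1 + D.σ) by ring]
    field_simp
  rw [this]
  gcongr
  linarith

theorem n_low (D : Dat) : ∃ C3 > 0, ∀ M > 0, ∃ z0 ≥ 2, ∀ z ≥ z0, ∀ t, √D.nu ≤ t → ∀ x ∈ Icc z (2 * z),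
    C3 * M / z ^ 2 ≤ D.w x * (D.κ x * D.F (t * (D.bU z x - D.bU z 1))) := by
  have hσ := D.hσ
  have hc := D.c_pos
  have hcκ := D.hcκ
  have hγ := D.hγ
  have hm0 := D.m0_pos
  have hm1 := D.m1_pos
  have ht0 : 0 < √D.nu := Real.sqrt_pos.2 nu_pos
  set b := √D.nu * D.m0 / 2 with hb
  have hb0 : 0 < b := by positivity
  set a := D.γ * D.σ + 2 * D.σ with ha
  refine ⟨D.c * 2 ^ (-(D.σ + 2)) * (D.cκ * 2 ^ (-(D.γ * D.σ / 2)) * b ^ a), by positivity, fun M hM => ?_⟩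
  obtain ⟨T, hT, hF⟩ := D.f4 M
  refine ⟨max (max 2 D.xκ) (max (2 * D.m1 / D.m0) ((T / b) ^ 2)), (le_max_left _ _).trans (le_max_left _ _), fun z hz t ht x hx => ?_⟩
  have hz2 : 2 ≤ z := le_trans ((le_max_left _ _).trans (le_max_left _ _)) hz
  have hzκ : D.xκ ≤ z := le_trans ((le_max_right _ _).trans (le_max_left _ _)) hz
  have hzm : 2 * D.m1 / D.m0 ≤ z := le_trans ((le_max_left _ _).trans (le_max_right _ _)) hz
  have hzT : (T / b) ^ 2 ≤ z := le_trans ((le_max_right _ _).trans (le_max_right _ _)) hz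
  have hz0 : 0 < z := by linarith
  have hs : 0 < √z := Real.sqrt_pos.2 hz0
  have hss : √z * √z = z := Real.mul_self_sqrt hz0.le
  have hU : D.m0 / 2 * √z ≤ D.bU z x - D.bU z 1 := by
    have h1 := bU_mono (D := D) hz0 (by linarith) hx.1
    rw [bU_zz hz0] at h1
    have h2 := bU_1 (D := D) hz0
    have h3 : D.m1 / √z ≤ D.m0 / 2 * √z := by
      rw [div_le_iff₀ hs, mul_assoc, hss]
      rw [div_le_iff₀ hm0] at hzm
      linarith
    linarith
  have harg : b * √z ≤ t * (D.bU z x - D.bU z 1) := by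
    calc b * √z = √D.nu * (D.m0 / 2 * √z) := by rw [hb]; ring
      _ ≤ t * (D.bU z x - D.bU z 1) := mul_le_mul ht hU (by positivity) (by linarith)
  have hTb : T ≤ b * √z := by
    have := Real.sqrt_le_sqrt hzT
    rw [Real.sqrt_sq (by positivity), div_le_iff₀ hb0] at this
    linarith
  have h1 : M * (b ^ a * (z ^ (D.γ * D.σ / 2) * z ^ D.σ)) ≤ D.F (t * (D.bU z x - D.bU z 1)) := by
    refine le_trans (le_of_eq ?_) ((hF (b * √z) hTb).trans (D.F_mono harg))
    have e1 := sqrt_rpow hz0 (D.γ * D.σ / 2 + D.σ)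
    rw [show 2 * (D.γ * D.σ / 2 + D.σ) = D.γ * D.σ + 2 * D.σ by ring] at e1
    rw [Real.mul_rpow hb0.le hs.le, e1, Real.rpow_add hz0]
  have hx0 : 0 < x := by linarith [hx.1]
  have h2 : D.cκ * (2 ^ (-(D.γ * D.σ / 2)) * z ^ (-(D.γ * D.σ / 2))) ≤ D.κ x := by
    refine le_trans ?_ (D.κl x (hzκ.trans hx.1))
    rw [← Real.mul_rpow (by norm_num) hz0.le]
    refine mul_le_mul_of_nonneg_left (Real.rpow_le_rpow_of_nonpos hx0 hx.2 ?_) hcκ.le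
    simp; positivity
  have h3 : D.c * (2 ^ (-(D.σ + 2)) * z ^ (-(D.σ + 2))) ≤ D.w x := by
    rw [D.w_eq (by linarith [hx.1]), ← Real.mul_rpow (by norm_num) hz0.le]
    exact mul_le_mul_of_nonneg_left (Real.rpow_le_rpow_of_nonpos hx0 hx.2 (by linarith)) hc.le
  have h4 := mul_le_mul h3 (mul_le_mul h2 h1 (by positivity) (D.κ0 x)) (by positivity) (D.w_pos x).le
  refine le_trans (le_of_eq ?_) h4
  rw [Real.rpow_neg hz0.le (D.γ * D.σ / 2), Real.rpow_neg hz0.le (D.σ + 2), Real.rpow_add hz0, Real.rpow_two]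
  field_simp

set_option maxHeartbeats 1000000 in
theorem mp_sol (D : Dat) : ∃ cs, cs < D.nu * D.Kst ∧ ∃ L0 > 1, ∀ L ≥ L0, ∃ u y g, D.Sol L u y g ∧
    0 < 1 / 2 * (∫ s in (1:ℝ)..L, u s * g s) - ∫ s in (1:ℝ)..L, D.H s (u s) ∧
      1 / 2 * (∫ s in (1:ℝ)..L, u s * g s) - ∫ s in (1:ℝ)..L, D.H s (u s) ≤ cs := by
  obtain ⟨C3, hC3, hn⟩ := n_low D
  have hσ := D.hσ
  have hm1 := D.m1_pos
  have hKst := D.Kst_pos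
  have hKm := Kmin_pos (D := D)
  have hν := nu_pos (D := D)
  set p := 2 * D.σ + 2 with hp
  have hp0 : 0 < p := by linarith
  set CK := 2 * D.m1 ^ 2 * (1 + D.σ) / D.σ with hCK
  have hCK0 : 0 < CK := by positivity
  set CQ := (2 * D.σ + 3) * D.m1 ^ 2 with hCQ
  have hCQ0 : 0 < CQ := by positivity
  set Y := p * (D.Kst + CK) / D.Kmin with hY
  have hY0 : 0 < Y := by positivity
  set T := max 1 (Y ^ (1 / (2 * D.σ))) with hT
  have hT1 : 1 ≤ T := le_max_left _ _
  have hTp : ∀ t ≥ T, Y ≤ t ^ (2 * D.σ) := by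
    intro t ht
    have := Real.rpow_le_rpow (by positivity) ((le_max_right 1 _).trans ht) (show 0 ≤ 2 * D.σ by linarith)
    rwa [← Real.rpow_mul hY0.le, one_div_mul_cancel (by positivity), Real.rpow_one] at this
  set M := (D.nu * CK + T ^ p * CQ / p + 1) / C3 with hM
  have hM0 : 0 < M := by positivity
  obtain ⟨z0, hz02, hn⟩ := hn M hM0
  set z := max z0 (max (2 * CQ / D.Kmin) ((D.nu * CK + 2) / (D.nu * D.Kst))) with hzdef
  have hz1 : z0 ≤ z := le_max_left _ _
  have hz2 : 2 * CQ / D.Kmin ≤ z := (le_max_left _ _).trans (le_max_right _ _)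
  have hz3 : (D.nu * CK + 2) / (D.nu * D.Kst) ≤ z := (le_max_right _ _).trans (le_max_right _ _)
  have hz : 2 ≤ z := by linarith
  have hzp : 0 < z := by linarith
  rw [div_le_iff₀ (by positivity)] at hz3 hz2
  refine ⟨D.nu * D.Kst - 1 / z, by have : 0 < 1 / z := by positivity
                                   linarith, z ^ 2, by nlinarith, fun L hL => ?_⟩
  have hL' : z ^ 2 ≤ L := hL
  have hL1 : 1 < L := by nlinarith
  have hK1 := bK_le (D := D) (by linarith) hL'
  have hK2 := bK_ge (D := D) hz hL'
  have hQ := bQhat (D := D) (by linarith) hL'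
  rw [← hCK] at hK1
  rw [← hCQ, ← hp] at hQ
  have hlow := fun t ht n hn => H_low (D := D) hz hL' t ht n hn
  rw [← hp] at hlow
  set K := ∫ x in (1:ℝ)..L, D.bV z x ^ 2 with hK
  set Q := ∫ x in (1:ℝ)..L, D.w x * (D.bU z x - D.bU z 1) ^ p
  have hQm : D.Kmin / 2 ≤ Q := by
    have : CQ / z ≤ D.Kmin / 2 := by rw [div_le_div_iff₀ hzp two_pos]; linarith
    linarith
  have hCKz : CK / z ≤ CK := div_le_self hCK0.le (by linarith)
  have hcs0 : (D.nu * CK / 2 + 1) / z ≤ D.nu * D.Kst / 2 := by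
    rw [div_le_div_iff₀ hzp two_pos]; linarith
  have hcsa : (D.nu * CK / 2 + 1) / z = D.nu * (CK / z) / 2 + 1 / z := by field_simp
  have hzi : 0 < 1 / z := by positivity
  have hCKz0 : 0 < CK / z := by positivity
  have hlow0 : ∀ t ≥ 0, t ^ p / p * Q ≤ ∫ s in (1:ℝ)..L, D.H s (t * ∫ r in (1:ℝ)..s, D.bV z r) := by
    intro t ht
    have := hlow t ht 0 (fun x hx => ?_)
    · linarith
    · have := (D.w_pos x).le
      have := D.κ0 x
      have := D.F_nonneg2 (t * (D.bU z x - D.bU z 1))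
      positivity
  have hbig : ∀ t ≥ T, 1 / 2 * t ^ 2 * K - ∫ s in (1:ℝ)..L, D.H s (t * ∫ r in (1:ℝ)..s, D.bV z r) ≤ 0 := by
    intro t ht
    have ht0 : 0 < t := by linarith
    have h1 := hlow0 t ht0.le
    have h2 := hTp t ht
    rw [hY, div_le_iff₀ hKm] at h2
    have e : t ^ p = t ^ (2 * D.σ) * t ^ 2 := by rw [hp, Real.rpow_add ht0, Real.rpow_two]
    have h3 : t ^ p / p * (D.Kmin / 2) ≤ t ^ p / p * Q := by gcongr
    have h4 : 1 / 2 * t ^ 2 * K ≤ t ^ p / p * (D.Kmin / 2) := by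
      rw [e, div_mul_eq_mul_div (t ^ (2 * D.σ) * t ^ 2), le_div_iff₀ hp0]
      have : p * K ≤ p * (D.Kst + CK) := by gcongr; linarith
      have := mul_le_mul_of_nonneg_left (this.trans h2) (sq_nonneg t)
      linarith
    linarith
  refine D.sol_exists L hL1 (D.bV z) (bV_contOn hzp L) (by linarith) _ ?_ ?_
  · intro t ht
    rcases lt_or_ge t (√D.nu) with h | h
    · have h1 := hlow0 t ht
      have h2 : 0 ≤ t ^ p / p * Q := by
        have : 0 ≤ Q := by linarith
        positivity
      have h3 : t ^ 2 ≤ D.nu := by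
        have := pow_le_pow_left₀ ht h.le 2
        rwa [Real.sq_sqrt hν.le] at this
      have h4 : t ^ 2 * K ≤ D.nu * (D.Kst + CK / z) := mul_le_mul h3 hK1 (by linarith) hν.le
      linarith
    · rcases le_total t T with h' | h'
      · have h1 := hlow t ht _ (hn z hz1 t h)
        have h2 := t_bern (D := D) t ht
        rw [← hp] at h2
        have h3 : t ^ p ≤ T ^ p := Real.rpow_le_rpow ht h' hp0.le
        have h4 : K * (t ^ 2 / 2 - t ^ p / p) ≤ K * D.nu := mul_le_mul_of_nonneg_left h2 (by linarith)
        have h5 : t ^ p / p * (K - Q) ≤ T ^ p / p * (CQ / z) := by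
          have : 0 ≤ t ^ p / p := by positivity
          have h6 : t ^ p / p ≤ T ^ p / p := by gcongr
          have : 0 < CQ / z := by positivity
          exact (mul_le_mul_of_nonneg_left (show K - Q ≤ CQ / z by linarith) ‹0 ≤ t ^ p / p›).trans
            (mul_le_mul_of_nonneg_right h6 this.le)
        have h7 : K * D.nu ≤ D.nu * (D.Kst + CK / z) := by
          rw [mul_comm]; exact mul_le_mul_of_nonneg_left hK1 hν.le
        have h8 : z * (C3 * M / z ^ 2) = D.nu * (CK / z) + T ^ p / p * (CQ / z) + 1 / z := by
          rw [hM]; field_simp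
        rw [h8] at h1
        linarith
      · refine (hbig t h').trans ?_
        have a1 := mul_pos hν hCKz0
        have a2 := mul_pos hν hKst
        linarith
  · intro T0
    exact ⟨max T0 T, le_max_left _ _, hbig _ (le_max_right _ _)⟩

end Dat

namespace Dat
namespace Sol
variable {D : Dat} {L : ℝ} {u y g : ℝ → ℝ}

theorem uc (S : D.Sol L u y g) : Continuous u := continuous_iff_continuousAt.2 fun x => (S.du x).continuousAt
theorem yc (S : D.Sol L u y g) : Continuous y := continuous_iff_continuousAt.2 fun x => (S.dy x).continuousAt

theorem g0 (S : D.Sol L u y g) {x : ℝ} (hx : x ∈ Icc 1 L) : 0 ≤ g x := by rw [S.gh x hx]; exact D.h_nonneg _ _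

theorem y_anti (S : D.Sol L u y g) : AntitoneOn y (Icc 1 L) := by
  refine antitoneOn_of_deriv_nonpos (convex_Icc _ _) S.yc.continuousOn (fun x _ => (S.dy x).differentiableAt.differentiableWithinAt) ?_
  intro x hx
  rw [(S.dy x).deriv]
  rw [interior_Icc] at hx
  linarith [S.g0 ⟨hx.1.le, hx.2.le⟩]

theorem y0 (S : D.Sol L u y g) {x : ℝ} (hx : x ∈ Icc 1 L) : 0 ≤ y x := by
  have := S.y_anti hx ⟨hx.1.trans hx.2, le_rfl⟩ hx.2
  rwa [S.yL] at this

theorem u_mono (S : D.Sol L u y g) : MonotoneOn u (Icc 1 L) := by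
  refine monotoneOn_of_deriv_nonneg (convex_Icc _ _) S.uc.continuousOn (fun x _ => (S.du x).differentiableAt.differentiableWithinAt) ?_
  intro x hx
  rw [(S.du x).deriv]
  rw [interior_Icc] at hx
  exact S.y0 ⟨hx.1.le, hx.2.le⟩

theorem u0 (S : D.Sol L u y g) {x : ℝ} (hx : x ∈ Icc 1 L) : 0 ≤ u x := by
  have := S.u_mono ⟨le_rfl, hx.1.trans hx.2⟩ hx hx.1
  rwa [S.u1] at this

theorem uL (S : D.Sol L u y g) {x : ℝ} (hx : x ∈ Icc 1 L) : u x ≤ u L :=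
  S.u_mono hx ⟨hx.1.trans hx.2, le_rfl⟩ hx.2

theorem gh' (S : D.Sol L u y g) {x : ℝ} (hx : x ∈ Icc 1 L) : g x = D.w x * (u x ^ (2 * D.σ + 1) + D.κ x * D.f (u x)) := by
  rw [S.gh x hx, Dat.h, max_eq_left (S.u0 hx)]

theorem int_y (S : D.Sol L u y g) (x0 : ℝ) : ∫ x in x0..L, y x ^ 2 = (∫ x in x0..L, u x * g x) - u x0 * y x0 := by
  have h1 : Continuous fun x => y x ^ 2 := S.yc.pow 2
  have h2 : Continuous fun x => u x * g x := S.uc.mul S.gc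
  have h := intervalIntegral.integral_eq_sub_of_hasDerivAt (a := x0) (b := L)
    (f := fun x => u x * y x) (f' := fun x => y x ^ 2 - u x * g x) ?_ ((h1.sub h2).intervalIntegrable _ _)
  · rw [intervalIntegral.integral_sub (h1.intervalIntegrable _ _) (h2.intervalIntegrable _ _), S.yL] at h
    linarith
  · intro x _
    refine ((S.du x).mul (S.dy x)).congr_deriv ?_
    ring

theorem wu_cont (S : D.Sol L u y g) : Continuous fun x => D.w x * (max (u x) 0) ^ (2 * D.σ + 2) :=
  D.w_cont.mul ((pw_cont _ (by linarith [D.hσ])).comp S.uc)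

theorem Hu_cont (S : D.Sol L u y g) : Continuous fun x => D.H x (u x) := D.H_cont.comp (continuous_id.prodMk S.uc)

theorem J_ge (S : D.Sol L u y g) (hL : 1 ≤ L) : D.nu * ∫ x in (1:ℝ)..L, D.w x * (max (u x) 0) ^ (2 * D.σ + 2) ≤
    1 / 2 * (∫ s in (1:ℝ)..L, u s * g s) - ∫ s in (1:ℝ)..L, D.H s (u s) := by
  have h2 : Continuous fun x => u x * g x := S.uc.mul S.gc
  have h5 : Continuous fun x => 1 / 2 * (u x * g x) := continuous_const.mul h2
  rw [← intervalIntegral.integral_const_mul, ← intervalIntegral.integral_const_mul,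
    ← intervalIntegral.integral_sub (h5.intervalIntegrable _ _) (S.Hu_cont.intervalIntegrable _ _)]
  refine intervalIntegral.integral_mono_on hL ((continuous_const.mul S.wu_cont).intervalIntegrable _ _)
    (((continuous_const.mul h2).sub S.Hu_cont).intervalIntegrable _ _) fun x hx => ?_
  have hu := S.u0 hx
  have hσ := D.hσ
  rw [S.gh' hx, Dat.H, max_eq_left hu]
  have h3 : D.θ * D.F (u x) ≤ u x * D.f (u x) := D.f3 _ hu
  have hF := D.F_nonneg hu
  have hθ := D.hθ
  have e : u x * u x ^ (2 * D.σ + 1) = u x ^ (2 * D.σ + 2) := by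
    have := Real.rpow_add_one' hu (show (2 * D.σ + 1) + 1 ≠ 0 by linarith)
    rw [show 2 * D.σ + 2 = (2 * D.σ + 1) + 1 by ring, this, mul_comm]
  have e2 : D.nu * u x ^ (2 * D.σ + 2) = 1 / 2 * u x ^ (2 * D.σ + 2) - u x ^ (2 * D.σ + 2) / (2 * D.σ + 2) := by
    unfold nu
    rw [show 2 * D.σ + 2 = 2 * (1 + D.σ) by ring]
    field_simp; ring
  have h4 : 0 ≤ D.w x * (D.κ x * (1 / 2 * (u x * D.f (u x)) - D.F (u x))) := by
    have := (D.w_pos x).le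
    have := D.κ0 x
    have : 0 ≤ 1 / 2 * (u x * D.f (u x)) - D.F (u x) := by nlinarith
    positivity
  linear_combination h4 + D.w x * e2 - D.w x / 2 * e

theorem E_le (S : D.Sol L u y g) (hL : 1 ≤ L) : (1 / 2 - 1 / min D.θ (2 * D.σ + 2)) * (∫ s in (1:ℝ)..L, u s * g s) ≤
    1 / 2 * (∫ s in (1:ℝ)..L, u s * g s) - ∫ s in (1:ℝ)..L, D.H s (u s) := by
  have h2 : Continuous fun x => u x * g x := S.uc.mul S.gc
  have hm : 0 < min D.θ (2 * D.σ + 2) := lt_min (by linarith [D.hθ]) (by linarith [D.hσ])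
  have : ∫ s in (1:ℝ)..L, D.H s (u s) ≤ ∫ s in (1:ℝ)..L, 1 / min D.θ (2 * D.σ + 2) * (u s * g s) := by
    refine intervalIntegral.integral_mono_on hL (S.Hu_cont.intervalIntegrable _ _)
      ((continuous_const.mul h2).intervalIntegrable _ _) fun x hx => ?_
    have := D.H_AR x (u x)
    rw [S.gh x hx, one_div_mul_eq_div, le_div_iff₀ hm]
    linarith
  rw [intervalIntegral.integral_const_mul] at this
  linarith

theorem u_sq (S : D.Sol L u y g) (hL : 1 ≤ L) {x : ℝ} (hx : x ∈ Icc 1 L) : u x ^ 2 ≤ (∫ s in (1:ℝ)..L, u s * g s) * x := by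
  have hx0 : 0 < x := by linarith [hx.1]
  have h1 : Continuous fun x => y x ^ 2 := S.yc.pow 2
  have e := S.int_y 1
  rw [S.u1, zero_mul, sub_zero] at e
  rw [← e]
  have m1 : ∫ s in (1:ℝ)..x, y s ^ 2 ≤ ∫ s in (1:ℝ)..L, y s ^ 2 :=
    intervalIntegral.integral_mono_interval le_rfl hx.1 hx.2 (Eventually.of_forall fun x => sq_nonneg _) (h1.intervalIntegrable _ _)
  set s := u x / x with hs
  have m2 : ∫ t in (1:ℝ)..x, (2 * s * y t - s ^ 2) ≤ ∫ t in (1:ℝ)..x, y t ^ 2 := by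
    refine intervalIntegral.integral_mono_on hx.1 (((continuous_const.mul S.yc).sub continuous_const).intervalIntegrable _ _)
      (h1.intervalIntegrable _ _) fun t _ => ?_
    nlinarith [sq_nonneg (s - y t)]
  have e2 : ∫ t in (1:ℝ)..x, y t = u x := by
    rw [intervalIntegral.integral_eq_sub_of_hasDerivAt (fun t _ => S.du t) (S.yc.intervalIntegrable _ _), S.u1, sub_zero]
  have h5 : Continuous fun t => 2 * s * y t := continuous_const.mul S.yc
  rw [intervalIntegral.integral_sub (h5.intervalIntegrable _ _) (by simp), intervalIntegral.integral_const_mul, e2] at m2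
  simp only [intervalIntegral.integral_const, smul_eq_mul] at m2
  have e3 : 2 * s * u x - (x - 1) * s ^ 2 = u x ^ 2 / x + s ^ 2 := by rw [hs]; field_simp; ring
  have := sq_nonneg s
  have h : u x ^ 2 / x ≤ ∫ s in (1:ℝ)..L, y s ^ 2 := by linarith
  rwa [div_le_iff₀ hx0] at h

end Sol

/-- bound on the subcritical part -/
theorem sub_bound (D : Dat) (X : ℝ) (hX : 0 < X) (ε : ℝ) (hε : 0 < ε) : ∃ C > 0, ∀ x t : ℝ, 1 ≤ x → 0 ≤ t → t ^ 2 ≤ X * x →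
    D.κ x * D.f t ≤ ε * t ^ (2 * D.σ + 1) + C * t := by
  have hσ := D.hσ
  have hβ := D.hβ
  have hCκ := D.hCκ
  set B := X ^ (D.β * D.σ / 2) with hB
  have hB0 : 0 < B := by positivity
  obtain ⟨C, hC, hf⟩ := D.fl (ε / (D.Cκ * B)) (by positivity)
  refine ⟨D.Cκ * C + 1, by positivity, fun x t hx ht htx => ?_⟩
  have hx0 : 0 < x := by linarith
  have h1 : D.κ x * t ^ (D.β * D.σ) ≤ D.Cκ * B := by
    have h2 : t ^ (D.β * D.σ) ≤ B * x ^ (D.β * D.σ / 2) := by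
      rw [hB, ← Real.mul_rpow hX.le hx0.le]
      refine le_trans (le_of_eq ?_) (Real.rpow_le_rpow (by positivity) htx (by positivity))
      rw [← Real.rpow_natCast, ← Real.rpow_mul ht]; congr 1; push_cast; ring
    calc D.κ x * t ^ (D.β * D.σ) ≤ (D.Cκ * x ^ (-(D.β * D.σ / 2))) * (B * x ^ (D.β * D.σ / 2)) :=
          mul_le_mul (D.κu x hx) h2 (by positivity) (by positivity)
      _ = D.Cκ * B := by
        rw [Real.rpow_neg hx0.le]; field_simp
  have e : t ^ (2 * D.σ + 1 + D.β * D.σ) = t ^ (2 * D.σ + 1) * t ^ (D.β * D.σ) :=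
    Real.rpow_add' ht (by positivity)
  have h2 := mul_le_mul_of_nonneg_left (hf t ht) (D.κ0 x)
  have h3 : D.κ x * (C * t) ≤ D.Cκ * (C * t) := mul_le_mul_of_nonneg_right (D.κ_le hx) (by positivity)
  have h4 : ε / (D.Cκ * B) * t ^ (2 * D.σ + 1) * (D.κ x * t ^ (D.β * D.σ)) ≤ ε / (D.Cκ * B) * t ^ (2 * D.σ + 1) * (D.Cκ * B) := by
    gcongr
  have e2 : ε / (D.Cκ * B) * t ^ (2 * D.σ + 1) * (D.Cκ * B) = ε * t ^ (2 * D.σ + 1) := by field_simp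
  rw [e] at h2
  nlinarith

end Dat

namespace Dat

theorem calib_step (D : Dat) (u y : ℝ → ℝ) (hy : Continuous y) (du : ∀ x, HasDerivAt u (y x) x) (a b m e : ℝ)
    (ha : 1 ≤ a) (hab : a ≤ b) (hm : 0 < m) (he : e ^ 2 = 1) (hu0 : ∀ x ∈ Icc a b, 0 ≤ u x)
    (hum : ∀ x ∈ Icc a b, u x / √x ≤ m) :
    ((u b / √b) ^ 2 / 2 + e * (2 * cS D.σ m (u b / √b))) - ((u a / √a) ^ 2 / 2 + e * (2 * cS D.σ m (u a / √a))) ≤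
      ∫ x in a..b, (y x ^ 2 - m ^ (-(2 * D.σ)) / (4 * D.c) * (D.w x * (max (u x) 0) ^ (2 * D.σ + 2))) := by
  have hσ := D.hσ
  have hc := D.c_pos
  have uc : Continuous u := continuous_iff_continuousAt.2 fun x => (du x).continuousAt
  have dφ : ∀ x, 0 < x → HasDerivAt (fun x => u x / √x) ((y x - u x / (2 * x)) / √x) x := by
    intro x hx
    have hs : 0 < √x := Real.sqrt_pos.2 hx
    refine ((du x).div (Real.hasDerivAt_sqrt hx.ne') hs.ne').congr_deriv ?_
    have : x = √x ^ 2 := (Real.sq_sqrt hx.le).symm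
    generalize u x = U
    generalize y x = Y
    generalize √x = r at *
    subst this
    field_simp
  have dE : ∀ x, 0 < x → HasDerivAt (fun x => (u x / √x) ^ 2 / 2 + e * (2 * cS D.σ m (u x / √x)))
      ((y x - u x / (2 * x)) / √x * (u x / √x + 2 * e * cR D.σ m (u x / √x))) x := by
    intro x hx
    have h1 := dφ x hx
    have h2 := (cS_deriv D.σ m (u x / √x) hσ).comp x h1
    refine (((h1.pow 2).div_const 2).add ((h2.const_mul 2).const_mul e)).congr_deriv ?_
    push_cast; ring
  have wc : Continuous fun x => D.w x * (max (u x) 0) ^ (2 * D.σ + 2) :=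
    D.w_cont.mul ((pw_cont _ (by linarith)).comp uc)
  have ic : Continuous fun x => y x ^ 2 - m ^ (-(2 * D.σ)) / (4 * D.c) * (D.w x * (max (u x) 0) ^ (2 * D.σ + 2)) :=
    (hy.pow 2).sub (continuous_const.mul wc)
  refine intervalIntegral.sub_le_integral_of_hasDeriv_right_of_le hab (g' := fun x => (y x - u x / (2 * x)) / √x * (u x / √x + 2 * e * cR D.σ m (u x / √x)))
    (fun x hx => (dE x (by linarith [hx.1])).continuousAt.continuousWithinAt) (fun x hx => (dE x (by linarith [hx.1])).hasDerivWithinAt)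
    (ic.continuousOn.integrableOn_compact isCompact_Icc) ?_
  intro x hx
  have hx1 : 1 ≤ x := by linarith [hx.1]
  have hx0 : 0 < x := by linarith
  have hxI : x ∈ Icc a b := ⟨hx.1.le, hx.2.le⟩
  have hs : 0 < √x := Real.sqrt_pos.2 hx0
  have hu := hu0 x hxI
  have hφm := hum x hxI
  set φ := u x / √x with hφ
  have hφ0 : 0 ≤ φ := by positivity
  have hue : u x = √x * φ := by rw [hφ]; field_simp
  have hR : (2 * cR D.σ m φ) ^ 2 = φ ^ 2 - φ ^ (2 * D.σ + 2) * m ^ (-(2 * D.σ)) := by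
    unfold cR
    rw [show ∀ s : ℝ, 2 * (1 / 2 * s) = s by intro s; ring, Real.sq_sqrt]
    rw [Real.rpow_add' hφ0 (by linarith), Real.rpow_two, Real.rpow_neg hm.le]
    have : φ ^ (2 * D.σ) ≤ m ^ (2 * D.σ) := Real.rpow_le_rpow hφ0 hφm (by linarith)
    have h2 : φ ^ (2 * D.σ) * (m ^ (2 * D.σ))⁻¹ ≤ 1 := by
      rw [← div_eq_mul_inv]; exact (div_le_one (by positivity)).2 this
    nlinarith [sq_nonneg φ]
  have hw : D.w x * (max (u x) 0) ^ (2 * D.σ + 2) = D.c * (φ ^ (2 * D.σ + 2) / x) := by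
    rw [max_eq_left hu, hue, D.w_eq hx1, Real.mul_rpow hs.le hφ0,
      show 2 * D.σ + 2 = 2 * (D.σ + 1) by ring, sqrt_rpow hx0, Real.rpow_add_one hx0.ne', show -(D.σ + 2) = -D.σ - 2 by ring,
      Real.rpow_sub hx0, Real.rpow_neg hx0.le, Real.rpow_two]
    field_simp
  rw [hw]
  set R := cR D.σ m φ
  set d := (y x - u x / (2 * x)) / √x with hd
  have hyx : y x = √x * d + φ / (2 * √x) := by
    rw [hd, hue]
    have := Real.sq_sqrt hx0.le
    field_simp
    linear_combination φ * this
  have e1 : y x ^ 2 = x * d ^ 2 + φ * d + φ ^ 2 / (4 * x) := by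
    rw [hyx]
    have : x = √x ^ 2 := (Real.sq_sqrt hx0.le).symm
    generalize √x = r at *
    clear_value d φ
    subst this
    field_simp; ring
  have e2 : m ^ (-(2 * D.σ)) / (4 * D.c) * (D.c * (φ ^ (2 * D.σ + 2) / x)) = (φ ^ 2 - (2 * R) ^ 2) / (4 * x) := by
    rw [hR]; field_simp; ring
  rw [e1, e2]
  have e3 : x * d ^ 2 + φ * d + φ ^ 2 / (4 * x) - (φ ^ 2 - (2 * R) ^ 2) / (4 * x) - d * (φ + 2 * e * R) = (x * d - e * R) ^ 2 / x := by
    have : (x * d - e * R) ^ 2 = x ^ 2 * d ^ 2 - 2 * x * d * e * R + R ^ 2 := by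
      linear_combination R ^ 2 * he
    rw [this]; field_simp; ring
  have e4 : 0 ≤ (x * d - e * R) ^ 2 / x := by positivity
  linarith

theorem s_bern (σ s : ℝ) (hσ : 0 < σ) (hs : 0 < s) : 1 - σ * (s ^ 2 - 1) ≤ s ^ (-(2 * σ)) := by
  have h1 : Real.log (s ^ 2) ≤ s ^ 2 - 1 := Real.log_le_sub_one_of_pos (by positivity)
  have h2 : Real.log (s ^ 2) = 2 * Real.log s := by rw [Real.log_pow]; norm_num
  rw [Real.rpow_def_of_pos hs]
  have := Real.add_one_le_exp (Real.log s * -(2 * σ))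
  nlinarith

/-- conclusion of the calibration argument -/
theorem calib (D : Dat) {L : ℝ} {u y g : ℝ → ℝ} (S : D.Sol L u y g) (x0 : ℝ) (hx0 : x0 ∈ Icc 1 L) (Qs e1 : ℝ)
    (hQs : Qs < D.Kst)
    (hQ : ∫ x in x0..L, D.w x * (max (u x) 0) ^ (2 * D.σ + 2) ≤ Qs)
    (hE : ∫ x in x0..L, u x * g x ≤ (∫ x in x0..L, D.w x * (max (u x) 0) ^ (2 * D.σ + 2)) + e1)
    (he1 : 0 ≤ e1) :
    ∀ x ∈ Icc x0 L, (u x / √x) ^ 2 ≤ D.m0 ^ 2 * ((1 + D.σ) / D.σ) * (e1 + (u x0 / √x0) ^ 2) / (D.Kst - Qs) := by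
  have hσ := D.hσ
  have hc := D.c_pos
  have hm0 := D.m0_pos
  have hK : 0 < D.Kst - Qs := by linarith
  have hsub : ∀ x ∈ Icc x0 L, x ∈ Icc 1 L := fun x hx => ⟨hx0.1.trans hx.1, hx.2⟩
  have φc : ContinuousOn (fun x => u x / √x) (Icc x0 L) := by
    refine S.uc.continuousOn.div Real.continuous_sqrt.continuousOn fun x hx => ?_
    exact (Real.sqrt_pos.2 (by linarith [(hsub x hx).1])).ne'
  obtain ⟨xm, hxm, hmax⟩ := isCompact_Icc.exists_isMaxOn (nonempty_Icc.2 hx0.2) φc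
  have hmax : ∀ x ∈ Icc x0 L, u x / √x ≤ u xm / √xm := fun x hx => hmax hx
  set m := u xm / √xm with hm
  have φ0 : ∀ x ∈ Icc x0 L, 0 ≤ u x / √x := fun x hx => div_nonneg (S.u0 (hsub x hx)) (Real.sqrt_nonneg _)
  have hmm : 0 ≤ m := φ0 xm hxm
  suffices h : m ^ 2 ≤ D.m0 ^ 2 * ((1 + D.σ) / D.σ) * (e1 + (u x0 / √x0) ^ 2) / (D.Kst - Qs) by
    intro x hx
    exact (pow_le_pow_left₀ (φ0 x hx) (hmax x hx) 2).trans h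
  rcases hmm.eq_or_lt with h0 | hmp
  · have hz : m ^ 2 = 0 := by rw [← h0]; norm_num
    rw [hz]
    have : 0 ≤ D.m0 ^ 2 * ((1 + D.σ) / D.σ) * (e1 + (u x0 / √x0) ^ 2) := by positivity
    exact div_nonneg this hK.le
  have c1 := calib_step D u y S.yc S.du x0 xm m 1 hx0.1 hxm.1 hmp (by norm_num)
    (fun x hx => S.u0 (hsub x ⟨hx.1, hx.2.trans hxm.2⟩)) (fun x hx => hmax x ⟨hx.1, hx.2.trans hxm.2⟩)
  have c2 := calib_step D u y S.yc S.du xm L m (-1) (hsub xm hxm).1 hxm.2 hmp (by norm_num)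
    (fun x hx => S.u0 (hsub x ⟨hxm.1.trans hx.1, hx.2⟩)) (fun x hx => hmax x ⟨hxm.1.trans hx.1, hx.2⟩)
  have ia : Continuous fun x => y x ^ 2 := S.yc.pow 2
  have ib : Continuous fun x => m ^ (-(2 * D.σ)) / (4 * D.c) * (D.w x * (max (u x) 0) ^ (2 * D.σ + 2)) := continuous_const.mul S.wu_cont
  have ic : Continuous fun x => y x ^ 2 - m ^ (-(2 * D.σ)) / (4 * D.c) * (D.w x * (max (u x) 0) ^ (2 * D.σ + 2)) := ia.sub ib
  have h3 := intervalIntegral.integral_add_adjacent_intervals (ic.intervalIntegrable (μ := volume) x0 xm) (ic.intervalIntegrable xm L)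
  rw [intervalIntegral.integral_sub (ia.intervalIntegrable x0 L) (ib.intervalIntegrable x0 L), intervalIntegral.integral_const_mul, S.int_y x0] at h3
  set Q0 := ∫ x in x0..L, D.w x * (max (u x) 0) ^ (2 * D.σ + 2) with hQ0
  have hQ00 : 0 ≤ Q0 := by
    refine intervalIntegral.integral_nonneg hx0.2 fun x _ => ?_
    have := (D.w_pos x).le
    positivity
  have s1 := cS_le D.σ m (u x0 / √x0) hσ (φ0 x0 ⟨le_rfl, hx0.2⟩) hmp
  have s2 := cS_le D.σ m (u L / √L) hσ (φ0 L ⟨hx0.2, le_rfl⟩) hmp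
  have s3 := mul_nonneg (S.u0 hx0) (S.y0 hx0)
  rw [← hm] at c1 c2
  have main : 4 * cS D.σ m m - (u x0 / √x0) ^ 2 ≤ Q0 + e1 - m ^ (-(2 * D.σ)) / (4 * D.c) * Q0 := by linarith
  rw [cS_scale _ _ hσ hmp] at main
  set s := m / D.m0 with hs
  have hs0 : 0 < s := by positivity
  have hms : m = s * D.m0 := by rw [hs]; field_simp
  have k1 : 4 * (m ^ 2 * cS D.σ 1 1) = s ^ 2 * D.Kst * (D.σ / (1 + D.σ)) := by
    unfold Kst
    rw [cS_scale _ _ hσ hm0, hms]; field_simp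
  have k2 : m ^ (-(2 * D.σ)) / (4 * D.c) = s ^ (-(2 * D.σ)) / (1 + D.σ) := by
    rw [hms, Real.mul_rpow hs0.le hm0.le, Real.rpow_neg hm0.le (2 * D.σ), D.m0_pow]
    field_simp
  rw [k1, k2] at main
  have k3 := s_bern D.σ s hσ hs0
  have k4 : (1 - D.σ * (s ^ 2 - 1)) / (1 + D.σ) * Q0 ≤ s ^ (-(2 * D.σ)) / (1 + D.σ) * Q0 := by gcongr
  have k5 : Q0 - (1 - D.σ * (s ^ 2 - 1)) / (1 + D.σ) * Q0 = D.σ / (1 + D.σ) * s ^ 2 * Q0 := by field_simp; ring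
  have k6 : D.σ / (1 + D.σ) * s ^ 2 * Q0 ≤ D.σ / (1 + D.σ) * s ^ 2 * Qs := by gcongr
  have k7 : D.σ / (1 + D.σ) * s ^ 2 * (D.Kst - Qs) ≤ e1 + (u x0 / √x0) ^ 2 := by linarith
  rw [le_div_iff₀ hK]
  have k8 : m ^ 2 * (D.Kst - Qs) = D.m0 ^ 2 * ((1 + D.σ) / D.σ) * (D.σ / (1 + D.σ) * s ^ 2 * (D.Kst - Qs)) := by
    rw [hms]; field_simp
  rw [k8]
  gcongr

end Dat

namespace Dat

theorem int_rpow_le (σ a b : ℝ) (hσ : 0 < σ) (ha : 0 < a) (hab : a ≤ b) :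
    ∫ x in a..b, x ^ (-(σ + 1)) ≤ a ^ (-σ) / σ := by
  rw [integral_rpow (Or.inr ⟨by linarith, fun h => ?_⟩)]
  · rw [show -(σ + 1) + 1 = -σ by ring, div_neg, ← neg_div]
    have : 0 ≤ b ^ (-σ) := Real.rpow_nonneg (by linarith) _
    gcongr; linarith
  · rw [uIcc_of_le hab] at h; linarith [h.1]

theorem wu_eq (D : Dat) {x η : ℝ} (hx : 1 ≤ x) (hη : 0 ≤ η) :
    D.w x * (η * √x) ^ (2 * D.σ + 2) = D.c * η ^ (2 * D.σ + 2) * x⁻¹ := by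
  have hx0 : 0 < x := by linarith
  rw [D.w_eq hx, Real.mul_rpow hη (Real.sqrt_nonneg _), show 2 * D.σ + 2 = 2 * (D.σ + 1) by ring, sqrt_rpow hx0,
      Real.rpow_add_one hx0.ne', show -(D.σ + 2) = -D.σ - 2 by ring,
      Real.rpow_sub hx0, Real.rpow_neg hx0.le, Real.rpow_two]
  field_simp

theorem small_inf (D : Dat) (cs : ℝ) (hcs0 : 0 < cs) (hcs : cs < D.nu * D.Kst) (μ : ℝ) (hμ : 0 < μ) :
    ∃ X2 ≥ 1, ∀ L ≥ X2, ∀ u y g, D.Sol L u y g →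
      1/2*(∫ s in (1:ℝ)..L, u s*g s) - ∫ s in (1:ℝ)..L, D.H s (u s) ≤ cs →
      ∀ x ∈ Icc X2 L, u x ≤ μ * √x := by
  have hσ := D.hσ
  have hc := D.c_pos
  have hnu := D.nu_pos
  have hm0 := D.m0_pos
  set Qs := cs / D.nu with hQs
  have hQs0 : 0 < Qs := by positivity
  have hQK : Qs < D.Kst := by rw [hQs, div_lt_iff₀ hnu]; linarith
  have hK : 0 < D.Kst - Qs := by linarith
  have hmin : 2 < min D.θ (2 * D.σ + 2) := lt_min D.hθ (by linarith)
  have hd : 0 < 1 / 2 - 1 / min D.θ (2 * D.σ + 2) := by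
    have := one_div_lt_one_div_of_lt (by norm_num : (0:ℝ) < 2) hmin
    linarith
  set X := cs / (1 / 2 - 1 / min D.θ (2 * D.σ + 2)) with hX
  have hX0 : 0 < X := by positivity
  set T := D.m0 ^ 2 * ((1 + D.σ) / D.σ) / (D.Kst - Qs) with hT
  have hT0 : 0 < T := by positivity
  set e1 := μ ^ 2 / (2 * T) with he1
  have he10 : 0 < e1 := by positivity
  have hη : 0 < √e1 := Real.sqrt_pos.2 he10
  set ε := e1 / (2 * (Qs + 1)) with hε
  have hε0 : 0 < ε := by positivity
  obtain ⟨C, hC, hsub⟩ := D.sub_bound X hX0 ε hε0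
  have hεQ : ε * Qs ≤ e1 / 2 := by
    rw [hε, div_mul_eq_mul_div, div_le_div_iff₀ (by positivity) (by positivity)]
    nlinarith
  obtain ⟨X1, hX1, hX11⟩ : ∃ X1 : ℝ, C * D.c * X * (X1 ^ (-D.σ) / D.σ) ≤ e1 / 2 ∧ 1 ≤ X1 := by
    have h1 : Tendsto (fun x : ℝ => C * D.c * X * (x ^ (-D.σ) / D.σ)) atTop (nhds (C * D.c * X * (0 / D.σ))) :=
      ((tendsto_rpow_neg_atTop hσ).div_const _).const_mul _
    rw [zero_div, mul_zero] at h1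
    have h2 := (h1.eventually (Iic_mem_nhds (show 0 < e1 / 2 by positivity))).and (eventually_ge_atTop 1)
    exact h2.exists
  set A := D.c * (√e1) ^ (2 * D.σ + 2) with hA
  have hA0 : 0 < A := by positivity
  set X2 := X1 * Real.exp ((Qs + 1) / A) with hX2
  have hX10 : 0 < X1 := by linarith
  have hX12 : X1 ≤ X2 := by
    have : 1 ≤ Real.exp ((Qs + 1) / A) := Real.one_le_exp (by positivity)
    nlinarith
  refine ⟨X2, by linarith, ?_⟩
  intro L hL u y g S hJ x hx
  have hL1 : 1 ≤ L := by linarith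
  have iw := S.wu_cont
  have hJ1 := S.J_ge hL1
  have hQ1 : ∫ x in (1:ℝ)..L, D.w x * (max (u x) 0) ^ (2 * D.σ + 2) ≤ Qs := by
    rw [hQs, le_div_iff₀ hnu]; linarith
  have w0 : ∀ x, 0 ≤ D.w x * (max (u x) 0) ^ (2 * D.σ + 2) := fun x =>
    mul_nonneg (D.w_pos x).le (Real.rpow_nonneg (le_max_right _ _) _)
  have hE : ∫ s in (1:ℝ)..L, u s*g s ≤ X := by
    rw [hX, le_div_iff₀ hd]; linarith [S.E_le hL1]
  have husq : ∀ x ∈ Icc 1 L, u x ^ 2 ≤ X * x := fun x hx =>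
    (S.u_sq hL1 hx).trans (mul_le_mul_of_nonneg_right hE (by linarith [hx.1]))
  -- pigeonhole
  obtain ⟨x0, hx0, hux0⟩ : ∃ x0 ∈ Icc X1 X2, u x0 ≤ √e1 * √x0 := by
    by_contra! hcon
    have h1 : ∫ x in X1..X2, A * x⁻¹ ≤ ∫ x in X1..X2, D.w x * (max (u x) 0) ^ (2 * D.σ + 2) := by
      refine intervalIntegral.integral_mono_on hX12 (ContinuousOn.intervalIntegrable_of_Icc hX12 ?_) (iw.intervalIntegrable _ _) fun x hx => ?_
      · exact continuousOn_const.mul (continuousOn_id.inv₀ fun x hx => by have := hx.1; simp only [id]; linarith)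
      · have hx1 : 1 ≤ x := hX11.trans hx.1
        rw [hA, ← D.wu_eq hx1 hη.le]
        have := (D.w_pos x).le
        have h2 := (hcon x hx).le.trans (le_max_left (u x) 0)
        gcongr
    have h2 : ∫ x in X1..X2, D.w x * (max (u x) 0) ^ (2 * D.σ + 2) ≤ ∫ x in (1:ℝ)..L, D.w x * (max (u x) 0) ^ (2 * D.σ + 2) :=
      intervalIntegral.integral_mono_interval hX11 hX12 hL (Eventually.of_forall w0) (iw.intervalIntegrable _ _)
    rw [intervalIntegral.integral_const_mul, integral_inv_of_pos hX10 (by linarith), hX2, mul_div_cancel_left₀ _ hX10.ne', Real.log_exp,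
      mul_div_cancel₀ _ hA0.ne'] at h1
    linarith
  have hx01 : 1 ≤ x0 := hX11.trans hx0.1
  have hx0L : x0 ≤ L := hx0.2.trans hL
  have hx0p : 0 < x0 := by linarith
  have hQ : ∫ x in x0..L, D.w x * (max (u x) 0) ^ (2 * D.σ + 2) ≤ Qs :=
    (intervalIntegral.integral_mono_interval hx01 hx0L le_rfl (Eventually.of_forall w0) (iw.intervalIntegrable _ _)).trans hQ1
  have ir : IntervalIntegrable (fun x : ℝ => C * D.c * X * x ^ (-(D.σ + 1))) volume x0 L := by
    refine ContinuousOn.intervalIntegrable_of_Icc hx0L (continuousOn_const.mul (ContinuousOn.rpow_const continuousOn_id fun x hx => Or.inl ?_))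
    exact (lt_of_lt_of_le hx0p hx.1).ne'
  have iε : Continuous fun x => (1 + ε) * (D.w x * (max (u x) 0) ^ (2 * D.σ + 2)) := continuous_const.mul iw
  have hEE : ∫ x in x0..L, u x * g x ≤ (∫ x in x0..L, D.w x * (max (u x) 0) ^ (2 * D.σ + 2)) + e1 := by
    have h1 : ∫ x in x0..L, u x * g x ≤ ∫ x in x0..L, ((1 + ε) * (D.w x * (max (u x) 0) ^ (2 * D.σ + 2)) + C * D.c * X * x ^ (-(D.σ + 1))) := by
      refine intervalIntegral.integral_mono_on hx0L ((S.uc.mul S.gc).intervalIntegrable _ _) ((iε.intervalIntegrable _ _).add ir) fun x hx => ?_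
      have hx' : x ∈ Icc 1 L := ⟨hx01.trans hx.1, hx.2⟩
      have hxp : 0 < x := by linarith [hx'.1]
      have hu := S.u0 hx'
      rw [S.gh' hx', max_eq_left hu]
      have e : u x * u x ^ (2 * D.σ + 1) = u x ^ (2 * D.σ + 2) := by
        have := Real.rpow_add_one' hu (show (2 * D.σ + 1) + 1 ≠ 0 by linarith)
        rw [show 2 * D.σ + 2 = (2 * D.σ + 1) + 1 by ring, this, mul_comm]
      have h2 := hsub x (u x) hx'.1 hu (husq x hx')
      have h3 : D.w x * x = D.c * x ^ (-(D.σ + 1)) := by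
        rw [D.w_eq hx'.1, mul_assoc, ← Real.rpow_add_one hxp.ne']; congr 2; ring
      have h4 := mul_le_mul_of_nonneg_left h2 (mul_nonneg (D.w_pos x).le hu)
      have h5 := mul_le_mul_of_nonneg_left (husq x hx') (mul_nonneg (D.w_pos x).le hC.le)
      linear_combination h4 + h5 + (1 + ε) * D.w x * e + C * X * h3
    rw [intervalIntegral.integral_add (iε.intervalIntegrable _ _) ir, intervalIntegral.integral_const_mul, intervalIntegral.integral_const_mul] at h1
    have h2 := int_rpow_le D.σ x0 L hσ hx0p hx0L
    have h3 : x0 ^ (-D.σ) ≤ X1 ^ (-D.σ) := Real.rpow_le_rpow_of_nonpos hX10 hx0.1 (by linarith)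
    have h4 : C * D.c * X * ∫ x in x0..L, x ^ (-(D.σ + 1)) ≤ e1 / 2 := by
      refine le_trans ?_ hX1
      refine mul_le_mul_of_nonneg_left (h2.trans ?_) (by positivity)
      gcongr
    have h5 := mul_le_mul_of_nonneg_left hQ hε0.le
    linarith
  have hfin := calib D S x0 ⟨hx01, hx0L⟩ Qs e1 hQK hQ hEE he10.le x ⟨hx0.2.trans hx.1, hx.2⟩
  have hs0 : 0 < √x0 := Real.sqrt_pos.2 hx0p
  have hxp : 0 < x := by linarith [hx.1]
  have hsx : 0 < √x := Real.sqrt_pos.2 hxp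
  have h6 : (u x0 / √x0) ^ 2 ≤ e1 := by
    rw [← Real.sq_sqrt he10.le]
    refine pow_le_pow_left₀ (div_nonneg (S.u0 ⟨hx01, hx0L⟩) hs0.le) ?_ 2
    rwa [div_le_iff₀ hs0]
  have h7 : (u x / √x) ^ 2 ≤ μ ^ 2 := by
    refine hfin.trans ?_
    rw [mul_div_right_comm, ← hT]
    have : T * (e1 + (u x0 / √x0) ^ 2) ≤ T * (2 * e1) := by
      apply mul_le_mul_of_nonneg_left _ hT0.le; linarith
    refine this.trans (le_of_eq ?_)
    rw [he1]; field_simp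
  rw [← div_le_iff₀ hsx]; exact le_of_abs_le (abs_le_of_sq_le_sq h7 hμ.le)

end Dat

namespace Dat

theorem compar (D : Dat) {L : ℝ} {u y g : ℝ → ℝ} (S : D.Sol L u y g) (G : ℝ) (hG : 0 ≤ G)
    (hg : ∀ x ∈ Icc 1 L, g x ≤ G * D.w x) : ∀ x ∈ Icc 1 L, u L - G * (D.c / (D.σ * (D.σ + 1))) * x ^ (-D.σ) ≤ u x := by
  have hσ := D.hσ
  have hc := D.c_pos
  set C3 := G * D.c / (D.σ + 1) with hC3
  have hC30 : 0 ≤ C3 := by positivity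
  have dψ : ∀ x : ℝ, 0 < x → HasDerivAt (fun x => y x - C3 * x ^ (-(D.σ + 1))) (-g x + G * D.c * x ^ (-(D.σ + 2))) x := by
    intro x hx
    have h1 := (Real.hasDerivAt_rpow_const (x := x) (p := -(D.σ + 1)) (Or.inl hx.ne')).const_mul C3
    refine ((S.dy x).sub h1).congr_deriv ?_
    rw [show -(D.σ + 1) - 1 = -(D.σ + 2) by ring, hC3]
    field_simp; ring
  have dχ : ∀ x : ℝ, 0 < x → HasDerivAt (fun x => u x + C3 / D.σ * x ^ (-D.σ)) (y x - C3 * x ^ (-(D.σ + 1))) x := by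
    intro x hx
    have h1 := (Real.hasDerivAt_rpow_const (x := x) (p := -D.σ) (Or.inl hx.ne')).const_mul (C3 / D.σ)
    refine ((S.du x).add h1).congr_deriv ?_
    rw [show -D.σ - 1 = -(D.σ + 1) by ring]
    field_simp; ring
  have pos : ∀ x ∈ Icc 1 L, 0 < x := fun x hx => by linarith [hx.1]
  have m1 : MonotoneOn (fun x => y x - C3 * x ^ (-(D.σ + 1))) (Icc 1 L) := by
    refine monotoneOn_of_deriv_nonneg (convex_Icc _ _) (fun x hx => (dψ x (pos x hx)).continuousAt.continuousWithinAt)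
      (fun x hx => (dψ x (pos x (interior_subset hx))).differentiableAt.differentiableWithinAt) ?_
    intro x hx
    have hx := interior_subset hx
    rw [(dψ x (pos x hx)).deriv]
    have := hg x hx
    rw [D.w_eq hx.1] at this
    linarith
  have m2 : AntitoneOn (fun x => u x + C3 / D.σ * x ^ (-D.σ)) (Icc 1 L) := by
    refine antitoneOn_of_deriv_nonpos (convex_Icc _ _) (fun x hx => (dχ x (pos x hx)).continuousAt.continuousWithinAt)
      (fun x hx => (dχ x (pos x (interior_subset hx))).differentiableAt.differentiableWithinAt) ?_
    intro x hx
    have hx := interior_subset hx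
    rw [(dχ x (pos x hx)).deriv]
    have hL : L ∈ Icc 1 L := ⟨hx.1.trans hx.2, le_rfl⟩
    have := m1 hx hL hx.2
    simp only [S.yL] at this
    have : 0 ≤ C3 * L ^ (-(D.σ + 1)) := mul_nonneg hC30 (Real.rpow_nonneg (pos L hL).le _)
    linarith
  intro x hx
  have hL : L ∈ Icc 1 L := ⟨hx.1.trans hx.2, le_rfl⟩
  have h := m2 hx hL hx.2
  simp only at h
  have h0 : 0 ≤ C3 / D.σ * L ^ (-D.σ) := mul_nonneg (by positivity) (Real.rpow_nonneg (pos L hL).le _)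
  have e : C3 / D.σ = G * (D.c / (D.σ * (D.σ + 1))) := by rw [hC3]; field_simp
  rw [← e]; linarith

theorem sup_bound (D : Dat) (cs : ℝ) (hcs0 : 0 < cs) (hcs : cs < D.nu * D.Kst) :
    ∃ A0 : ℝ, ∃ L1 ≥ 1, ∀ L ≥ L1, ∀ u y g, D.Sol L u y g →
      1/2*(∫ s in (1:ℝ)..L, u s*g s) - ∫ s in (1:ℝ)..L, D.H s (u s) ≤ cs → u L ≤ A0 := by
  have hσ := D.hσ
  have hc := D.c_pos
  have hmin : 2 < min D.θ (2 * D.σ + 2) := lt_min D.hθ (by linarith)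
  have hd : 0 < 1 / 2 - 1 / min D.θ (2 * D.σ + 2) := by
    have := one_div_lt_one_div_of_lt (by norm_num : (0:ℝ) < 2) hmin
    linarith
  set X := cs / (1 / 2 - 1 / min D.θ (2 * D.σ + 2)) with hX
  have hX0 : 0 < X := by positivity
  obtain ⟨C, hC, hsub⟩ := D.sub_bound X hX0 1 one_pos
  set K := (2 + C) * (D.c / (D.σ * (D.σ + 1))) with hK
  obtain ⟨A, hA, hA1⟩ : ∃ A : ℝ, K * A ^ (-D.σ) ≤ 1 / 2 ∧ 1 ≤ A := by
    have h1 : Tendsto (fun x : ℝ => K * x ^ (-D.σ)) atTop (nhds (K * 0)) :=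
      (tendsto_rpow_neg_atTop hσ).const_mul _
    rw [mul_zero] at h1
    exact ((h1.eventually (Iic_mem_nhds (show (0:ℝ) < 1 / 2 by norm_num))).and (eventually_ge_atTop 1)).exists
  have hA0 : 0 < A := by linarith
  have hsA : 0 < √A := Real.sqrt_pos.2 hA0
  obtain ⟨X2, hX2, hsm⟩ := D.small_inf cs hcs0 hcs (1 / (4 * √A)) (by positivity)
  refine ⟨max 1 (√X2), X2, hX2, ?_⟩
  intro L hL u y g S hJ
  by_contra! hcon
  have hL1 : 1 ≤ L := le_trans hX2 hL
  have hLm : L ∈ Icc 1 L := ⟨hL1, le_rfl⟩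
  set a := u L with ha
  have ha1 : 1 < a := (le_max_left _ _).trans_lt hcon
  have ha2 : √X2 < a := (le_max_right _ _).trans_lt hcon
  have hE : ∫ s in (1:ℝ)..L, u s*g s ≤ X := by
    rw [hX, le_div_iff₀ hd]; linarith [S.E_le hL1]
  have husq : ∀ x ∈ Icc 1 L, u x ^ 2 ≤ X * x := fun x hx =>
    (S.u_sq hL1 hx).trans (mul_le_mul_of_nonneg_right hE (by linarith [hx.1]))
  have hg : ∀ x ∈ Icc 1 L, g x ≤ (2 + C) * a ^ (2 * D.σ + 1) * D.w x := by
    intro x hx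
    have hu := S.u0 hx
    rw [S.gh' hx]
    have h1 := hsub x (u x) hx.1 hu (husq x hx)
    have h2 : u x ^ (2 * D.σ + 1) ≤ a ^ (2 * D.σ + 1) := Real.rpow_le_rpow hu (S.uL hx) (by linarith)
    have h3 : u x ≤ a ^ (2 * D.σ + 1) := (S.uL hx).trans (by
      conv_lhs => rw [← ha, ← Real.rpow_one a]
      exact Real.rpow_le_rpow_of_exponent_le ha1.le (by linarith))
    have h4 : u x ^ (2 * D.σ + 1) + D.κ x * D.f (u x) ≤ (2 + C) * a ^ (2 * D.σ + 1) := by nlinarith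
    have := mul_le_mul_of_nonneg_left h4 (D.w_pos x).le
    linarith
  have hxX : X2 < A * a ^ 2 := by
    have : X2 < a ^ 2 := by
      rw [← Real.sq_sqrt (show 0 ≤ X2 by linarith)]
      exact pow_lt_pow_left₀ ha2 (Real.sqrt_nonneg _) (by norm_num)
    nlinarith
  have hsq : √(A * a ^ 2) = √A * a := by
    rw [Real.sqrt_mul hA0.le, Real.sqrt_sq (by linarith)]
  have hq : 1 / (4 * √A) * √(A * a ^ 2) = a / 4 := by rw [hsq]; field_simp
  rcases le_total (A * a ^ 2) L with h | h
  · have h1 := hsm L hL u y g S hJ _ ⟨hxX.le, h⟩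
    have h2 := D.compar S _ (by positivity) hg (A * a ^ 2) ⟨by linarith, h⟩
    rw [hq] at h1
    have h3 : (A * a ^ 2) ^ (-D.σ) = A ^ (-D.σ) * (a ^ (2 * D.σ))⁻¹ := by
      rw [Real.mul_rpow hA0.le (by positivity), ← Real.rpow_natCast, ← Real.rpow_mul (by linarith), ← Real.rpow_neg (by linarith)]
      congr 2; push_cast; ring
    have h4 : (2 + C) * a ^ (2 * D.σ + 1) * (D.c / (D.σ * (D.σ + 1))) * (A * a ^ 2) ^ (-D.σ) = K * A ^ (-D.σ) * a := by
      rw [h3, Real.rpow_add_one (by linarith), hK]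
      have : 0 < a ^ (2 * D.σ) := by positivity
      field_simp
    rw [h4] at h2
    nlinarith
  · have h1 := hsm L hL u y g S hJ L ⟨hL, le_rfl⟩
    have h2 : 1 / (4 * √A) * √L ≤ 1 / (4 * √A) * √(A * a ^ 2) :=
      mul_le_mul_of_nonneg_left (Real.sqrt_le_sqrt h) (by positivity)
    rw [hq] at h2
    linarith

theorem low_bound (D : Dat) : ∃ a0 > 0, ∀ L ≥ 1, ∀ u y g, D.Sol L u y g →
      0 < 1/2*(∫ s in (1:ℝ)..L, u s*g s) - ∫ s in (1:ℝ)..L, D.H s (u s) → a0 ≤ u L := by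
  have hσ := D.hσ
  have hc := D.c_pos
  have hCκ := D.hCκ
  set K := D.c / (D.σ * (D.σ + 1)) with hK
  have hK0 : 0 < K := by positivity
  set ε := 1 / (2 * (1 + D.Cκ) * K) with hε
  have hε0 : 0 < ε := by positivity
  obtain ⟨δ, hδ, hf⟩ := D.f_F_small ε hε0
  refine ⟨δ, hδ, fun L hL u y g S hJ => ?_⟩
  by_contra! hcon
  have h1m : (1:ℝ) ∈ Icc 1 L := ⟨le_rfl, hL⟩
  have hLm : L ∈ Icc 1 L := ⟨hL, le_rfl⟩
  have ha := S.u0 hLm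
  have hg : ∀ x ∈ Icc 1 L, g x ≤ ε * (1 + D.Cκ) * u L * D.w x := by
    intro x hx
    have hu := S.u0 hx
    have huL := S.uL hx
    rw [S.gh' hx]
    obtain ⟨h1, h2, -⟩ := hf (u x) hu (by linarith)
    rw [Real.rpow_add_one' hu (by linarith)]
    have h3 : u x ^ (2 * D.σ) * u x ≤ ε * u L := mul_le_mul h1 huL hu hε0.le
    have h4 : D.κ x * D.f (u x) ≤ D.Cκ * (ε * u L) :=
      mul_le_mul (D.κ_le hx.1) (h2.trans (by gcongr)) (D.f0 _) hCκ.le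
    have := mul_le_mul_of_nonneg_left (add_le_add h3 h4) (D.w_pos x).le
    linarith
  have h := D.compar S _ (by positivity) hg 1 h1m
  rw [S.u1, Real.one_rpow, ← hK, mul_one] at h
  have e : ε * (1 + D.Cκ) * u L * K = u L / 2 := by rw [hε]; field_simp
  rw [e] at h
  have hz : ∀ x ∈ Icc 1 L, u x = 0 := fun x hx => le_antisymm ((S.uL hx).trans (by linarith)) (S.u0 hx)
  have i1 : ∫ s in (1:ℝ)..L, u s*g s = 0 := by
    have : ∫ s in (1:ℝ)..L, u s*g s = ∫ s in (1:ℝ)..L, 0 := by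
      refine intervalIntegral.integral_congr fun s hs => ?_
      rw [uIcc_of_le hL] at hs
      simp [hz s hs]
    rw [this]; simp
  have i2 : 0 ≤ ∫ s in (1:ℝ)..L, D.H s (u s) := by
    refine intervalIntegral.integral_nonneg hL fun s _ => ?_
    have := (D.w_pos s).le
    have := D.κ0 s
    have := D.F_nonneg2 (u s)
    have := Real.rpow_nonneg (le_max_right (u s) 0) (2 * D.σ + 2)
    unfold H
    positivity
  rw [i1] at hJ
  linarith

theorem apriori (D : Dat) : ∃ a0 > 0, ∃ A0 : ℝ, ∃ L1 ≥ 1, ∀ L ≥ L1, ∃ u y g, D.Sol L u y g ∧ a0 ≤ u L ∧ u L ≤ A0 := by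
  obtain ⟨cs, hcs, L0, hL0, hs⟩ := D.mp_sol
  have hcs0 : 0 < cs := by
    obtain ⟨u, y, g, -, h1, h2⟩ := hs L0 le_rfl
    linarith
  obtain ⟨a0, ha0, hl⟩ := D.low_bound
  obtain ⟨A0, L1, hL1, hu⟩ := D.sup_bound cs hcs0 hcs
  refine ⟨a0, ha0, A0, max L0 L1, le_max_of_le_right hL1, fun L hL => ?_⟩
  obtain ⟨u, y, g, S, h1, h2⟩ := hs L ((le_max_left _ _).trans hL)
  have hLL := (le_max_right _ _).trans hL
  exact ⟨u, y, g, S, hl L (hL1.trans hLL) u y g S h1, hu L hLL u y g S h2⟩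

end Dat

theorem aa_lem (V : ℕ → ℝ → ℝ) (K A : ℝ) (hK : 0 ≤ K) (hV : ∀ n x y, |V n x - V n y| ≤ K * |x - y|)
    (hA : ∀ n x, V n x ∈ Icc 0 A) :
    ∃ φ : ℕ → ℕ, StrictMono φ ∧ ∃ U : ℝ → ℝ, ∀ x, Tendsto (fun n => V (φ n) x) atTop (nhds (U x)) := by
  have hc : IsCompact (Set.pi univ fun _ : ℚ => Icc (0:ℝ) A) := isCompact_univ_pi fun _ => isCompact_Icc
  obtain ⟨a, -, φ, hφ, ha⟩ := hc.tendsto_subseq (x := fun n => fun q : ℚ => V n q) fun n q _ => hA n q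
  refine ⟨φ, hφ, ?_⟩
  rw [tendsto_pi_nhds] at ha
  have : ∀ x, ∃ l, Tendsto (fun n => V (φ n) x) atTop (nhds l) := by
    intro x
    refine cauchySeq_tendsto_of_complete ?_
    rw [Metric.cauchySeq_iff]
    intro ε hε
    have hd : 0 < ε / (3 * (K + 1)) := by positivity
    obtain ⟨q, hq1, hq2⟩ := exists_rat_btwn (show x < x + ε / (3 * (K + 1)) by linarith)
    have hqx : K * |x - q| ≤ ε / 3 := by
      have : |x - q| ≤ ε / (3 * (K + 1)) := by rw [abs_le]; constructor <;> linarith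
      calc K * |x - q| ≤ (K + 1) * (ε / (3 * (K + 1))) := by gcongr; linarith
        _ = ε / 3 := by field_simp
    obtain ⟨M, hM⟩ := Metric.cauchySeq_iff.1 (ha q).cauchySeq (ε / 3) (by positivity)
    refine ⟨M, fun m hm n hn => ?_⟩
    have h1 := hM m hm n hn
    have h2 := hV (φ m) x q
    have h3 := hV (φ n) x q
    simp only [Function.comp, Real.dist_eq] at h1 ⊢
    rw [abs_le] at h2 h3
    rw [abs_lt] at h1 ⊢
    constructor <;> linarith
  choose U hU using this
  exact ⟨U, hU⟩

namespace Dat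

theorem y_bd (D : Dat) {L : ℝ} {u y g : ℝ → ℝ} (S : D.Sol L u y g) (G : ℝ) (hG : 0 ≤ G)
    (hg : ∀ x ∈ Icc 1 L, g x ≤ G * D.w x) : ∀ x ∈ Icc 1 L, y x ≤ G * D.c / (D.σ + 1) * x ^ (-(D.σ + 1)) := by
  have hσ := D.hσ
  have hc := D.c_pos
  set C3 := G * D.c / (D.σ + 1) with hC3
  have hC30 : 0 ≤ C3 := by positivity
  have dψ : ∀ x : ℝ, 0 < x → HasDerivAt (fun x => y x - C3 * x ^ (-(D.σ + 1))) (-g x + G * D.c * x ^ (-(D.σ + 2))) x := by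
    intro x hx
    have h1 := (Real.hasDerivAt_rpow_const (x := x) (p := -(D.σ + 1)) (Or.inl hx.ne')).const_mul C3
    refine ((S.dy x).sub h1).congr_deriv ?_
    rw [show -(D.σ + 1) - 1 = -(D.σ + 2) by ring, hC3]
    field_simp; ring
  have pos : ∀ x ∈ Icc 1 L, 0 < x := fun x hx => by linarith [hx.1]
  have m1 : MonotoneOn (fun x => y x - C3 * x ^ (-(D.σ + 1))) (Icc 1 L) := by
    refine monotoneOn_of_deriv_nonneg (convex_Icc _ _) (fun x hx => (dψ x (pos x hx)).continuousAt.continuousWithinAt)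
      (fun x hx => (dψ x (pos x (interior_subset hx))).differentiableAt.differentiableWithinAt) ?_
    intro x hx
    have hx := interior_subset hx
    rw [(dψ x (pos x hx)).deriv]
    have := hg x hx
    rw [D.w_eq hx.1] at this
    linarith
  intro x hx
  have hL : L ∈ Icc 1 L := ⟨hx.1.trans hx.2, le_rfl⟩
  have h := m1 hx hL hx.2
  simp only [S.yL] at h
  have : 0 ≤ C3 * L ^ (-(D.σ + 1)) := mul_nonneg hC30 (Real.rpow_nonneg (pos L hL).le _)
  linarith

theorem h_bd (D : Dat) (A : ℝ) : ∃ G ≥ 0, ∀ x t, 1 ≤ x → t ∈ Icc 0 A → D.h x t ≤ G * D.w x := by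
  have hσ := D.hσ
  have hCκ := D.hCκ
  obtain ⟨M, hM⟩ := (isCompact_Icc (a := (0:ℝ)) (b := A)).bddAbove_image D.fc.continuousOn
  refine ⟨(max A 0) ^ (2 * D.σ + 1) + D.Cκ * max M 0, ?_, fun x t hx ht => ?_⟩
  · have := Real.rpow_nonneg (le_max_right A 0) (2 * D.σ + 1)
    have := le_max_right M 0
    positivity
  have h1 : D.f t ≤ max M 0 := (hM ⟨t, ht, rfl⟩).trans (le_max_left _ _)
  have h2 : D.κ x * D.f t ≤ D.Cκ * max M 0 := mul_le_mul (D.κ_le hx) h1 (D.f0 _) hCκ.le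
  have h3 : (max t 0) ^ (2 * D.σ + 1) ≤ (max A 0) ^ (2 * D.σ + 1) :=
    Real.rpow_le_rpow (le_max_right _ _) (max_le_max ht.2 le_rfl) (by linarith)
  unfold h
  have := mul_le_mul_of_nonneg_left (add_le_add h3 h2) (D.w_pos x).le
  linarith

structure LSol (D : Dat) (u y g : ℝ → ℝ) (K : ℝ) : Prop where
  du : ∀ x, HasDerivAt u (y x) x
  dy : ∀ x, HasDerivAt y (-g x) x
  gc : Continuous g
  gh : ∀ x, 1 ≤ x → g x = D.h x (u x)
  u1 : u 1 = 0
  u0 : ∀ x, 1 ≤ x → 0 ≤ u x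
  y0 : ∀ x, 1 ≤ x → 0 ≤ y x
  yK : ∀ x, 1 ≤ x → y x ≤ K * x ^ (-(D.σ + 1))
  ne : ∃ x, 1 ≤ x ∧ 0 < u x

theorem limit_sol (D : Dat) : ∃ u y g K, D.LSol u y g K := by
  have hσ := D.hσ
  have hc := D.c_pos
  obtain ⟨a0, ha0, A0, L1, hL1, hap⟩ := D.apriori
  have hLn : ∀ n : ℕ, L1 + n ≥ L1 := fun n => by have := Nat.cast_nonneg (α := ℝ) n; linarith
  choose u y g S hlo hup using fun n : ℕ => hap (L1 + n) (hLn n)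
  obtain ⟨G, hG, hhG⟩ := D.h_bd A0
  set C3 := G * D.c / (D.σ + 1) with hC3
  have hC30 : 0 ≤ C3 := by positivity
  have hL1n : ∀ n : ℕ, 1 ≤ L1 + n := fun n => hL1.trans (hLn n)
  have huA : ∀ n : ℕ, ∀ x ∈ Icc 1 (L1 + n), u n x ∈ Icc 0 A0 := fun n x hx => ⟨(S n).u0 hx, ((S n).uL hx).trans (hup n)⟩
  have hgG : ∀ n : ℕ, ∀ x ∈ Icc 1 (L1 + n), g n x ≤ G * D.w x := fun n x hx => by
    rw [(S n).gh x hx]; exact hhG x _ hx.1 (huA n x hx)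
  have hyb : ∀ n : ℕ, ∀ x ∈ Icc 1 (L1 + n), y n x ≤ C3 * x ^ (-(D.σ + 1)) := fun n => D.y_bd (S n) G hG (hgG n)
  have hyb1 : ∀ n : ℕ, ∀ x ∈ Icc 1 (L1 + n), y n x ≤ C3 := fun n x hx => by
    refine (hyb n x hx).trans ?_
    have := Real.rpow_le_one_of_one_le_of_nonpos hx.1 (show -(D.σ + 1) ≤ 0 by linarith)
    nlinarith
  set cl : ℕ → ℝ → ℝ := fun n x => max (min x (L1 + n)) 1 with hcl
  have hclm : ∀ (n : ℕ) x, cl n x ∈ Icc 1 (L1 + n) := fun n x => ⟨le_max_right _ _, max_le (min_le_right _ _) (hL1n n)⟩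
  have hcle : ∀ n : ℕ, ∀ x ∈ Icc 1 (L1 + n), cl n x = x := fun n x hx => by
    simp only [hcl]; rw [min_eq_left hx.2, max_eq_left hx.1]
  have hlip : ∀ n a b, |u n (cl n a) - u n (cl n b)| ≤ C3 * |a - b| := fun n a b => by
    have h1 := (convex_Icc 1 (L1 + n)).norm_image_sub_le_of_norm_hasDerivWithin_le (f := u n) (f' := y n) (C := C3)
      (fun x _ => ((S n).du x).hasDerivWithinAt) (fun x hx => by
        rw [Real.norm_eq_abs, abs_of_nonneg ((S n).y0 hx)]; exact hyb1 n x hx) (hclm n b) (hclm n a)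
    refine h1.trans (mul_le_mul_of_nonneg_left ?_ hC30)
    rw [Real.norm_eq_abs]
    calc |cl n a - cl n b| ≤ |min a (L1 + n) - min b (L1 + n)| := abs_max_sub_max_le_abs _ _ _
      _ ≤ |a - b| := abs_inf_sub_inf_le_abs _ _ _
  obtain ⟨φ, hφ, U, hU⟩ := aa_lem (fun n x => u n (cl n x)) C3 A0 hC30 hlip (fun n x => huA n _ (hclm n x))
  obtain ⟨Y1, hY1, ψ, hψ, hY⟩ := (isCompact_Icc (a := (0:ℝ)) (b := C3)).tendsto_subseq (x := fun n => y (φ n) 1)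
    fun n => ⟨(S _).y0 ⟨le_rfl, hL1n _⟩, hyb1 _ 1 ⟨le_rfl, hL1n _⟩⟩
  set χ : ℕ → ℕ := fun n => φ (ψ n) with hχ
  have hχm : StrictMono χ := hφ.comp hψ
  have hUχ : ∀ x, Tendsto (fun n => u (χ n) (cl (χ n) x)) atTop (nhds (U x)) := fun x => (hU x).comp hψ.tendsto_atTop
  have hYχ : Tendsto (fun n => y (χ n) 1) atTop (nhds Y1) := hY
  have hev : ∀ x : ℝ, ∀ᶠ n in atTop, x ≤ L1 + (χ n : ℕ) := fun x => by
    have h1 : Tendsto (fun n => ((χ n : ℕ) : ℝ)) atTop atTop := tendsto_natCast_atTop_atTop.comp hχm.tendsto_atTop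
    filter_upwards [h1.eventually_ge_atTop (x - L1)] with n hn
    linarith
  have hUx : ∀ x, 1 ≤ x → Tendsto (fun n => u (χ n) x) atTop (nhds (U x)) := fun x hx => by
    refine (hUχ x).congr' ?_
    filter_upwards [hev x] with n hn
    rw [hcle _ x ⟨hx, hn⟩]
  have hUc : Continuous U := by
    have : LipschitzWith (Real.toNNReal C3) U := by
      refine LipschitzWith.of_dist_le_mul fun a b => ?_
      rw [Real.coe_toNNReal _ hC30, Real.dist_eq, Real.dist_eq]
      refine le_of_tendsto ((hUχ a).sub (hUχ b)).abs (Eventually.of_forall fun n => hlip _ a b)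
    exact this.continuous
  set gg : ℝ → ℝ := fun x => D.h x (U x) with hgg
  have ggc : Continuous gg := D.h_cont.comp (continuous_id.prodMk hUc)
  set yy : ℝ → ℝ := fun x => Y1 - ∫ t in (1:ℝ)..x, gg t with hyy
  have yyd : ∀ x, HasDerivAt yy (-gg x) x := fun x => by
    have := (ggc.integral_hasStrictDerivAt 1 x).hasDerivAt.const_sub Y1
    exact this
  have yyc : Continuous yy := continuous_iff_continuousAt.2 fun x => (yyd x).continuousAt
  have hyx : ∀ x, 1 ≤ x → Tendsto (fun n => y (χ n) x) atTop (nhds (yy x)) := fun x hx => by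
    have h1 : Tendsto (fun n => ∫ t in (1:ℝ)..x, g (χ n) t) atTop (nhds (∫ t in (1:ℝ)..x, gg t)) := by
      refine intervalIntegral.tendsto_integral_filter_of_dominated_convergence (fun _ => G * D.c)
        (Eventually.of_forall fun n => (S _).gc.aestronglyMeasurable) ?_ (by simp) ?_
      · filter_upwards [hev x] with n hn
        refine Eventually.of_forall fun t ht => ?_
        rw [uIoc_of_le hx] at ht
        have htm : t ∈ Icc 1 (L1 + (χ n : ℕ)) := ⟨ht.1.le, ht.2.trans hn⟩
        rw [Real.norm_eq_abs, abs_of_nonneg ((S _).g0 htm)]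
        exact (hgG _ t htm).trans (mul_le_mul_of_nonneg_left (D.w_le t) hG)
      · refine Eventually.of_forall fun t ht => ?_
        rw [uIoc_of_le hx] at ht
        have hc2 : Continuous fun v => D.h t v := D.h_cont.comp (continuous_const.prodMk continuous_id)
        refine ((hc2.tendsto _).comp (hUx t ht.1.le)).congr' ?_
        filter_upwards [hev t] with n hn
        exact ((S _).gh t ⟨ht.1.le, hn⟩).symm
    refine (hYχ.sub h1).congr fun n => ?_
    have := intervalIntegral.integral_eq_sub_of_hasDerivAt (a := 1) (b := x) (fun t _ => (S (χ n)).dy t) ((S (χ n)).gc.neg.intervalIntegrable _ _)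
    rw [intervalIntegral.integral_neg] at this
    linarith
  set uu : ℝ → ℝ := fun x => ∫ t in (1:ℝ)..x, yy t with huu
  have hux : ∀ x, 1 ≤ x → uu x = U x := fun x hx => by
    have h1 : Tendsto (fun n => ∫ t in (1:ℝ)..x, y (χ n) t) atTop (nhds (∫ t in (1:ℝ)..x, yy t)) := by
      refine intervalIntegral.tendsto_integral_filter_of_dominated_convergence (fun _ => C3)
        (Eventually.of_forall fun n => (S _).yc.aestronglyMeasurable) ?_ (by simp) ?_
      · filter_upwards [hev x] with n hn
        refine Eventually.of_forall fun t ht => ?_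
        rw [uIoc_of_le hx] at ht
        have htm : t ∈ Icc 1 (L1 + (χ n : ℕ)) := ⟨ht.1.le, ht.2.trans hn⟩
        rw [Real.norm_eq_abs, abs_of_nonneg ((S _).y0 htm)]
        exact hyb1 _ t htm
      · refine Eventually.of_forall fun t ht => ?_
        rw [uIoc_of_le hx] at ht
        exact hyx t ht.1.le
    refine tendsto_nhds_unique h1 ((hUx x hx).congr fun n => ?_)
    rw [intervalIntegral.integral_eq_sub_of_hasDerivAt (fun t _ => (S (χ n)).du t) ((S (χ n)).yc.intervalIntegrable _ _), (S _).u1, sub_zero]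
  refine ⟨uu, yy, gg, C3, ⟨fun x => (yyc.integral_hasStrictDerivAt 1 x).hasDerivAt, yyd, ggc, fun x hx => by rw [hux x hx], by simp [huu],
    fun x hx => ?_, fun x hx => ?_, fun x hx => ?_, ?_⟩⟩
  · rw [hux x hx]
    exact ge_of_tendsto' (hUχ x) fun n => (huA _ _ (hclm _ x)).1
  · refine ge_of_tendsto (hyx x hx) ?_
    filter_upwards [hev x] with n hn
    exact (S _).y0 ⟨hx, hn⟩
  · refine le_of_tendsto (hyx x hx) ?_
    filter_upwards [hev x] with n hn
    exact hyb _ x ⟨hx, hn⟩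
  · obtain ⟨x, hx, hx1⟩ : ∃ x : ℝ, G * (D.c / (D.σ * (D.σ + 1))) * x ^ (-D.σ) ≤ a0 / 2 ∧ 1 ≤ x := by
      have h1 : Tendsto (fun x : ℝ => G * (D.c / (D.σ * (D.σ + 1))) * x ^ (-D.σ)) atTop (nhds (G * (D.c / (D.σ * (D.σ + 1))) * 0)) :=
        (tendsto_rpow_neg_atTop hσ).const_mul _
      rw [mul_zero] at h1
      exact ((h1.eventually (Iic_mem_nhds (show 0 < a0 / 2 by positivity))).and (eventually_ge_atTop 1)).exists
    refine ⟨x, hx1, ?_⟩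
    rw [hux x hx1]
    have : a0 / 2 ≤ U x := by
      refine ge_of_tendsto (hUx x hx1) ?_
      filter_upwards [hev x] with n hn
      have := D.compar (S _) G hG (hgG _) x ⟨hx1, hn⟩
      linarith [hlo (χ n)]
    linarith

end Dat

namespace RadPDE
variable (N : ℕ) (G : ℝ → ℝ)

noncomputable def P (r : ℝ) : ℝ := ∫ s in (0:ℝ)..1, s ^ (N - 1) * G (r * s)

theorem P_cont (hG : Continuous G) : Continuous (P N G) := by
  unfold P
  refine intervalIntegral.continuous_parametric_intervalIntegral_of_continuous' ?_ 0 1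
  unfold Function.uncurry
  fun_prop

theorem P_zero (hN : 1 ≤ N) : N * P N G 0 = G 0 := by
  unfold P
  simp only [zero_mul]
  rw [intervalIntegral.integral_mul_const, integral_pow]
  have : ((N - 1 : ℕ) : ℝ) + 1 = N := by rw [Nat.cast_sub hN]; push_cast; ring
  rw [this]
  have : (N:ℝ) ≠ 0 := by positivity
  have h2 : N - 1 + 1 ≠ 0 := by omega
  simp; field_simp

theorem P_eq (hN : 1 ≤ N) (r : ℝ) : r ^ N * P N G r = ∫ t in (0:ℝ)..r, t ^ (N - 1) * G t := by
  have h := intervalIntegral.mul_integral_comp_mul_left (a := 0) (b := 1) (f := fun t => t ^ (N - 1) * G t) r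
  rw [mul_zero, mul_one] at h
  rw [← h, P, ← intervalIntegral.integral_const_mul, ← intervalIntegral.integral_const_mul]
  refine intervalIntegral.integral_congr fun s _ => ?_
  obtain ⟨m, rfl⟩ : ∃ m, N = m + 1 := ⟨N - 1, by omega⟩
  simp only [Nat.add_sub_cancel]
  ring

theorem P_deriv (hN : 1 ≤ N) (hG : Continuous G) {r : ℝ} (hr : 0 < r) :
    HasDerivAt (P N G) ((G r - N * P N G r) / r) r := by
  have hc : Continuous fun t => t ^ (N - 1) * G t := by fun_prop
  have h1 := (hc.integral_hasStrictDerivAt 0 r).hasDerivAt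
  have h2 := h1.div (hasDerivAt_pow N r) (by positivity)
  have h3 : P N G =ᶠ[nhds r] fun r => (∫ t in (0:ℝ)..r, t ^ (N - 1) * G t) / r ^ N := by
    filter_upwards [lt_mem_nhds hr] with s hs
    rw [← P_eq N G hN, mul_div_cancel_left₀ _ (by positivity)]
  refine (h2.congr_of_eventuallyEq h3).congr_deriv ?_
  rw [← P_eq N G hN]
  obtain ⟨m, rfl⟩ : ∃ m, N = m + 1 := ⟨N - 1, by omega⟩
  simp only [Nat.add_sub_cancel]
  field_simp
  ring

noncomputable def W (x : EuclideanSpace ℝ (Fin N)) : EuclideanSpace ℝ (Fin N) := P N G ‖x‖ • x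

noncomputable def A (x : EuclideanSpace ℝ (Fin N)) : EuclideanSpace ℝ (Fin N) →L[ℝ] EuclideanSpace ℝ (Fin N) :=
  P N G ‖x‖ • ContinuousLinearMap.id ℝ _ + ((G ‖x‖ - N * P N G ‖x‖) / ‖x‖ ^ 2) • (innerSL ℝ x).smulRight x

theorem W_deriv (hN : 1 ≤ N) (hG : Continuous G) (x : EuclideanSpace ℝ (Fin N)) : HasFDerivAt (W N G) (A N G x) x := by
  rcases eq_or_ne x 0 with rfl | hx
  · have : A N G 0 = P N G 0 • ContinuousLinearMap.id ℝ _ := by ext; simp [A]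
    rw [this, hasFDerivAt_iff_isLittleO_nhds_zero]
    have h1 : Tendsto (fun x : EuclideanSpace ℝ (Fin N) => P N G ‖x‖ - P N G 0) (nhds 0) (nhds 0) := by
      have : Continuous fun x : EuclideanSpace ℝ (Fin N) => P N G ‖x‖ - P N G 0 := ((P_cont N G hG).comp continuous_norm).sub continuous_const
      simpa using this.tendsto 0
    have h2 := ((Asymptotics.isLittleO_one_iff ℝ).2 h1).smul_isBigO (Asymptotics.isBigO_refl (fun x : EuclideanSpace ℝ (Fin N) => x) (nhds 0))
    simp only [one_smul] at h2
    refine h2.congr_left fun x => ?_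
    simp [W, sub_smul]
  · have hn : 0 < ‖x‖ := norm_pos_iff.2 hx
    have h1 : HasFDerivAt (fun x : EuclideanSpace ℝ (Fin N) => ‖x‖) (‖x‖⁻¹ • innerSL ℝ x) x := by
      have h2 : HasFDerivAt (fun x : EuclideanSpace ℝ (Fin N) => ‖x‖ ^ 2) (2 • innerSL ℝ x) x := (hasStrictFDerivAt_norm_sq x).hasFDerivAt
      have h3 := h2.sqrt (by positivity)
      simp only [Real.sqrt_sq (norm_nonneg _)] at h3
      refine h3.congr_fderiv ?_
      ext z
      simp
      field_simp
    have h2 := (P_deriv N G hN hG hn).comp_hasFDerivAt x h1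
    have h3 := h2.smul (hasFDerivAt_id x)
    refine h3.congr_fderiv ?_
    ext z
    simp [A]
    field_simp

theorem A_cont (hN : 1 ≤ N) (hG : Continuous G) : Continuous (A N G) := by
  have hP := P_cont N G hG
  have hPn : Continuous fun x : EuclideanSpace ℝ (Fin N) => P N G ‖x‖ := hP.comp continuous_norm
  have hGn : Continuous fun x : EuclideanSpace ℝ (Fin N) => G ‖x‖ := hG.comp continuous_norm
  unfold A
  refine (hPn.smul continuous_const).add ?_
  have hT : Continuous fun x : EuclideanSpace ℝ (Fin N) => (innerSL ℝ x).smulRight x := by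
    have : Continuous fun x : EuclideanSpace ℝ (Fin N) => ContinuousLinearMap.smulRightL ℝ _ _ (innerSL ℝ x) x := by fun_prop
    exact this
  rw [continuous_iff_continuousAt]
  intro x
  rcases eq_or_ne x 0 with rfl | hx
  · have h0 : ((G ‖(0 : EuclideanSpace ℝ (Fin N))‖ - N * P N G ‖(0 : EuclideanSpace ℝ (Fin N))‖) / ‖(0 : EuclideanSpace ℝ (Fin N))‖ ^ 2) • (innerSL ℝ (0 : EuclideanSpace ℝ (Fin N))).smulRight (0 : EuclideanSpace ℝ (Fin N)) = 0 := by
      simp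
    rw [ContinuousAt, h0]
    have h1 : Tendsto (fun x : EuclideanSpace ℝ (Fin N) => |G ‖x‖ - N * P N G ‖x‖|) (nhds 0) (nhds 0) := by
      have : Continuous fun x : EuclideanSpace ℝ (Fin N) => |G ‖x‖ - N * P N G ‖x‖| := (hGn.sub (continuous_const.mul hPn)).abs
      simpa [P_zero N G hN] using this.tendsto 0
    refine squeeze_zero_norm (fun x => ?_) h1
    rw [norm_smul, ContinuousLinearMap.norm_smulRight_apply, innerSL_apply_norm, Real.norm_eq_abs, abs_div, abs_of_nonneg (sq_nonneg ‖x‖)]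
    rcases eq_or_ne x 0 with rfl | hx
    · simp
    · have hn : 0 < ‖x‖ := norm_pos_iff.2 hx
      rw [← sq, div_mul_cancel₀ _ (by positivity)]
  · have hn : ‖x‖ ^ 2 ≠ 0 := by have := norm_pos_iff.2 hx; positivity
    have hn2 : Continuous fun x : EuclideanSpace ℝ (Fin N) => ‖x‖ ^ 2 := by fun_prop
    have h1 : ContinuousAt (fun x : EuclideanSpace ℝ (Fin N) => (G ‖x‖ - N * P N G ‖x‖) / ‖x‖ ^ 2) x :=
      ContinuousAt.div (hGn.sub (continuous_const.mul hPn)).continuousAt hn2.continuousAt hn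
    exact h1.smul hT.continuousAt

noncomputable def v (U0 : ℝ) (x : EuclideanSpace ℝ (Fin N)) : ℝ := U0 - 1 / 2 * ∫ s in (0:ℝ)..‖x‖ ^ 2, P N G (√s)

theorem v_deriv (hG : Continuous G) (U0 : ℝ) (x : EuclideanSpace ℝ (Fin N)) : HasFDerivAt (v N G U0) (-(innerSL ℝ (W N G x))) x := by
  have hP : Continuous fun s => P N G (√s) := (P_cont N G hG).comp Real.continuous_sqrt
  have h1 := (hP.integral_hasStrictDerivAt 0 (‖x‖ ^ 2)).hasDerivAt
  have h2 : HasFDerivAt (fun x : EuclideanSpace ℝ (Fin N) => ‖x‖ ^ 2) (2 • innerSL ℝ x) x := (hasStrictFDerivAt_norm_sq x).hasFDerivAt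
  have h3 := ((h1.comp_hasFDerivAt x h2).const_mul (1 / 2 : ℝ)).const_sub U0
  refine h3.congr_fderiv ?_
  ext z
  simp [W, inner_smul_left]
  ring

theorem v_contDiff (hN : 1 ≤ N) (hG : Continuous G) (U0 : ℝ) : ContDiff ℝ 2 (v N G U0) := by
  have hW : ContDiff ℝ 1 (W N G) := by
    rw [contDiff_one_iff_fderiv]
    refine ⟨fun x => (W_deriv N G hN hG x).differentiableAt, ?_⟩
    rw [show fderiv ℝ (W N G) = A N G from funext fun x => (W_deriv N G hN hG x).fderiv]
    exact A_cont N G hN hG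
  rw [show (2 : WithTop ℕ∞) = 1 + 1 by norm_num, contDiff_succ_iff_fderiv]
  refine ⟨fun x => (v_deriv N G hG U0 x).differentiableAt, by simp, ?_⟩
  rw [show fderiv ℝ (v N G U0) = fun x => -(innerSL ℝ (W N G x)) from funext fun x => (v_deriv N G hG U0 x).fderiv]
  exact ((innerSL ℝ).contDiff.comp hW).neg

theorem v_lap (hN : 1 ≤ N) (hG : Continuous G) (U0 : ℝ) (x : EuclideanSpace ℝ (Fin N)) : laplacian (v N G U0) x = -G ‖x‖ := by
  unfold laplacian
  have h : ∀ i : Fin N, fderiv ℝ (fun y => fderiv ℝ (v N G U0) y (EuclideanSpace.single i (1:ℝ))) x (EuclideanSpace.single i (1:ℝ)) =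
      -(P N G ‖x‖ + ((G ‖x‖ - N * P N G ‖x‖) / ‖x‖ ^ 2) * x i ^ 2) := by
    intro i
    have e1 : (fun y => fderiv ℝ (v N G U0) y (EuclideanSpace.single i (1:ℝ))) = fun y => -(innerSL ℝ (EuclideanSpace.single i (1:ℝ)) (W N G y)) := by
      ext y
      rw [(v_deriv N G hG U0 y).fderiv]
      simp [real_inner_comm]
    rw [e1]
    have h2 := ((innerSL ℝ (EuclideanSpace.single i (1:ℝ))).hasFDerivAt.comp x (W_deriv N G hN hG x)).neg
    have h3 := h2.fderiv
    simp only [Function.comp_def] at h3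
    erw [h3]
    have i1 : inner ℝ x (EuclideanSpace.single i (1:ℝ)) = x i := by rw [EuclideanSpace.inner_single_right]; simp
    have i2 : inner ℝ (EuclideanSpace.single i (1:ℝ)) x = x i := by rw [EuclideanSpace.inner_single_left]; simp
    simp [A, inner_add_right, inner_smul_right, i1, i2]
    left; ring
  rw [Finset.sum_congr rfl fun i _ => h i, Finset.sum_neg_distrib, Finset.sum_add_distrib, ← Finset.mul_sum]
  have h4 : ∑ i, x i ^ 2 = ‖x‖ ^ 2 := by rw [EuclideanSpace.norm_sq_eq]; simp
  rw [h4]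
  simp only [Finset.sum_const, Finset.card_univ, Fintype.card_fin, nsmul_eq_mul]
  rcases eq_or_ne x 0 with rfl | hx
  · simp [P_zero N G hN]
  · have hn : 0 < ‖x‖ := norm_pos_iff.2 hx
    field_simp; ring

end RadPDE

namespace Dat
namespace LSol
variable {D : Dat} {u y g : ℝ → ℝ} {K : ℝ}

theorem uc (S : D.LSol u y g K) : Continuous u := continuous_iff_continuousAt.2 fun x => (S.du x).continuousAt
theorem yc (S : D.LSol u y g K) : Continuous y := continuous_iff_continuousAt.2 fun x => (S.dy x).continuousAt

theorem u_mono (S : D.LSol u y g K) : MonotoneOn u (Ici 1) := by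
  refine monotoneOn_of_deriv_nonneg (convex_Ici _) S.uc.continuousOn (fun x _ => (S.du x).differentiableAt.differentiableWithinAt) ?_
  intro x hx
  rw [(S.du x).deriv]
  exact S.y0 x (interior_subset hx)

theorem y_anti (S : D.LSol u y g K) : AntitoneOn y (Ici 1) := by
  refine antitoneOn_of_deriv_nonpos (convex_Ici _) S.yc.continuousOn (fun x _ => (S.dy x).differentiableAt.differentiableWithinAt) ?_
  intro x hx
  have hx := interior_subset hx
  rw [(S.dy x).deriv, S.gh x hx]
  linarith [D.h_nonneg x (u x)]

theorem u_pos (S : D.LSol u y g K) {x : ℝ} (hx : 1 < x) : 0 < u x := by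
  by_contra! hcon
  obtain ⟨z, hz, huz⟩ := S.ne
  have hux : u x = 0 := le_antisymm hcon (S.u0 x hx.le)
  have hxz : x ≤ z := by
    by_contra! h
    have := S.u_mono hz hx.le h.le
    linarith
  obtain ⟨a, ha, hea⟩ := exists_hasDerivAt_eq_slope u y hx S.uc.continuousOn (fun t _ => S.du t)
  rw [hux, S.u1, sub_zero, zero_div] at hea
  have h0 : ∀ t, a ≤ t → y t = 0 := fun t ht => le_antisymm (hea ▸ S.y_anti ha.1.le (ha.1.le.trans ht) ht) (S.y0 t (ha.1.le.trans ht))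
  rcases hxz.eq_or_lt with rfl | hlt
  · linarith
  obtain ⟨b, hb, heb⟩ := exists_hasDerivAt_eq_slope u y hlt S.uc.continuousOn (fun t _ => S.du t)
  rw [h0 b (ha.2.trans hb.1).le, hux, sub_zero, eq_comm, div_eq_zero_iff] at heb
  rcases heb with h | h <;> linarith

theorem u_lim (S : D.LSol u y g K) : ∃ l, Tendsto u atTop (nhds l) := by
  have hσ := D.hσ
  have hm : Monotone fun x => u (max x 1) := fun a b hab =>
    S.u_mono (mem_Ici.2 (le_max_right a 1)) (mem_Ici.2 (le_max_right b 1)) (max_le_max hab le_rfl)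
  have hK : 0 ≤ K := by
    have := (S.y0 1 le_rfl).trans (S.yK 1 le_rfl)
    simpa using this
  have dχ : ∀ x : ℝ, 0 < x → HasDerivAt (fun x => u x + K / D.σ * x ^ (-D.σ)) (y x - K * x ^ (-(D.σ + 1))) x := by
    intro x hx
    have h1 := (Real.hasDerivAt_rpow_const (x := x) (p := -D.σ) (Or.inl hx.ne')).const_mul (K / D.σ)
    refine ((S.du x).add h1).congr_deriv ?_
    rw [show -D.σ - 1 = -(D.σ + 1) by ring]
    field_simp; ring
  have pos : ∀ x ∈ Ici (1:ℝ), 0 < x := fun x hx => lt_of_lt_of_le one_pos hx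
  have m2 : AntitoneOn (fun x => u x + K / D.σ * x ^ (-D.σ)) (Ici 1) := by
    refine antitoneOn_of_deriv_nonpos (convex_Ici _) (fun x hx => (dχ x (pos x hx)).continuousAt.continuousWithinAt)
      (fun x hx => (dχ x (pos x (interior_subset hx))).differentiableAt.differentiableWithinAt) ?_
    intro x hx
    have hx := interior_subset hx
    rw [(dχ x (pos x hx)).deriv]
    linarith [S.yK x hx]
  have hb : ∀ x, u (max x 1) ≤ K / D.σ := fun x => by
    have h := m2 (le_refl (1:ℝ)) (le_max_right x 1) (le_max_right x 1)
    simp only [S.u1, Real.one_rpow] at h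
    have : 0 ≤ K / D.σ * (max x 1) ^ (-D.σ) := mul_nonneg (by positivity) (Real.rpow_nonneg (le_max_of_le_right zero_le_one) _)
    linarith
  rcases tendsto_of_monotone hm with h | ⟨l, h⟩
  · obtain ⟨x, hx⟩ := (h.eventually_gt_atTop (K / D.σ)).exists
    linarith [hb x]
  · refine ⟨l, h.congr' ?_⟩
    filter_upwards [eventually_ge_atTop 1] with x hx
    rw [max_eq_left hx]

theorem y_lim (S : D.LSol u y g K) : Tendsto y atTop (nhds 0) := by
  have hσ := D.hσ
  have h1 : Tendsto (fun x : ℝ => K * x ^ (-(D.σ + 1))) atTop (nhds (K * 0)) :=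
    (tendsto_rpow_neg_atTop (by linarith)).const_mul _
  rw [mul_zero] at h1
  refine tendsto_of_tendsto_of_tendsto_of_le_of_le' tendsto_const_nhds h1 ?_ ?_
  · filter_upwards [eventually_ge_atTop 1] with x hx using S.y0 x hx
  · filter_upwards [eventually_ge_atTop 1] with x hx using S.yK x hx

end LSol

theorem X_tendsto (m : ℕ) : Tendsto (fun r : ℝ => (r ^ (m + 1))⁻¹) (nhdsWithin 0 (Ioi 0)) atTop := by
  refine tendsto_inv_nhdsGT_zero.comp ?_
  rw [tendsto_nhdsWithin_iff]
  constructor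
  · have : Continuous fun r : ℝ => r ^ (m + 1) := by fun_prop
    have := this.tendsto 0
    simp only [ne_eq, Nat.add_eq_zero_iff, one_ne_zero, and_false, not_false_eq_true, zero_pow] at this
    exact this.mono_left nhdsWithin_le_nhds
  · filter_upwards [self_mem_nhdsWithin] with r hr
    have : (0:ℝ) < r := hr
    exact pow_pos this _

theorem final (D : Dat) (m : ℕ) (hσm : D.σ = 2 / ((m:ℝ) + 1)) (kr : ℝ → ℝ) (hkc : Continuous kr)
    (hkr : ∀ r, 0 < r → r ≤ 1 → D.κ (r ^ (m + 1))⁻¹ = kr r) :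
    ∃ v : EuclideanSpace ℝ (Fin (m + 3)) → ℝ, (∀ x y, ‖x‖ = ‖y‖ → v x = v y) ∧ ContDiff ℝ 2 v ∧
      (∀ x, ‖x‖ < 1 → 0 < v x) ∧ (∀ x, ‖x‖ = 1 → v x = 0) ∧
      ∀ x, ‖x‖ < 1 → -laplacian v x = v x ^ (2 * D.σ + 1) + kr ‖x‖ * D.f (v x) := by
  have hσ := D.hσ
  have hm1 : (0:ℝ) < m + 1 := by positivity
  obtain ⟨u, y, g, K, S⟩ := D.limit_sol
  obtain ⟨l, hl⟩ := S.u_lim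
  have hX1 : ∀ r : ℝ, 0 < r → r ≤ 1 → 1 ≤ (r ^ (m + 1))⁻¹ := fun r h0 h1 => (one_le_inv₀ (by positivity)).2 (pow_le_one₀ h0.le h1)
  have hl0 : 0 < l := by
    have h2 := S.u_pos one_lt_two
    refine lt_of_lt_of_le h2 (ge_of_tendsto hl ?_)
    filter_upwards [eventually_ge_atTop 2] with x hx
    exact S.u_mono (show (1:ℝ) ≤ 2 by norm_num) (show (1:ℝ) ≤ x by linarith) hx
  set U : ℝ → ℝ := fun r => if r ≤ 0 then l else u (max 1 (r ^ (m + 1))⁻¹) with hU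
  have hU0 : U 0 = l := by simp [hU]
  have hUr : ∀ r, 0 < r → r ≤ 1 → U r = u (r ^ (m + 1))⁻¹ := fun r h0 h1 => by
    simp only [hU]; rw [if_neg (by linarith), max_eq_right (hX1 r h0 h1)]
  have hUc : Continuous U := by
    rw [continuous_iff_continuousAt]
    intro r
    rcases lt_trichotomy r 0 with hr | rfl | hr
    · refine (continuousAt_const (y := l)).congr ?_
      filter_upwards [gt_mem_nhds hr] with s hs
      simp only [hU]; rw [if_pos hs.le]
    · rw [continuousAt_iff_continuous_left'_right']
      constructor
      · rw [ContinuousWithinAt, hU0]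
        refine (tendsto_const_nhds (x := l)).congr' ?_
        filter_upwards [self_mem_nhdsWithin] with s hs
        have hs : s < 0 := hs
        simp only [hU]; rw [if_pos hs.le]
      · rw [ContinuousWithinAt, hU0]
        refine (hl.comp (X_tendsto m)).congr' ?_
        filter_upwards [Ioc_mem_nhdsGT (zero_lt_one (α := ℝ))] with s hs
        exact (hUr s hs.1 hs.2).symm
    · have h1 : ContinuousAt (fun r : ℝ => u (max 1 (r ^ (m + 1))⁻¹)) r := by
        refine S.uc.continuousAt.comp (continuousAt_const.max (ContinuousAt.inv₀ (by fun_prop) (by positivity)))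
      refine h1.congr ?_
      filter_upwards [lt_mem_nhds hr] with s hs
      simp only [hU]; rw [if_neg (by linarith)]
  set G : ℝ → ℝ := fun r => (max (U r) 0) ^ (2 * D.σ + 1) + kr r * D.f (U r) with hG
  have hGc : Continuous G := ((pw_cont _ (by linarith)).comp hUc).add (hkc.mul (D.fc.comp hUc))
  have dX : ∀ r : ℝ, 0 < r → HasDerivAt (fun r : ℝ => (r ^ (m + 1))⁻¹) (-((m + 1) * (r ^ (m + 2))⁻¹)) r := fun r hr => by
    have := (hasDerivAt_pow (m + 1) r).inv (by positivity)
    refine this.congr_deriv ?_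
    simp only [Nat.add_sub_cancel]
    push_cast
    field_simp
    ring
  have hgX : ∀ r, 0 < r → r ≤ 1 → (m + 1) ^ 2 * g (r ^ (m + 1))⁻¹ = r ^ (2 * m + 4) * G r := fun r h0 h1 => by
    rw [S.gh _ (hX1 r h0 h1), Dat.h, D.w_eq (hX1 r h0 h1), hkr r h0 h1]
    simp only [hG, hUr r h0 h1]
    have e1 : ((r ^ (m + 1))⁻¹) ^ (-(D.σ + 2)) = r ^ (2 * m + 4) := by
      rw [Real.rpow_neg (by positivity), Real.inv_rpow (by positivity), inv_inv, ← Real.rpow_natCast, ← Real.rpow_mul h0.le, ← Real.rpow_natCast, hσm]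
      congr 1
      push_cast
      field_simp; ring
    have e2 : (m + 1 : ℝ) ^ 2 * D.c = 1 := by
      rw [Dat.c, hσm]; field_simp; norm_num
    rw [e1]
    linear_combination r ^ (2 * m + 4) * (max (u (r ^ (m + 1))⁻¹) 0 ^ (2 * D.σ + 1) + kr r * D.f (u (r ^ (m + 1))⁻¹)) * e2
  have dY : ∀ r, 0 < r → r ≤ 1 → HasDerivAt (fun r => (m + 1) * y (r ^ (m + 1))⁻¹) (r ^ (m + 2) * G r) r := fun r h0 h1 => by
    have := ((S.dy (r ^ (m + 1))⁻¹).comp r (dX r h0)).const_mul ((m:ℝ) + 1)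
    refine this.congr_deriv ?_
    have h2 := hgX r h0 h1
    have h3 : (m + 1 : ℝ) * (-g (r ^ (m + 1))⁻¹ * -((m + 1) * (r ^ (m + 2))⁻¹)) = ((m + 1) ^ 2 * g (r ^ (m + 1))⁻¹) * (r ^ (m + 2))⁻¹ := by ring
    rw [h3, h2]
    field_simp
    ring
  have hY : ∀ r, 0 < r → r ≤ 1 → (m + 1) * y (r ^ (m + 1))⁻¹ = ∫ t in (0:ℝ)..r, t ^ (m + 2) * G t := fun r h0 h1 => by
    have hi : Continuous fun t => t ^ (m + 2) * G t := by fun_prop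
    have := intervalIntegral.integral_eq_sub_of_hasDerivAt_of_tendsto h0 (fun t ht => dY t ht.1 (ht.2.le.trans h1))
      (hi.intervalIntegrable _ _) (fa := ((m:ℝ) + 1) * 0) (fb := ((m:ℝ) + 1) * y (r ^ (m + 1))⁻¹)
      ((S.y_lim.comp (X_tendsto m)).const_mul _) ((dY r h0 h1).continuousAt.tendsto.mono_left nhdsWithin_le_nhds)
    rw [this]; ring
  have hP : ∀ r, 0 < r → r ≤ 1 → r ^ (m + 3) * RadPDE.P (m + 3) G r = (m + 1) * y (r ^ (m + 1))⁻¹ := fun r h0 h1 => by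
    rw [hY r h0 h1, RadPDE.P_eq (m + 3) G (by omega) r]
    rfl
  have hPc : Continuous fun s => RadPDE.P (m + 3) G (√s) := (RadPDE.P_cont (m + 3) G hGc).comp Real.continuous_sqrt
  set V : ℝ → ℝ := fun r => l - 1 / 2 * ∫ s in (0:ℝ)..r ^ 2, RadPDE.P (m + 3) G (√s) with hV
  have dV : ∀ r, 0 < r → HasDerivAt V (-(r * RadPDE.P (m + 3) G r)) r := fun r h0 => by
    have h1 := (hPc.integral_hasStrictDerivAt 0 (r ^ 2)).hasDerivAt
    have h2 := ((HasDerivAt.comp (h := fun x : ℝ => x ^ 2) r h1 (hasDerivAt_pow 2 r)).const_mul (1 / 2 : ℝ)).const_sub l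
    refine h2.congr_deriv ?_
    rw [Real.sqrt_sq h0.le]
    push_cast
    ring
  have hVc : Continuous V := by
    have h1 : Continuous fun z => ∫ s in (0:ℝ)..z, RadPDE.P (m + 3) G (√s) :=
      continuous_iff_continuousAt.2 fun z => (hPc.integral_hasStrictDerivAt 0 z).hasDerivAt.continuousAt
    exact continuous_const.sub (continuous_const.mul (h1.comp (continuous_pow 2)))
  have hV0 : V 0 = l := by simp [hV]
  have dU : ∀ r, 0 < r → r < 1 → HasDerivAt U (-(r * RadPDE.P (m + 3) G r)) r := fun r h0 h1 => by
    have h2 := (S.du (r ^ (m + 1))⁻¹).comp r (dX r h0)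
    have h3 : U =ᶠ[nhds r] u ∘ fun r : ℝ => (r ^ (m + 1))⁻¹ := by
      filter_upwards [Ioo_mem_nhds h0 h1] with s hs
      exact hUr s hs.1 hs.2.le
    refine (h2.congr_of_eventuallyEq h3).congr_deriv ?_
    have h4 := hP r h0 h1.le
    have h5 : r ^ (m + 3) = r ^ (m + 2) * r := pow_succ _ _
    rw [h5] at h4
    have : 0 < r ^ (m + 2) := by positivity
    rw [show y (r ^ (m + 1))⁻¹ * -(((m:ℝ) + 1) * (r ^ (m + 2))⁻¹) = -((m + 1) * y (r ^ (m + 1))⁻¹) * (r ^ (m + 2))⁻¹ by ring, ← h4]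
    field_simp
  have hUV : ∀ r, 0 ≤ r → r ≤ 1 → U r = V r := fun r h0 h1 => by
    rcases h0.eq_or_lt with rfl | h0
    · rw [hU0, hV0]
    have hdc : Continuous fun r => U r - V r := hUc.sub hVc
    have := intervalIntegral.integral_eq_sub_of_hasDerivAt_of_tendsto (f := fun r => U r - V r) (f' := fun _ => 0) h0
      (fun t ht => ((dU t ht.1 (ht.2.trans_le h1)).sub (dV t ht.1)).congr_deriv (by ring))
      (by simp) (fa := U 0 - V 0) (fb := U r - V r)
      ((hdc.tendsto 0).mono_left nhdsWithin_le_nhds) ((hdc.tendsto r).mono_left nhdsWithin_le_nhds)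
    rw [hU0, hV0] at this
    simp only [intervalIntegral.integral_zero] at this
    linarith
  have hv : ∀ x : EuclideanSpace ℝ (Fin (m + 3)), ‖x‖ ≤ 1 → RadPDE.v (m + 3) G l x = U ‖x‖ := fun x hx => by
    rw [hUV _ (norm_nonneg _) hx]; rfl
  have hUpos : ∀ r, 0 ≤ r → r < 1 → 0 < U r := fun r h0 h1 => by
    rcases h0.eq_or_lt with rfl | h0
    · rw [hU0]; exact hl0
    rw [hUr r h0 h1.le]
    exact S.u_pos ((one_lt_inv₀ (by positivity)).2 (pow_lt_one₀ h0.le h1 (by omega)))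
  refine ⟨RadPDE.v (m + 3) G l, fun x y h => by simp [RadPDE.v, h], RadPDE.v_contDiff _ _ (by omega) hGc _, fun x hx => ?_, fun x hx => ?_, fun x hx => ?_⟩
  · rw [hv x hx.le]; exact hUpos _ (norm_nonneg _) hx
  · rw [hv x hx.le, hx, hUr 1 one_pos le_rfl]; simpa using S.u1
  · rw [RadPDE.v_lap _ _ (by omega) hGc, neg_neg, hv x hx.le]
    simp only [hG]
    rw [max_eq_left (hUpos _ (norm_nonneg _) hx).le]

end Dat

theorem f4_aux (f : ℝ → ℝ) (hc : Continuous f) (f0 : ∀ t, 0 ≤ f t) (p e : ℝ) (hp : 1 ≤ p) (hpe : e ≤ p + 1)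
    (h : Tendsto (fun t => f t / t ^ p) atTop atTop) (M : ℝ) : ∃ T > 0, ∀ t, T ≤ t → M * t ^ e ≤ ∫ s in (0:ℝ)..t, f s := by
  obtain ⟨T0, hT0⟩ := eventually_atTop.1 (h.eventually_ge_atTop (|M| * 2 ^ (p + 1)))
  refine ⟨2 * max T0 1, by positivity, fun t ht => ?_⟩
  have ht1 : 1 ≤ t / 2 := by have := le_max_right T0 1; linarith
  have htT : T0 ≤ t / 2 := by have := le_max_left T0 1; linarith
  have h1 : ∫ s in (t / 2)..t, f s ≤ ∫ s in (0:ℝ)..t, f s :=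
    intervalIntegral.integral_mono_interval (by linarith) (by linarith) le_rfl (Eventually.of_forall f0) (hc.intervalIntegrable _ _)
  have h2 : ∫ s in (t / 2)..t, |M| * 2 ^ (p + 1) * (t / 2) ^ p ≤ ∫ s in (t / 2)..t, f s := by
    refine intervalIntegral.integral_mono_on (by linarith) (by simp) (hc.intervalIntegrable _ _) fun s hs => ?_
    have hs0 : 0 < s := by linarith [hs.1]
    have h3 := hT0 s (htT.trans hs.1)
    rw [le_div_iff₀ (by positivity)] at h3
    refine le_trans ?_ h3
    have : (t / 2) ^ p ≤ s ^ p := Real.rpow_le_rpow (by linarith) hs.1 (by linarith)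
    gcongr
  rw [intervalIntegral.integral_const, smul_eq_mul] at h2
  have h4 : (t - t / 2) * (|M| * 2 ^ (p + 1) * (t / 2) ^ p) = |M| * t ^ (p + 1) := by
    have : t ^ (p + 1) = 2 ^ (p + 1) * ((t / 2) ^ p * (t / 2)) := by
      rw [← Real.rpow_add_one (by linarith), ← Real.mul_rpow (by norm_num) (by linarith)]
      congr 1; ring
    rw [this]; ring
  have h5 : t ^ e ≤ t ^ (p + 1) := Real.rpow_le_rpow_of_exponent_le (by linarith) hpe
  have h6 : M * t ^ e ≤ |M| * t ^ (p + 1) :=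
    mul_le_mul (le_abs_self M) h5 (Real.rpow_nonneg (by linarith) _) (abs_nonneg M)
  linarith

theorem fs_aux (f : ℝ → ℝ) (fz : ∀ t ≤ 0, f t = 0)
    (h : Tendsto (fun t => f t / t) (nhdsWithin 0 (Ioi 0)) (nhds 0)) (ε : ℝ) (hε : 0 < ε) :
    ∃ δ > 0, ∀ t, 0 ≤ t → t ≤ δ → f t ≤ ε * t := by
  have h1 := h.eventually (Iic_mem_nhds hε)
  obtain ⟨δ, hδ, h2⟩ := (mem_nhdsGT_iff_exists_Ioc_subset).1 h1
  refine ⟨δ, hδ, fun t ht htd => ?_⟩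
  rcases ht.eq_or_lt with rfl | ht
  · simp [fz 0 le_rfl]
  · have h3 : f t / t ≤ ε := h2 ⟨ht, htd⟩
    rwa [div_le_iff₀ ht] at h3

theorem fl_aux (f : ℝ → ℝ) (hc : Continuous f) (fz : ∀ t ≤ 0, f t = 0) (q : ℝ)
    (ha : Tendsto (fun t => f t / t) (nhdsWithin 0 (Ioi 0)) (nhds 0))
    (h : Tendsto (fun t => f t / t ^ q) atTop (nhds 0)) (ε : ℝ) (hε : 0 < ε) :
    ∃ C ≥ 0, ∀ t, 0 ≤ t → f t ≤ ε * t ^ q + C * t := by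
  obtain ⟨δ, hδ, h1⟩ := fs_aux f fz ha 1 one_pos
  obtain ⟨T, hT⟩ := eventually_atTop.1 (h.eventually (Iic_mem_nhds hε))
  obtain ⟨M, hM⟩ := (isCompact_Icc (a := (0:ℝ)) (b := T)).bddAbove_image hc.continuousOn
  refine ⟨1 + max M 0 / δ, by positivity, fun t ht => ?_⟩
  have hr : 0 ≤ ε * t ^ q := mul_nonneg hε.le (Real.rpow_nonneg ht _)
  have hm : 0 ≤ max M 0 / δ := by positivity
  rcases le_total t δ with h2 | h2
  · have := h1 t ht h2
    nlinarith
  have ht0 : 0 < t := by linarith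
  rcases le_total t T with h3 | h3
  · have h4 : f t ≤ max M 0 := (hM ⟨t, ⟨ht, h3⟩, rfl⟩).trans (le_max_left _ _)
    have h5 : max M 0 ≤ max M 0 / δ * t := by
      rw [div_mul_eq_mul_div, le_div_iff₀ hδ]
      exact mul_le_mul_of_nonneg_left h2 (le_max_right _ _)
    nlinarith
  · have h4 : f t / t ^ q ≤ ε := hT t h3
    rw [div_le_iff₀ (by positivity)] at h4
    nlinarith

theorem κu_aux (kr : ℝ → ℝ) (hc : Continuous kr) (β C0 δ0 : ℝ) (hβ : 0 < β) (hC0 : 0 < C0) (hδ0 : 0 < δ0)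
    (h : ∀ r, 0 ≤ r → r ≤ 1 → r ≤ δ0 → kr r ≤ C0 * r ^ β) : ∃ C > 0, ∀ r, 0 ≤ r → r ≤ 1 → kr r ≤ C * r ^ β := by
  obtain ⟨M, hM⟩ := (isCompact_Icc (a := (0:ℝ)) (b := 1)).bddAbove_image hc.continuousOn
  refine ⟨C0 + max M 0 / δ0 ^ β, by positivity, fun r h0 h1 => ?_⟩
  have hrb : 0 ≤ r ^ β := Real.rpow_nonneg h0 _
  have hm : 0 ≤ max M 0 / δ0 ^ β := by positivity
  rcases le_total r δ0 with h2 | h2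
  · have := h r h0 h1 h2
    nlinarith
  · have h4 : kr r ≤ max M 0 := (hM ⟨r, ⟨h0, h1⟩, rfl⟩).trans (le_max_left _ _)
    have h5 : max M 0 ≤ max M 0 / δ0 ^ β * r ^ β := by
      rw [div_mul_eq_mul_div, le_div_iff₀ (by positivity)]
      exact mul_le_mul_of_nonneg_left (Real.rpow_le_rpow hδ0.le h2 hβ.le) (le_max_right _ _)
    nlinarith

theorem cont_of_holder (f : ℝ → ℝ) (h : ∀ a b : ℝ, ∃ C α : ℝ≥0, 0 < α ∧ α ≤ 1 ∧ HolderOnWith C α f (Icc a b)) : Continuous f := by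
  rw [continuous_iff_continuousAt]
  intro x
  obtain ⟨C, α, hα, -, hf⟩ := h (x - 1) (x + 1)
  exact (hf.continuousOn hα).continuousAt (Icc_mem_nhds (by linarith) (by linarith))

theorem stmt_0 (N : ℕ) (hN : 3 ≤ N)
    (k : EuclideanSpace ℝ (Fin N) → ℝ) (f : ℝ → ℝ) (β γ : ℝ)
    -- (k1)
    (hk_nonneg : ∀ x, 0 ≤ k x)
    (hk_ne : ∃ x ∈ closedBall (0 : EuclideanSpace ℝ (Fin N)) 1, k x ≠ 0)
    (hk_radial : ∀ x y : EuclideanSpace ℝ (Fin N), ‖x‖ = ‖y‖ → k x = k y)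
    (hk_holder : ∃ C α : ℝ≥0, 0 < α ∧ α ≤ 1 ∧
      HolderOnWith C α k (closedBall (0 : EuclideanSpace ℝ (Fin N)) 1))
    -- (k2)
    (hβ : 0 < β)
    (hk2 : ∃ C₀ δ₀ : ℝ, 0 < C₀ ∧ 0 < δ₀ ∧
      ∀ x : EuclideanSpace ℝ (Fin N), ‖x‖ ≤ δ₀ → k x ≤ C₀ * ‖x‖ ^ β)
    -- (k3)
    (hγβ : β ≤ γ)
    (hk3 : ∃ C δ : ℝ, 0 < C ∧ 0 < δ ∧
      ∀ x : EuclideanSpace ℝ (Fin N), 0 < ‖x‖ → ‖x‖ < δ → C * ‖x‖ ^ γ ≤ k x)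
    -- (f1)
    (hf_holder : ∀ a b : ℝ, ∃ C α : ℝ≥0, 0 < α ∧ α ≤ 1 ∧ HolderOnWith C α f (Icc a b))
    (hf_pos : ∀ t : ℝ, 0 < t → 0 ≤ f t)
    (hf_zero : ∀ t : ℝ, t ≤ 0 → f t = 0)
    -- (f2)
    (hf2a : Tendsto (fun t => f t / t) (nhdsWithin 0 (Ioi 0)) (nhds 0))
    (hf2b : Tendsto (fun t => f t / t ^ (((N : ℝ) + 2 + 2 * β) / ((N : ℝ) - 2)))
      atTop (nhds 0))
    -- (f3)
    (hf3 : ∃ θ : ℝ, 2 < θ ∧ ∀ t : ℝ, 0 ≤ t → θ * (∫ s in (0:ℝ)..t, f s) ≤ t * f t)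
    -- (f4)
    (hf4 : Tendsto (fun t => f t / t ^ (max 1 ((2 * γ + 6 - (N : ℝ)) / ((N : ℝ) - 2))))
      atTop atTop)
    (lam : ℝ) (hlam : 0 < lam) :
    ∃ u : EuclideanSpace ℝ (Fin N) → ℝ,
      (∀ x y : EuclideanSpace ℝ (Fin N), ‖x‖ = ‖y‖ → u x = u y) ∧
      ContinuousOn u (closedBall 0 1) ∧
      ContDiffOn ℝ 2 u (ball 0 1) ∧
      (∀ x ∈ ball (0 : EuclideanSpace ℝ (Fin N)) 1, 0 < u x) ∧
      (∀ x ∈ sphere (0 : EuclideanSpace ℝ (Fin N)) 1, u x = 0) ∧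
      (∀ x ∈ ball (0 : EuclideanSpace ℝ (Fin N)) 1,
        -laplacian u x = u x ^ (((N : ℝ) + 2) / ((N : ℝ) - 2)) + lam * k x * f (u x)) := by
  obtain ⟨m, rfl⟩ : ∃ m, N = m + 3 := ⟨N - 3, by omega⟩
  have hm : (0:ℝ) < (m:ℝ) + 1 := by positivity
  have hcast : ((m + 3 : ℕ) : ℝ) = (m:ℝ) + 3 := by push_cast; ring
  have hn2 : (m:ℝ) + 3 - 2 = m + 1 := by ring
  rw [hcast, hn2] at hf2b hf4
  obtain ⟨Ck, α, hα, -, hkh⟩ := hk_holder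
  obtain ⟨C0, δ0, hC0, hδ0, hk2⟩ := hk2
  obtain ⟨C1, δ1, hC1, hδ1, hk3⟩ := hk3
  obtain ⟨θ, hθ, hf3⟩ := hf3
  have hγ : 0 < γ := by linarith
  have fc : Continuous f := cont_of_holder f hf_holder
  have f0 : ∀ t, 0 ≤ f t := fun t => by
    rcases le_or_gt t 0 with h | h
    · rw [hf_zero t h]
    · exact hf_pos t h
  set pt : ℝ → EuclideanSpace ℝ (Fin (m + 3)) := fun r => EuclideanSpace.single 0 (max 0 (min r 1)) with hpt
  have hptn : ∀ r, ‖pt r‖ = max 0 (min r 1) := fun r => by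
    simp only [hpt]
    rw [EuclideanSpace.norm_single, Real.norm_eq_abs, abs_of_nonneg (le_max_left _ _)]
  have hptn1 : ∀ r, 0 ≤ r → r ≤ 1 → ‖pt r‖ = r := fun r h0 h1 => by
    rw [hptn, min_eq_left h1, max_eq_right h0]
  have hptc : Continuous pt := by
    have h1 : Continuous fun r : ℝ => r • EuclideanSpace.single (0 : Fin (m + 3)) (1:ℝ) := by fun_prop
    have h2 : Continuous fun r : ℝ => max 0 (min r 1) := by fun_prop
    refine (h1.comp h2).congr fun r => ?_
    ext i
    simp [hpt, Pi.single_apply]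
  have hptm : ∀ r, pt r ∈ closedBall (0 : EuclideanSpace ℝ (Fin (m + 3))) 1 := fun r => by
    rw [mem_closedBall_zero_iff, hptn]
    exact max_le zero_le_one (min_le_right _ _)
  set kr : ℝ → ℝ := fun r => lam * k (pt r) with hkr
  have krc : Continuous kr := continuous_const.mul ((hkh.continuousOn hα).comp_continuous hptc hptm)
  set σ : ℝ := 2 / ((m:ℝ) + 1) with hσd
  have hσ : 0 < σ := by positivity
  obtain ⟨Cκ, hCκ, hκu⟩ := κu_aux kr krc β (lam * C0) δ0 hβ (by positivity) hδ0 (fun r h0 h1 h2 => by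
    have h3 := hk2 (pt r) (by rw [hptn1 r h0 h1]; exact h2)
    rw [hptn1 r h0 h1] at h3
    have := mul_le_mul_of_nonneg_left h3 hlam.le
    simp only [hkr]; linarith)
  have hr1 : ∀ x : ℝ, 1 ≤ x → x ^ (-(σ / 2)) ≤ 1 := fun x hx => Real.rpow_le_one_of_one_le_of_nonpos hx (by linarith)
  have hrr : ∀ x a : ℝ, 1 ≤ x → (x ^ (-(σ / 2))) ^ a = x ^ (-(a * σ / 2)) := fun x a hx => by
    rw [← Real.rpow_mul (by linarith)]; congr 1; ring
  obtain ⟨xκ, hxκ1, hxκ⟩ : ∃ xκ : ℝ, 1 ≤ xκ ∧ ∀ x, xκ ≤ x → x ^ (-(σ / 2)) < δ1 := by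
    have h1 := (tendsto_rpow_neg_atTop (show 0 < σ / 2 by positivity)).eventually (Iio_mem_nhds hδ1)
    obtain ⟨a, ha⟩ := eventually_atTop.1 h1
    exact ⟨max a 1, le_max_right _ _, fun x hx => ha x ((le_max_left _ _).trans hx)⟩
  let D : Dat :=
    { σ := σ
      hσ := hσ
      κ := fun x => kr ((max x 1) ^ (-(σ / 2)))
      f := f
      κc := krc.comp (Continuous.rpow_const (by fun_prop) fun x => Or.inl (by
        have : 0 < max x 1 := lt_max_of_lt_right one_pos
        exact this.ne'))
      κ0 := fun x => mul_nonneg hlam.le (hk_nonneg _)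
      fc := fc
      f0 := f0
      fz := hf_zero
      β := β
      γ := γ
      hβ := hβ
      hγ := hγ
      Cκ := Cκ
      hCκ := hCκ
      κu := fun x hx => by
        have h1 := hκu (x ^ (-(σ / 2))) (Real.rpow_nonneg (by linarith) _) (hr1 x hx)
        rw [hrr x β hx] at h1
        simp only [max_eq_left hx]
        exact h1
      cκ := lam * C1
      hcκ := by positivity
      xκ := xκ
      hxκ := hxκ1
      κl := fun x hx => by
        have hx1 := hxκ1.trans hx
        have hp : 0 < x ^ (-(σ / 2)) := Real.rpow_pos_of_pos (by linarith) _
        have e := hptn1 _ hp.le (hr1 x hx1)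
        have h1 := hk3 (pt (x ^ (-(σ / 2)))) (by rw [e]; exact hp) (by rw [e]; exact hxκ x hx)
        rw [e, hrr x γ hx1] at h1
        simp only [max_eq_left hx1, hkr]
        have := mul_le_mul_of_nonneg_left h1 hlam.le
        linarith
      fs := fun ε hε => fs_aux f hf_zero hf2a ε hε
      fl := fun ε hε => by
        have e : 2 * σ + 1 + β * σ = ((m:ℝ) + 3 + 2 + 2 * β) / (m + 1) := by rw [hσd]; field_simp; ring
        rw [e]
        exact fl_aux f fc hf_zero _ hf2a hf2b ε hε
      θ := θ
      hθ := hθ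
      f3 := hf3
      f4 := fun M => by
        refine f4_aux f fc f0 _ _ (le_max_left _ _) ?_ hf4 M
        have e : γ * σ + 2 * σ = (2 * γ + 6 - ((m:ℝ) + 3)) / (m + 1) + 1 := by rw [hσd]; field_simp; ring
        rw [e]
        linarith [le_max_right 1 ((2 * γ + 6 - ((m:ℝ) + 3)) / ((m:ℝ) + 1))] }
  obtain ⟨v, hv1, hv2, hv3, hv4, hv5⟩ := D.final m rfl kr krc (fun r h0 h1 => by
    have h2 : 1 ≤ (r ^ (m + 1))⁻¹ := (one_le_inv₀ (by positivity)).2 (pow_le_one₀ h0.le h1)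
    change kr ((max (r ^ (m + 1))⁻¹ 1) ^ (-(σ / 2))) = kr r
    rw [max_eq_left h2, Real.rpow_neg (by positivity), Real.inv_rpow (by positivity), inv_inv, ← Real.rpow_natCast, ← Real.rpow_mul h0.le]
    have : ((m + 1 : ℕ) : ℝ) * (σ / 2) = 1 := by rw [hσd]; push_cast; field_simp
    rw [this, Real.rpow_one])
  refine ⟨v, hv1, hv2.continuous.continuousOn, hv2.contDiffOn, fun x hx => hv3 x (mem_ball_zero_iff.1 hx),
    fun x hx => hv4 x (mem_sphere_zero_iff_norm.1 hx), fun x hx => ?_⟩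
  have hx := mem_ball_zero_iff.1 hx
  rw [hv5 x hx]
  have e1 : (((m + 3 : ℕ) : ℝ) + 2) / (((m + 3 : ℕ) : ℝ) - 2) = 2 * σ + 1 := by
    rw [hcast, hn2, hσd]; field_simp; ring
  have e2 : kr ‖x‖ = lam * k x := by
    simp only [hkr]
    rw [hk_radial (pt ‖x‖) x (hptn1 _ (norm_nonneg _) hx.le)]
  rw [e1, e2]
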